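/- arXiv:1002.3630 — 6 statements merged into one kernel-verified Lean document; each statement's English description precedes it below -/
import Mathlib

section
/- Let m ≥ 2 and let a ∈ ℂᵐ be a nonzero vector. Then the functions τ ↦ (a|τ)^{j₁} · conj((a|τ))^{j₂}, for (j₁,j₂) ∈ ℕ², regarded as complex-valued functions on the unit sphere S^{2m-1} = {τ ∈ ℂᵐ : |τ| = 1}, are linearly independent over ℂ: if a finite linear combination Σ c_{j₁ j₂} (a|τ)^{j₁} conj((a|τ))^{j₂} vanishes for all τ ∈ ℂᵐ with |τ| = 1, then all coefficients c_{j₁ j₂} ∈ ℂ are zero. -/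
/-- A complex polynomial in two variables that vanishes at all pairs `(z, conj z)` with `z` in a
disk around `0` is the zero polynomial. -/
theorem MvPolynomial.eq_zero_of_eval_conj_eq_zero {r : ℝ} (hr : 0 < r)
    (p : MvPolynomial (Fin 2) ℂ)
    (h : ∀ z : ℂ, ‖z‖ < r → eval ![z, starRingEnd ℂ z] p = 0) : p = 0 := by
  let q : MvPolynomial (Fin 2) ℂ :=
    bind₁ ![X 0 + C Complex.I * X 1, X 0 - C Complex.I * X 1] p
  have eval_q (v : Fin 2 → ℂ) :
      eval v q = eval ![v 0 + Complex.I * v 1, v 0 - Complex.I * v 1] p := by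
    have h_subst : (fun i ↦ eval v ((![X 0 + C Complex.I * X 1, X 0 - C Complex.I * X 1] :
        Fin 2 → MvPolynomial (Fin 2) ℂ) i)) =
        ![v 0 + Complex.I * v 1, v 0 - Complex.I * v 1] := by
      funext i
      fin_cases i <;> simp
    rw [← h_subst]
    exact eval₂Hom_bind₁ _ _ _ _
  have q_zero : q = 0 := by
    refine funext_set (fun _ ↦ (fun x : ℝ ↦ (x : ℂ)) '' Set.Ioo 0 (r / 2))
      (fun _ ↦ (Set.Ioo_infinite (by positivity)).image Complex.ofReal_injective.injOn) ?_
    intro v hv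
    obtain ⟨x, ⟨hx0, hxr⟩, hx⟩ := hv 0 trivial
    obtain ⟨y, ⟨hy0, hyr⟩, hy⟩ := hv 1 trivial
    have hz : ‖(x : ℂ) + Complex.I * y‖ < r := by
      calc ‖(x : ℂ) + Complex.I * y‖ ≤ ‖(x : ℂ)‖ + ‖Complex.I * (y : ℂ)‖ := norm_add_le _ _
        _ = x + y := by simp [abs_of_pos hx0, abs_of_pos hy0]
        _ < r := by linarith
    have := h _ hz
    rw [eval_q, ← hx, ← hy, map_zero]
    simpa [sub_eq_add_neg] using this
  refine funext fun v ↦ ?_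
  have := eval_q ![(v 0 + v 1) / 2, (v 0 - v 1) / (2 * Complex.I)]
  rw [q_zero, map_zero] at this
  rw [map_zero, this]
  congr 2
  funext i
  have hI := Complex.I_ne_zero
  fin_cases i <;> simp <;> field_simp <;> ring

/-- In dimension at least two, the inner products of unit vectors with `a` fill the disk of
radius `‖a‖`. -/
theorem exists_norm_eq_one_inner_eq {E : Type*} [NormedAddCommGroup E] [InnerProductSpace ℂ E]
    [FiniteDimensional ℂ E] (hE : 2 ≤ Module.finrank ℂ E) {a : E} (ha : a ≠ 0) {z : ℂ}
    (hz : ‖z‖ ≤ ‖a‖) : ∃ τ : E, ‖τ‖ = 1 ∧ inner ℂ τ a = z := by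
  have ha' : 0 < ‖a‖ := norm_pos_iff.mpr ha
  have h_rank := (Submodule.span ℂ {a}).finrank_add_finrank_orthogonal
  rw [finrank_span_singleton ha] at h_rank
  have : Nontrivial (Submodule.span ℂ {a})ᗮ :=
    Module.nontrivial_of_finrank_pos (R := ℂ) (by omega)
  obtain ⟨b, hb⟩ := exists_norm_eq (Submodule.span ℂ {a})ᗮ zero_le_one
  have hba : inner ℂ (b : E) a = 0 :=
    Submodule.inner_left_of_mem_orthogonal (Submodule.mem_span_singleton_self a) b.2
  have hb' : ‖(b : E)‖ = 1 := hb
  have h_le : (‖z‖ / ‖a‖) ^ 2 ≤ 1 :=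
    pow_le_one₀ (by positivity) ((div_le_one ha').mpr hz)
  refine ⟨(starRingEnd ℂ z / (‖a‖ : ℂ) ^ 2) • a +
    (Real.sqrt (1 - (‖z‖ / ‖a‖) ^ 2) : ℂ) • (b : E), ?_, ?_⟩
  · rw [← sq_eq_sq₀ (norm_nonneg _) zero_le_one, sq,
      norm_add_sq_eq_norm_sq_add_norm_sq_of_inner_eq_zero (𝕜 := ℂ)]
    · simp only [norm_smul, hb', norm_div, RCLike.norm_conj, norm_pow, Complex.norm_real,
        abs_norm, Real.norm_eq_abs, abs_of_nonneg (Real.sqrt_nonneg _), mul_one,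
        Real.mul_self_sqrt (sub_nonneg.mpr h_le)]
      field_simp
      ring
    · rw [inner_smul_left, inner_smul_right, ← inner_conj_symm, hba]
      simp
  · rw [inner_add_left, inner_smul_left, inner_smul_left, hba, inner_self_eq_norm_sq_to_K]
    have : (‖a‖ : ℂ) ≠ 0 := by exact_mod_cast ha'.ne'
    simp
    field_simp


/-- Let `m ≥ 2` and `a ∈ ℂᵐ` nonzero.  The functions `τ ↦ (a|τ)^{j₁} conj((a|τ))^{j₂}`,
`(j₁,j₂) ∈ ℕ²`, are linearly independent over `ℂ` as functions on the unit sphere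
`S^{2m-1} ⊂ ℂᵐ`.  Here `(a|τ) = ∑ aᵢ conj(τᵢ)` is the Hermitian inner product. -/
theorem hermitian_powers_linearIndependent_on_sphere
    (m : ℕ) (hm : 2 ≤ m) (a : EuclideanSpace ℂ (Fin m)) (ha : a ≠ 0)
    (s : Finset (ℕ × ℕ)) (c : ℕ × ℕ → ℂ)
    (h : ∀ τ : EuclideanSpace ℂ (Fin m), ‖τ‖ = 1 →
      ∑ j ∈ s, c j * (@inner ℂ _ _ τ a) ^ j.1 * (starRingEnd ℂ (@inner ℂ _ _ τ a)) ^ j.2 = 0) :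
    ∀ j ∈ s, c j = 0 := by
  let e (j : ℕ × ℕ) : Fin 2 →₀ ℕ := Finsupp.single 0 j.1 + Finsupp.single 1 j.2
  have he : Function.Injective e := fun j k hjk ↦
    Prod.ext (by simpa [e] using DFunLike.congr_fun hjk 0)
      (by simpa [e] using DFunLike.congr_fun hjk 1)
  have hp : ∑ j ∈ s, MvPolynomial.monomial (e j) (c j) = 0 := by
    refine MvPolynomial.eq_zero_of_eval_conj_eq_zero (norm_pos_iff.mpr ha) _ fun z hz ↦ ?_
    obtain ⟨τ, hτ, rfl⟩ := exists_norm_eq_one_inner_eq (by simpa using hm) ha hz.le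
    rw [← h τ hτ, map_sum]
    refine Finset.sum_congr rfl fun j _ ↦ ?_
    simp [e, MvPolynomial.eval_monomial, Finsupp.prod_fintype, mul_assoc]
  intro k hk
  have := congr_arg (MvPolynomial.coeff (e k)) hp
  simpa [MvPolynomial.coeff_sum, MvPolynomial.coeff_monomial, he.eq_iff, hk] using this
end

section
/- Let d ≥ 1. For every multi-index α ∈ ℕ^d and all σ, τ ∈ ℕ there exist a constant C > 0 and an integer q ∈ ℕ such that: for every g ∈ 𝓢(ℝ^d) all of whose partial derivatives (of every order, including order zero) vanish at every point η with η_d = 0, and for every η ∈ ℝ^d, one has |∂^α g(η)| ≤ C ‖g‖_{(q)} |η_d|^σ (1+|η|)^{-τ}. -/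
/-- The `q`-th Schwartz norm `‖g‖_{(q)} = ∑_{j ≤ q} sup_η (1+|η|)^q ‖D^j g(η)‖`. -/
noncomputable def schwartzPNorm (d q : ℕ) (g : SchwartzMap (EuclideanSpace ℝ (Fin d)) ℂ) : ℝ :=
  ∑ j ∈ Finset.range (q + 1),
    ⨆ η : EuclideanSpace ℝ (Fin d), (1 + ‖η‖) ^ q * ‖iteratedFDeriv ℝ j (⇑g) η‖

theorem bddAbove_one_add_norm_pow_mul_iteratedFDeriv {d : ℕ}
    (g : SchwartzMap (EuclideanSpace ℝ (Fin d)) ℂ) (q j : ℕ) :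
    BddAbove (Set.range fun η : EuclideanSpace ℝ (Fin d) =>
      (1 + ‖η‖) ^ q * ‖iteratedFDeriv ℝ j (⇑g) η‖) := by
  refine ⟨2 ^ q * ((Finset.Iic (q, j)).sup fun m => SchwartzMap.seminorm ℝ m.1 m.2) g, ?_⟩
  rintro _ ⟨η, rfl⟩
  exact SchwartzMap.one_add_le_sup_seminorm_apply (m := (q, j)) le_rfl le_rfl g η

theorem one_add_norm_pow_mul_iteratedFDeriv_le_schwartzPNorm {d q j k : ℕ} (hj : j ≤ q)
    (hk : k ≤ q) (g : SchwartzMap (EuclideanSpace ℝ (Fin d)) ℂ) (η : EuclideanSpace ℝ (Fin d)) :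
    (1 + ‖η‖) ^ k * ‖iteratedFDeriv ℝ j (⇑g) η‖ ≤ schwartzPNorm d q g := by
  have h_one : (1 : ℝ) ≤ 1 + ‖η‖ := by linarith [norm_nonneg η]
  calc (1 + ‖η‖) ^ k * ‖iteratedFDeriv ℝ j (⇑g) η‖
      ≤ (1 + ‖η‖) ^ q * ‖iteratedFDeriv ℝ j (⇑g) η‖ := by gcongr
    _ ≤ ⨆ ξ : EuclideanSpace ℝ (Fin d), (1 + ‖ξ‖) ^ q * ‖iteratedFDeriv ℝ j (⇑g) ξ‖ :=
        le_ciSup (bddAbove_one_add_norm_pow_mul_iteratedFDeriv g q j) η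
    _ ≤ schwartzPNorm d q g :=
        Finset.single_le_sum
          (f := fun j => ⨆ ξ : EuclideanSpace ℝ (Fin d),
            (1 + ‖ξ‖) ^ q * ‖iteratedFDeriv ℝ j (⇑g) ξ‖)
          (fun _ _ => Real.iSup_nonneg fun _ => by positivity)
          (Finset.mem_range.2 (Nat.lt_succ_of_le hj))

/-- Near a coordinate hyperplane on which all derivatives of `g` vanish, each integration in the
normal direction gains one power of the normal coordinate. -/
theorem one_add_norm_pow_mul_iteratedFDeriv_le_of_vanishing {d : ℕ} (i : Fin d)
    {g : EuclideanSpace ℝ (Fin d) → ℂ} (hg : ContDiff ℝ (⊤ : ℕ∞) g)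
    (hvan : ∀ j : ℕ, ∀ η : EuclideanSpace ℝ (Fin d), η i = 0 → iteratedFDeriv ℝ j g η = 0)
    {q k : ℕ} {B : ℝ}
    (hB : ∀ j ≤ q, ∀ η : EuclideanSpace ℝ (Fin d), (1 + ‖η‖) ^ k * ‖iteratedFDeriv ℝ j g η‖ ≤ B)
    (σ N : ℕ) (hN : N + σ ≤ q) (η : EuclideanSpace ℝ (Fin d)) (hη : |η i| ≤ 1) :
    (1 + ‖η‖) ^ k * ‖iteratedFDeriv ℝ N g η‖ ≤ (2 ^ k) ^ σ * B * |η i| ^ σ := by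
  induction σ generalizing N η with
  | zero => simpa using hB N (by omega) η
  | succ σ ih =>
    have hB_nonneg : 0 ≤ B := le_trans (by positivity) (hB 0 (Nat.zero_le q) 0)
    set v : EuclideanSpace ℝ (Fin d) := η i • EuclideanSpace.single i (1 : ℝ) with hv
    have hvi : v i = η i := by simp [hv]
    have hv_norm : ‖v‖ = |η i| := by simp [hv, norm_smul]
    have hpos : 0 < (1 + ‖η‖) ^ k := by positivity
    have hbound : ∀ ζ ∈ segment ℝ (η - v) η,
        ‖fderiv ℝ (iteratedFDeriv ℝ N g) ζ‖ ≤
          2 ^ k * ((2 ^ k) ^ σ * B * |η i| ^ σ) / (1 + ‖η‖) ^ k := by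
      intro ζ hζ
      rw [segment_eq_image'] at hζ
      obtain ⟨θ, ⟨h0, h1⟩, rfl⟩ := hζ
      simp only [sub_sub_cancel]
      set ζ := η - v + θ • v with hζ
      have hζi : |ζ i| ≤ |η i| := by
        have : ζ i = θ * η i := by simp [hζ, hvi]
        rw [this, abs_mul, abs_of_nonneg h0]
        exact mul_le_of_le_one_left (abs_nonneg _) h1
      have hdist : ‖η‖ ≤ ‖ζ‖ + 1 := by
        have h_eq : η = ζ + (1 - θ) • v := by rw [hζ]; module
        have h_le : ‖(1 - θ) • v‖ ≤ 1 := by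
          rw [norm_smul, hv_norm, Real.norm_of_nonneg (by linarith)]
          nlinarith [abs_nonneg (η i)]
        calc ‖η‖ = ‖ζ + (1 - θ) • v‖ := by rw [← h_eq]
          _ ≤ ‖ζ‖ + ‖(1 - θ) • v‖ := norm_add_le _ _
          _ ≤ ‖ζ‖ + 1 := by linarith
      rw [norm_fderiv_iteratedFDeriv, le_div_iff₀ hpos]
      calc ‖iteratedFDeriv ℝ (N + 1) g ζ‖ * (1 + ‖η‖) ^ k
          ≤ ‖iteratedFDeriv ℝ (N + 1) g ζ‖ * (2 * (1 + ‖ζ‖)) ^ k := by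
            gcongr; linarith [norm_nonneg ζ]
        _ = 2 ^ k * ((1 + ‖ζ‖) ^ k * ‖iteratedFDeriv ℝ (N + 1) g ζ‖) := by rw [mul_pow]; ring
        _ ≤ 2 ^ k * ((2 ^ k) ^ σ * B * |ζ i| ^ σ) := by
            exact mul_le_mul_of_nonneg_left (ih (N + 1) (by omega) ζ (hζi.trans hη))
              (by positivity)
        _ ≤ 2 ^ k * ((2 ^ k) ^ σ * B * |η i| ^ σ) := by gcongr
    have hdiff : Differentiable ℝ (iteratedFDeriv ℝ N g) :=
      hg.differentiable_iteratedFDeriv (by exact_mod_cast WithTop.coe_lt_top N)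
    have hmvt := (convex_segment (𝕜 := ℝ) (η - v) η).norm_image_sub_le_of_norm_fderiv_le
      (fun ζ _ => hdiff ζ) hbound (left_mem_segment ℝ _ _) (right_mem_segment ℝ _ _)
    rw [hvan N (η - v) (by simp [hvi]), sub_zero, sub_sub_cancel, hv_norm, div_mul_eq_mul_div,
      le_div_iff₀ hpos] at hmvt
    calc (1 + ‖η‖) ^ k * ‖iteratedFDeriv ℝ N g η‖
        = ‖iteratedFDeriv ℝ N g η‖ * (1 + ‖η‖) ^ k := mul_comm _ _
      _ ≤ 2 ^ k * ((2 ^ k) ^ σ * B * |η i| ^ σ) * |η i| := hmvt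
      _ = (2 ^ k) ^ (σ + 1) * B * |η i| ^ (σ + 1) := by ring

/-- If all derivatives of a Schwartz function `g` on `ℝ^d` vanish at every point of the
hyperplane `{η_d = 0}`, then every derivative `∂^α g` satisfies estimates
`|∂^α g(η)| ≤ C ‖g‖_{(q)} |η_d|^σ (1+|η|)^{-τ}`, with `C` and `q` independent of `g`. -/
theorem derivative_decay_estimate (d : ℕ) (hd : 1 ≤ d) (N σ τ : ℕ) :
    ∃ C > (0 : ℝ), ∃ q : ℕ,
      ∀ g : SchwartzMap (EuclideanSpace ℝ (Fin d)) ℂ,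
        (∀ j : ℕ, ∀ η : EuclideanSpace ℝ (Fin d),
          η ⟨d - 1, by omega⟩ = 0 → iteratedFDeriv ℝ j (⇑g) η = 0) →
        ∀ η : EuclideanSpace ℝ (Fin d),
          ‖iteratedFDeriv ℝ N (⇑g) η‖ ≤
            C * schwartzPNorm d q g * |η ⟨d - 1, by omega⟩| ^ σ / (1 + ‖η‖) ^ τ := by
  refine ⟨(2 ^ τ) ^ σ, by positivity, N + σ + τ, fun g hvan η => ?_⟩
  have hB : ∀ j ≤ N + σ + τ, ∀ ξ : EuclideanSpace ℝ (Fin d),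
      (1 + ‖ξ‖) ^ τ * ‖iteratedFDeriv ℝ j (⇑g) ξ‖ ≤ schwartzPNorm d (N + σ + τ) g :=
    fun j hj ξ => one_add_norm_pow_mul_iteratedFDeriv_le_schwartzPNorm hj (by omega) g ξ
  rw [le_div_iff₀ (by positivity), mul_comm]
  rcases le_total |η ⟨d - 1, by omega⟩| 1 with h | h
  · exact one_add_norm_pow_mul_iteratedFDeriv_le_of_vanishing _ g.smooth' hvan hB σ N
      (by omega) η h
  · have hη := hB N (by omega) η
    have hS : 0 ≤ schwartzPNorm d (N + σ + τ) g := le_trans (by positivity) hη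
    have h_two : (1 : ℝ) ≤ (2 ^ τ) ^ σ := one_le_pow₀ (one_le_pow₀ one_le_two)
    calc _ ≤ schwartzPNorm d (N + σ + τ) g := hη
      _ ≤ (2 ^ τ) ^ σ * schwartzPNorm d (N + σ + τ) g := le_mul_of_one_le_left hS h_two
      _ ≤ _ := le_mul_of_one_le_right (by positivity) (one_le_pow₀ h)
end

section
/- Let 𝕂 be ℝ or ℂ, let A = 𝕂[x₁,…,x_N] be a polynomial algebra with its standard grading by total degree, and let B ⊆ A be a subalgebra. Suppose B is generated as a 𝕂-algebra by homogeneous, algebraically independent polynomials a₁,…,a_m, and suppose b₁,…,b_m ∈ B are homogeneous, algebraically independent polynomials with deg bᵢ = deg aᵢ for each i. Then B is generated as a 𝕂-algebra by b₁,…,b_m. -/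
open MvPolynomial in
/-- Substituting homogeneous polynomials of degrees `w i` for the variables turns a weighted
homogeneous polynomial into a homogeneous one. -/
theorem MvPolynomial.IsWeightedHomogeneous.isHomogeneous_aeval {R σ τ : Type*} [CommSemiring R]
    {a : σ → MvPolynomial τ R} {w : σ → ℕ} (ha : ∀ i, (a i).IsHomogeneous (w i))
    {q : MvPolynomial σ R} {n : ℕ} (hq : IsWeightedHomogeneous w q n) :
    (aeval a q).IsHomogeneous n := by
  rw [aeval_def, eval₂_eq]
  refine IsHomogeneous.sum _ _ _ fun d hd => ?_
  rw [algebraMap_eq]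
  refine IsHomogeneous.C_mul ?_ _
  rw [← hq (mem_support_iff.mp hd), Finsupp.weight_apply, Finsupp.sum]
  refine IsHomogeneous.prod _ _ _ fun i _ => ?_
  rw [smul_eq_mul, mul_comm]
  exact (ha i).pow _

open MvPolynomial in
/-- Substituting homogeneous polynomials of degrees `w i` for the variables commutes with taking
graded components. -/
theorem MvPolynomial.homogeneousComponent_aeval {R σ τ : Type*} [CommSemiring R]
    {a : σ → MvPolynomial τ R} {w : σ → ℕ} (ha : ∀ i, (a i).IsHomogeneous (w i))
    (n : ℕ) (q : MvPolynomial σ R) :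
    homogeneousComponent n (aeval a q) = aeval a (weightedHomogeneousComponent w n q) := by
  induction q using MvPolynomial.induction_on' with
  | monomial d r =>
    have h := isWeightedHomogeneous_monomial w d r rfl
    rw [homogeneousComponent_of_mem (h.isHomogeneous_aeval ha),
      weightedHomogeneousComponent_of_mem h]
    split_ifs
    · rfl
    · exact (map_zero _).symm
  | add p q hp hq => simp only [map_add, hp, hq]

open MvPolynomial in
/-- The degree of a homogeneous member of an algebraically independent family is nonzero. -/
theorem AlgebraicIndependent.degree_ne_zero {R ι τ : Type*} [CommRing R] [Nontrivial R]
    {a : ι → MvPolynomial τ R} (ha : AlgebraicIndependent R a) {i : ι} {n : ℕ}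
    (hi : (a i).IsHomogeneous n) : n ≠ 0 := by
  rintro rfl
  apply ha.transcendental i
  rw [totalDegree_eq_zero_iff_eq_C.mp
    ((totalDegree_zero_iff_isHomogeneous τ).mpr hi)]
  exact isAlgebraic_algebraMap _

open MvPolynomial in
/-- The homogeneous elements of degree `n` of a subalgebra generated by homogeneous polynomials are
the images of the weighted homogeneous polynomials of degree `n`. -/
theorem MvPolynomial.map_aeval_weightedHomogeneousSubmodule {R σ τ : Type*} [CommSemiring R]
    {a : σ → MvPolynomial τ R} {w : σ → ℕ} (ha : ∀ i, (a i).IsHomogeneous (w i)) (n : ℕ) :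
    (weightedHomogeneousSubmodule R w n).map (aeval a).toLinearMap =
      Subalgebra.toSubmodule (Algebra.adjoin R (Set.range a)) ⊓ homogeneousSubmodule τ R n := by
  ext p
  rw [Algebra.adjoin_range_eq_range_aeval]
  constructor
  · rintro ⟨q, hq, rfl⟩
    exact ⟨⟨q, rfl⟩, IsWeightedHomogeneous.isHomogeneous_aeval ha hq⟩
  · rintro ⟨⟨q, rfl⟩, hp⟩
    refine ⟨weightedHomogeneousComponent w n q, weightedHomogeneousComponent_mem w q n, ?_⟩
    exact (homogeneousComponent_aeval ha n q).symm.trans (homogeneousComponent_eq_self hp)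

/-- **Generators from degrees.**
Let `𝕜` be `ℝ` or `ℂ` and `A = 𝕜[x₁,…,x_N]` with its standard grading.  If a subalgebra
`B ⊆ A` is generated by homogeneous algebraically independent polynomials `a₁,…,a_m`, and
`b₁,…,b_m ∈ B` are homogeneous algebraically independent with `deg bᵢ = deg aᵢ`, then `B`
is generated by `b₁,…,b_m`. -/
theorem subalgebra_generated_by_same_degrees
    {𝕜 : Type} [RCLike 𝕜] (N m : ℕ)
    (B : Subalgebra 𝕜 (MvPolynomial (Fin N) 𝕜))
    (a b : Fin m → MvPolynomial (Fin N) 𝕜) (deg : Fin m → ℕ)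
    (ha_hom : ∀ i, (a i).IsHomogeneous (deg i))
    (hb_hom : ∀ i, (b i).IsHomogeneous (deg i))
    (ha_ind : AlgebraicIndependent 𝕜 a)
    (hb_ind : AlgebraicIndependent 𝕜 b)
    (ha_gen : Algebra.adjoin 𝕜 (Set.range a) = B)
    (hb_mem : ∀ i, b i ∈ B) :
    Algebra.adjoin 𝕜 (Set.range b) = B := by
  have hle : Algebra.adjoin 𝕜 (Set.range b) ≤ B :=
    Algebra.adjoin_le (Set.range_subset_iff.mpr hb_mem)
  refine le_antisymm hle ?_
  subst ha_gen
  refine Algebra.adjoin_le (Set.range_subset_iff.mpr fun i => ?_)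
  have hW : Module.Finite 𝕜 (MvPolynomial.weightedHomogeneousSubmodule 𝕜 deg (deg i)) :=
    Module.Finite.iff_fg.mpr (MvPolynomial.weightedHomogeneousSubmodule_fg _ deg
      (fun j => ha_ind.degree_ne_zero (ha_hom j)) (deg i))
  have ha_map := MvPolynomial.map_aeval_weightedHomogeneousSubmodule ha_hom (deg i)
  have hb_map := MvPolynomial.map_aeval_weightedHomogeneousSubmodule hb_hom (deg i)
  have hmap_le : (MvPolynomial.weightedHomogeneousSubmodule 𝕜 deg (deg i)).map
      (MvPolynomial.aeval b).toLinearMap ≤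
      (MvPolynomial.weightedHomogeneousSubmodule 𝕜 deg (deg i)).map
      (MvPolynomial.aeval a).toLinearMap := by
    rw [ha_map, hb_map]
    exact inf_le_inf_right _ hle
  have heq := Submodule.eq_of_le_of_finrank_eq hmap_le
    ((Submodule.equivMapOfInjective (MvPolynomial.aeval b).toLinearMap
      hb_ind _).finrank_eq.symm.trans
      (Submodule.equivMapOfInjective (MvPolynomial.aeval a).toLinearMap ha_ind _).finrank_eq)
  rw [ha_map, hb_map] at heq
  exact (heq.ge ⟨Algebra.subset_adjoin (Set.mem_range_self i), ha_hom i⟩).1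
end

section
/- Consider the action of SU(3) on ℂ³ × ℂ³ given by k·(v,z) = (kv, conj(k)z). Every real-valued polynomial function P on ℂ³ × ℂ³ (polynomial in the real coordinates) satisfying P(kv, conj(k)z) = P(v,z) for all k ∈ SU(3) is a real polynomial in the four functions |v|², |z|², Re(Σ_{ℓ=1}^3 v_ℓ z_ℓ), Im(Σ_{ℓ=1}^3 v_ℓ z_ℓ). -/
open MvPolynomial in
/-- The polynomial functions of `(a, x, y, b)` become, after multiplication by a power of `a ^ 2`,
combinations of `1, a, b, a * b` with coefficients that are polynomials in
`a ^ 2, x ^ 2 + y ^ 2 + b ^ 2, a * x, a * y`. -/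
def HasSlicePresentation (h : ℝ → ℝ → ℝ → ℝ → ℝ) : Prop :=
  ∃ (N : ℕ) (Q₀ Q₁ Q₂ Q₃ : MvPolynomial (Fin 4) ℝ), ∀ a x y b : ℝ,
    (a ^ 2) ^ N * h a x y b =
      eval ![a ^ 2, x ^ 2 + y ^ 2 + b ^ 2, a * x, a * y] Q₀ +
      a * eval ![a ^ 2, x ^ 2 + y ^ 2 + b ^ 2, a * x, a * y] Q₁ +
      b * eval ![a ^ 2, x ^ 2 + y ^ 2 + b ^ 2, a * x, a * y] Q₂ +
      a * b * eval ![a ^ 2, x ^ 2 + y ^ 2 + b ^ 2, a * x, a * y] Q₃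

namespace HasSlicePresentation

open MvPolynomial

variable {h g : ℝ → ℝ → ℝ → ℝ → ℝ}

theorem const (r : ℝ) : HasSlicePresentation fun _ _ _ _ => r :=
  ⟨0, C r, 0, 0, 0, fun a x y b => by simp⟩

theorem add (hh : HasSlicePresentation h) (hg : HasSlicePresentation g) :
    HasSlicePresentation fun a x y b => h a x y b + g a x y b := by
  obtain ⟨N, P₀, P₁, P₂, P₃, hP⟩ := hh
  obtain ⟨M, Q₀, Q₁, Q₂, Q₃, hQ⟩ := hg
  refine ⟨N + M, X 0 ^ M * P₀ + X 0 ^ N * Q₀, X 0 ^ M * P₁ + X 0 ^ N * Q₁,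
    X 0 ^ M * P₂ + X 0 ^ N * Q₂, X 0 ^ M * P₃ + X 0 ^ N * Q₃, fun a x y b => ?_⟩
  simp only [map_add, map_mul, map_pow, eval_X, Matrix.cons_val]
  linear_combination (a ^ 2) ^ M * hP a x y b + (a ^ 2) ^ N * hQ a x y b

theorem mul_fst (hh : HasSlicePresentation h) :
    HasSlicePresentation fun a x y b => h a x y b * a := by
  obtain ⟨N, P₀, P₁, P₂, P₃, hP⟩ := hh
  refine ⟨N, X 0 * P₁, P₀, X 0 * P₃, P₂, fun a x y b => ?_⟩
  simp only [map_mul, eval_X, Matrix.cons_val]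
  linear_combination a * hP a x y b

theorem mul_re (hh : HasSlicePresentation h) :
    HasSlicePresentation fun a x y b => h a x y b * x := by
  obtain ⟨N, P₀, P₁, P₂, P₃, hP⟩ := hh
  refine ⟨N + 1, X 2 * (X 0 * P₁), X 2 * P₀, X 2 * (X 0 * P₃), X 2 * P₂, fun a x y b => ?_⟩
  simp only [map_mul, eval_X, Matrix.cons_val]
  linear_combination a ^ 2 * x * hP a x y b

theorem mul_im (hh : HasSlicePresentation h) :
    HasSlicePresentation fun a x y b => h a x y b * y := by
  obtain ⟨N, P₀, P₁, P₂, P₃, hP⟩ := hh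
  refine ⟨N + 1, X 3 * (X 0 * P₁), X 3 * P₀, X 3 * (X 0 * P₃), X 3 * P₂, fun a x y b => ?_⟩
  simp only [map_mul, eval_X, Matrix.cons_val]
  linear_combination a ^ 2 * y * hP a x y b

theorem mul_snd (hh : HasSlicePresentation h) :
    HasSlicePresentation fun a x y b => h a x y b * b := by
  obtain ⟨N, P₀, P₁, P₂, P₃, hP⟩ := hh
  refine ⟨N + 1, (X 0 * X 1 - X 2 ^ 2 - X 3 ^ 2) * P₂, (X 0 * X 1 - X 2 ^ 2 - X 3 ^ 2) * P₃,
    X 0 * P₀, X 0 * P₁, fun a x y b => ?_⟩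
  simp only [map_sub, map_mul, map_pow, eval_X, Matrix.cons_val]
  linear_combination a ^ 2 * b * hP a x y b

/-- A function with a slice presentation and invariant under `(a, x, y) ↦ -(a, x, y)` and `b ↦ -b`
only needs the constant coefficient. -/
theorem exists_eval_of_even (hh : HasSlicePresentation h)
    (h₁ : ∀ a x y b, h (-a) (-x) (-y) b = h a x y b) (h₂ : ∀ a x y b, h a x y (-b) = h a x y b) :
    ∃ (N : ℕ) (Q : MvPolynomial (Fin 4) ℝ), ∀ a x y b : ℝ,
      (a ^ 2) ^ N * h a x y b = eval ![a ^ 2, x ^ 2 + y ^ 2 + b ^ 2, a * x, a * y] Q := by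
  obtain ⟨N, P₀, P₁, P₂, P₃, hP⟩ := hh
  refine ⟨N, P₀, fun a x y b => ?_⟩
  have e₁ := hP a x y b
  have e₂ := hP a x y (-b)
  have e₃ := hP (-a) (-x) (-y) b
  have e₄ := hP (-a) (-x) (-y) (-b)
  simp only [h₁, h₂, neg_sq, neg_mul_neg] at e₂ e₃ e₄
  linear_combination (e₁ + e₂ + e₃ + e₄) / 4

theorem eval_slice (p : MvPolynomial ((Fin 3 ⊕ Fin 3) ⊕ (Fin 3 ⊕ Fin 3)) ℝ) :
    HasSlicePresentation fun a x y b => eval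
      (Sum.elim (fun s => (Sum.elim ![(a : ℂ), 0, 0] ![⟨x, y⟩, (b : ℂ), 0] s).re)
        fun s => (Sum.elim ![(a : ℂ), 0, 0] ![⟨x, y⟩, (b : ℂ), 0] s).im) p := by
  induction p using MvPolynomial.induction_on with
  | C r => simpa using const r
  | add p q hp hq => simpa using hp.add hq
  | mul_X p i hp =>
    simp only [map_mul, eval_X]
    rcases i with (i | i) | (i | i) <;> fin_cases i
    all_goals
      first
      | simpa using hp.mul_fst
      | simpa using hp.mul_re
      | simpa using hp.mul_im
      | simpa using hp.mul_snd
      | simpa using const 0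

end HasSlicePresentation

/-- Every complex number can be rotated to a real number. -/
theorem Complex.exists_mul_conj_eq_one_mul_eq_norm (c : ℂ) :
    ∃ u : ℂ, u * (starRingEnd ℂ) u = 1 ∧ u * c = ‖c‖ := by
  by_cases hc : c = 0
  · exact ⟨1, by simp [hc]⟩
  · have h : (‖c‖ : ℂ) ≠ 0 := by simpa using hc
    have hcc : c * (starRingEnd ℂ) c = (‖c‖ : ℂ) ^ 2 := Complex.mul_conj' c
    refine ⟨(starRingEnd ℂ) c / ‖c‖, ?_, ?_⟩
    · simp only [map_div₀, Complex.conj_conj, Complex.conj_ofReal]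
      field_simp
      linear_combination hcc
    · field_simp
      linear_combination hcc

namespace Matrix

/-- Multiplying the rows of a unitary matrix by phases gives a unitary matrix. -/
theorem diagonal_mul_mul_conjTranspose {n : Type*} [Fintype n] [DecidableEq n]
    {U : Matrix n n ℂ} (hU : U * Uᴴ = 1) {d : n → ℂ} (hd : ∀ i, d i * (starRingEnd ℂ) (d i) = 1) :
    (diagonal d * U) * (diagonal d * U)ᴴ = 1 := by
  rw [conjTranspose_mul, Matrix.mul_assoc, ← Matrix.mul_assoc U, hU, Matrix.one_mul,
    diagonal_conjTranspose, diagonal_mul_diagonal, ← diagonal_one]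
  congr 1
  ext i
  exact hd i

theorem exists_unitary_mulVec_triangular (v w : Fin 3 → ℂ) :
    ∃ U : Matrix (Fin 3) (Fin 3) ℂ, U * Uᴴ = 1 ∧
      (U *ᵥ v) 1 = 0 ∧ (U *ᵥ v) 2 = 0 ∧ (U *ᵥ w) 2 = 0 := by
  let f : Fin 3 → EuclideanSpace ℂ (Fin 3) := ![WithLp.toLp 2 v, WithLp.toLp 2 w, 0]
  have hcard : Module.finrank ℂ (EuclideanSpace ℂ (Fin 3)) = Fintype.card (Fin 3) := by simp
  let e := InnerProductSpace.gramSchmidtOrthonormalBasis hcard f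
  have he : ∀ (i : Fin 3) (u : Fin 3 → ℂ),
      (Matrix.of (fun i j => (starRingEnd ℂ) (e i j)) *ᵥ u) i = inner ℂ (e i) (WithLp.toLp 2 u) := by
    intro i u
    simp [mulVec, dotProduct, PiLp.inner_apply, mul_comm]
  refine ⟨Matrix.of fun i j => (starRingEnd ℂ) (e i j), ?_, ?_, ?_, ?_⟩
  · ext i j
    have := orthonormal_iff_ite.mp e.orthonormal i j
    rw [one_apply, ← this]
    simp [mul_apply, PiLp.inner_apply, mul_comm]
  · rw [he]
    exact InnerProductSpace.gramSchmidtOrthonormalBasis_inv_triangular hcard f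
      (i := 0) (j := 1) (by decide)
  · rw [he]
    exact InnerProductSpace.gramSchmidtOrthonormalBasis_inv_triangular hcard f
      (i := 0) (j := 2) (by decide)
  · rw [he]
    exact InnerProductSpace.gramSchmidtOrthonormalBasis_inv_triangular hcard f
      (i := 1) (j := 2) (by decide)

/-- Canonical form of a pair of vectors under the action of `SU(3)`. -/
theorem exists_SU3_mulVec_eq (v z : Fin 3 → ℂ) :
    ∃ (k : Matrix (Fin 3) (Fin 3) ℂ) (a x y b : ℝ), k * kᴴ = 1 ∧ k.det = 1 ∧
      k *ᵥ v = ![(a : ℂ), 0, 0] ∧ k.map (starRingEnd ℂ) *ᵥ z = ![⟨x, y⟩, (b : ℂ), 0] := by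
  have hconj : ∀ k : Matrix (Fin 3) (Fin 3) ℂ,
      k.map (starRingEnd ℂ) *ᵥ z = star (k *ᵥ star z) := by
    intro k
    ext i
    simp [mulVec, dotProduct]
  obtain ⟨U, hU, h1, h2, h3⟩ := exists_unitary_mulVec_triangular v (star z)
  obtain ⟨α, hα, hαv⟩ := Complex.exists_mul_conj_eq_one_mul_eq_norm ((U *ᵥ v) 0)
  obtain ⟨β, hβ, hβz⟩ := Complex.exists_mul_conj_eq_one_mul_eq_norm ((U *ᵥ star z) 1)
  have hdet : U.det * (starRingEnd ℂ) U.det = 1 := by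
    simpa [det_conjTranspose] using congrArg det hU
  let d : Fin 3 → ℂ := ![α, β, (starRingEnd ℂ) (α * β * U.det)]
  have hd : ∀ i, d i * (starRingEnd ℂ) (d i) = 1 := by
    intro i
    fin_cases i
    · exact hα
    · exact hβ
    · simp only [d, Fin.reduceFinMk, Matrix.cons_val, Complex.conj_conj, map_mul]
      linear_combination (β * (starRingEnd ℂ) β) * (U.det * (starRingEnd ℂ) U.det) * hα +
        (U.det * (starRingEnd ℂ) U.det) * hβ + hdet
  have hmul : ∀ u i, ((diagonal d * U) *ᵥ u) i = d i * (U *ᵥ u) i := by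
    intro u i
    rw [← mulVec_mulVec, mulVec_diagonal]
  refine ⟨diagonal d * U, ‖(U *ᵥ v) 0‖, (star ((diagonal d * U) *ᵥ star z) 0).re,
    (star ((diagonal d * U) *ᵥ star z) 0).im, ‖(U *ᵥ star z) 1‖,
    diagonal_mul_mul_conjTranspose hU hd, ?_, ?_, ?_⟩
  · rw [det_mul, det_diagonal, Fin.prod_univ_three]
    simp only [d, Matrix.cons_val, map_mul]
    linear_combination (β * (starRingEnd ℂ) β) * (U.det * (starRingEnd ℂ) U.det) * hα +
        (U.det * (starRingEnd ℂ) U.det) * hβ + hdet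
  · ext i
    rw [hmul]
    fin_cases i
    · exact hαv
    · simp [h1]
    · simp [h2]
  · rw [hconj]
    ext i
    fin_cases i
    · rfl
    · change star (((diagonal d * U) *ᵥ star z) 1) = ((‖(U *ᵥ star z) 1‖ : ℝ) : ℂ)
      rw [hmul]
      change star (β * _) = _
      rw [hβz]
      exact Complex.conj_ofReal _
    · change star (((diagonal d * U) *ᵥ star z) 2) = 0
      simp [hmul, h3]

theorem mulVec_dotProduct_map_conj_mulVec {n : Type*} [Fintype n] [DecidableEq n]
    {k : Matrix n n ℂ} (hk : k * kᴴ = 1) (v z : n → ℂ) :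
    k *ᵥ v ⬝ᵥ k.map (starRingEnd ℂ) *ᵥ z = v ⬝ᵥ z := by
  have hk' : kᴴ * k = 1 := mul_eq_one_comm.mp hk
  have hk'' : kᵀ * k.map (starRingEnd ℂ) = 1 := by
    have := congrArg transpose hk'
    rwa [transpose_mul, transpose_one] at this
  rw [dotProduct_mulVec, vecMul_mulVec, hk'', vecMul_one]

theorem map_conj_mul_conjTranspose {n : Type*} [Fintype n] [DecidableEq n]
    {k : Matrix n n ℂ} (hk : k * kᴴ = 1) :
    k.map (starRingEnd ℂ) * (k.map (starRingEnd ℂ))ᴴ = 1 := by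
  have := congrArg (fun A : Matrix n n ℂ => A.map (starRingEnd ℂ)) hk
  rwa [Matrix.map_mul, Matrix.map_one _ (map_zero _) (map_one _)] at this

theorem sum_normSq_mulVec {n : Type*} [Fintype n] [DecidableEq n]
    {k : Matrix n n ℂ} (hk : k * kᴴ = 1) (v : n → ℂ) :
    ∑ i, Complex.normSq ((k *ᵥ v) i) = ∑ i, Complex.normSq (v i) := by
  have h := mulVec_dotProduct_map_conj_mulVec hk v (star v)
  have hconj : k.map (starRingEnd ℂ) *ᵥ star v = star (k *ᵥ v) := by
    ext i
    simp [mulVec, dotProduct]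
  rw [hconj] at h
  apply Complex.ofReal_injective
  simpa [dotProduct, Complex.normSq_eq_conj_mul_self, mul_comm] using h

end Matrix

/-- The four basic `SU(3)`-invariants of a pair of vectors in `ℂ³`. -/
def basicInvariants (v z : Fin 3 → ℂ) : Fin 4 → ℝ :=
  ![∑ i, Complex.normSq (v i), ∑ i, Complex.normSq (z i),
    (∑ i, v i * z i).re, (∑ i, v i * z i).im]

open MvPolynomial Matrix

theorem exists_pow_mul_eq_eval_basicInvariants
    (F : (Fin 3 → ℂ) → (Fin 3 → ℂ) → ℝ)
    (hpoly : ∃ p : MvPolynomial ((Fin 3 ⊕ Fin 3) ⊕ (Fin 3 ⊕ Fin 3)) ℝ,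
      ∀ v z : Fin 3 → ℂ, F v z = eval
        (Sum.elim (fun s => (Sum.elim v z s).re) fun s => (Sum.elim v z s).im) p)
    (hinv : ∀ k : Matrix (Fin 3) (Fin 3) ℂ, k * kᴴ = 1 → k.det = 1 →
      ∀ v z : Fin 3 → ℂ, F (k *ᵥ v) (k.map (starRingEnd ℂ) *ᵥ z) = F v z) :
    ∃ (N : ℕ) (Q : MvPolynomial (Fin 4) ℝ), ∀ v z : Fin 3 → ℂ,
      (∑ i, Complex.normSq (v i)) ^ N * F v z = eval (basicInvariants v z) Q := by
  obtain ⟨p, hp⟩ := hpoly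
  have hdiag : ∀ d : Fin 3 → ℂ, (∀ i, d i * (starRingEnd ℂ) (d i) = 1) → d 0 * d 1 * d 2 = 1 →
      ∀ v z, F (fun i => d i * v i) (fun i => (starRingEnd ℂ) (d i) * z i) = F v z := by
    intro d hd hdet v z
    have h := hinv (diagonal d) (by simpa only [Matrix.mul_one] using diagonal_mul_mul_conjTranspose (U := 1) (by simp) hd)
      (by rw [det_diagonal, Fin.prod_univ_three, hdet]) v z
    have e₁ : diagonal d *ᵥ v = fun i => d i * v i := by
      ext i; rw [mulVec_diagonal]
    have e₂ : (diagonal d).map (starRingEnd ℂ) *ᵥ z = fun i => (starRingEnd ℂ) (d i) * z i := by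
      ext i; rw [diagonal_map (map_zero _), mulVec_diagonal]
    rwa [e₁, e₂] at h
  have hs := HasSlicePresentation.eval_slice p
  simp only [← hp] at hs
  obtain ⟨N, Q, hQ⟩ := hs.exists_eval_of_even
    (fun a x y b => by
      rw [← hdiag ![-1, 1, -1] (by intro i; fin_cases i <;> simp) (by simp)]
      congr 1 <;> ext i <;> fin_cases i <;> simp [Complex.ext_iff])
    (fun a x y b => by
      rw [← hdiag ![1, -1, -1] (by intro i; fin_cases i <;> simp) (by simp)]
      congr 1 <;> ext i <;> fin_cases i <;> simp)
  refine ⟨N, Q, fun v z => ?_⟩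
  obtain ⟨k, a, x, y, b, hk, hdet, hv, hz⟩ := exists_SU3_mulVec_eq v z
  have hk' := map_conj_mul_conjTranspose hk
  have hvn : ∑ i, Complex.normSq (v i) = a ^ 2 := by
    rw [← sum_normSq_mulVec hk v, hv]
    simp [Fin.sum_univ_three, Complex.normSq_apply, sq]
  have hzn : ∑ i, Complex.normSq (z i) = x ^ 2 + y ^ 2 + b ^ 2 := by
    rw [← sum_normSq_mulVec hk' z, hz]
    simp [Fin.sum_univ_three, Complex.normSq_apply, sq]
  have hvz : ∑ i, v i * z i = a * ⟨x, y⟩ := by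
    have := mulVec_dotProduct_map_conj_mulVec hk v z
    rw [hv, hz] at this
    simpa [dotProduct, Fin.sum_univ_three] using this.symm
  rw [← hinv k hk hdet v z, hv, hz, hvn, hQ, basicInvariants, hvn, hzn, hvz]
  simp

theorem exists_basicInvariants_eq {A S x y : ℝ} (hA : 0 < A) (h : x ^ 2 + y ^ 2 ≤ A * S) :
    ∃ v z, basicInvariants v z = ![A, S, x, y] := by
  have hA' : √A ≠ 0 := (Real.sqrt_pos.mpr hA).ne'
  have hAA : √A ^ 2 = A := Real.sq_sqrt hA.le
  have hS : 0 ≤ S - (x ^ 2 + y ^ 2) / A := by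
    rw [sub_nonneg, div_le_iff₀ hA]; linarith
  refine ⟨![(√A : ℂ), 0, 0],
    ![⟨x / √A, y / √A⟩, (√(S - (x ^ 2 + y ^ 2) / A) : ℂ), 0], ?_⟩
  ext i
  fin_cases i
  · simp [basicInvariants, Fin.sum_univ_three, Complex.normSq_apply, hA.le]
  · simp [basicInvariants, Fin.sum_univ_three, Complex.normSq_apply, Real.mul_self_sqrt hS]
    have hxy : x / √A * (x / √A) + y / √A * (y / √A) = (x ^ 2 + y ^ 2) / A := by
      rw [div_mul_div_comm, div_mul_div_comm, Real.mul_self_sqrt hA.le]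
      ring
    linear_combination hxy
  · simp [basicInvariants, Fin.sum_univ_three]
    field_simp
  · simp [basicInvariants, Fin.sum_univ_three]
    field_simp

/-- The basic invariants are algebraically independent. -/
theorem eq_of_eval_basicInvariants_eq {P Q : MvPolynomial (Fin 4) ℝ}
    (h : ∀ v z, eval (basicInvariants v z) P = eval (basicInvariants v z) Q) : P = Q := by
  refine funext_set ![Set.Ioo 1 2, Set.Ioo 1 2, Set.Ioo 0 (1 / 2), Set.Ioo 0 (1 / 2)]
    (fun i => ?_) fun t ht => ?_
  · fin_cases i <;> exact Set.Ioo_infinite (by norm_num)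
  · have h0 : t 0 ∈ Set.Ioo (1 : ℝ) 2 := ht 0 trivial
    have h1 : t 1 ∈ Set.Ioo (1 : ℝ) 2 := ht 1 trivial
    have h2 : t 2 ∈ Set.Ioo (0 : ℝ) (1 / 2) := ht 2 trivial
    have h3 : t 3 ∈ Set.Ioo (0 : ℝ) (1 / 2) := ht 3 trivial
    simp only [Set.mem_Ioo] at h0 h1 h2 h3
    obtain ⟨v, z, hvz⟩ := exists_basicInvariants_eq (A := t 0) (S := t 1) (x := t 2) (y := t 3)
      (by linarith) (by nlinarith)
    have : basicInvariants v z = t := by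
      rw [hvz]; ext i; fin_cases i <;> rfl
    rw [← this]
    exact h v z

/-- **SU(3)-invariants on `ℂ³ ⊕ Λ²ℂ³`.**
Every real-valued polynomial function on `ℂ³ × ℂ³` invariant under the action
`k·(v,z) = (kv, conj(k)z)` of `SU(3)` is a real polynomial in
`|v|²`, `|z|²`, `Re(∑ vℓ zℓ)`, `Im(∑ vℓ zℓ)`. -/
theorem SU3_invariants
    (F : (Fin 3 → ℂ) → (Fin 3 → ℂ) → ℝ)
    (hpoly : ∃ p : MvPolynomial ((Fin 3 ⊕ Fin 3) ⊕ (Fin 3 ⊕ Fin 3)) ℝ,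
      ∀ v z : Fin 3 → ℂ,
        F v z = MvPolynomial.eval
          (Sum.elim (fun s => (Sum.elim v z s).re) fun s => (Sum.elim v z s).im) p)
    (hinv : ∀ k : Matrix (Fin 3) (Fin 3) ℂ, k * k.conjTranspose = 1 → k.det = 1 →
      ∀ v z : Fin 3 → ℂ, F (k.mulVec v) ((k.map (starRingEnd ℂ)).mulVec z) = F v z) :
    ∃ Q : MvPolynomial (Fin 4) ℝ, ∀ v z : Fin 3 → ℂ,
      F v z = MvPolynomial.eval
        ![∑ i, Complex.normSq (v i), ∑ i, Complex.normSq (z i),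
          (∑ i, v i * z i).re, (∑ i, v i * z i).im] Q := by
  obtain ⟨N, P, hP⟩ := exists_pow_mul_eq_eval_basicInvariants F hpoly hinv
  obtain ⟨p, hp⟩ := hpoly
  obtain ⟨M, R, hR⟩ := exists_pow_mul_eq_eval_basicInvariants (fun v z => F z v)
    ⟨rename (Sum.map Sum.swap Sum.swap) p, fun v z => by
      rw [hp, eval_rename]
      congr 2
      ext ((i | i) | (i | i)) <;> rfl⟩
    (fun k hk hdet v z => by
      have hk' : k.map (starRingEnd ℂ) * (k.map (starRingEnd ℂ))ᴴ = 1 :=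
        map_conj_mul_conjTranspose hk
      have hdet' : (k.map (starRingEnd ℂ)).det = 1 := by
        rw [← RingHom.mapMatrix_apply, ← RingHom.map_det, hdet, map_one]
      simpa [Matrix.map_map, Function.comp_def] using
        hinv (k.map (starRingEnd ℂ)) hk' hdet' z v)
  have hswap : ∀ v z, basicInvariants v z = basicInvariants z v ∘ ![1, 0, 2, 3] := by
    intro v z
    ext i
    fin_cases i <;> simp [basicInvariants, mul_comm]
  have hX : X 1 ^ M * P = X 0 ^ N * rename ![1, 0, 2, 3] R := by
    refine eq_of_eval_basicInvariants_eq fun v z => ?_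
    rw [map_mul, map_mul, eval_rename, ← hswap, ← hP, ← hR]
    simp [basicInvariants]
    ring
  obtain ⟨Q, rfl⟩ : X 0 ^ N ∣ P :=
    (X_prime (i := 0)).pow_dvd_of_dvd_mul_left N
      (fun h => by simpa using X_dvd_X.mp ((X_prime (i := 0)).dvd_of_dvd_pow h)) ⟨_, hX⟩
  refine ⟨Q, fun v z => ?_⟩
  have hF : Continuous fun v => F v z := by
    simp only [hp]
    refine (continuous_eval p).comp (continuous_pi ?_)
    rintro ((i | i) | (i | i)) <;> simp <;> fun_prop
  have hQ : Continuous fun v => eval (basicInvariants v z) Q := by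
    refine (continuous_eval Q).comp (continuous_pi fun i => ?_)
    fin_cases i <;> simp [basicInvariants, Complex.normSq_apply] <;> fun_prop
  refine congrFun (Continuous.ext_on (dense_compl_singleton (0 : Fin 3 → ℂ)) hF hQ ?_) v
  intro u hu
  have h := hP u z
  rw [map_mul, map_pow, eval_X] at h
  have hu' : ∑ i, Complex.normSq (u i) ≠ 0 := by
    contrapose! hu
    rw [Finset.sum_eq_zero_iff_of_nonneg fun i _ => Complex.normSq_nonneg _] at hu
    refine fun hu0 => hu0 (funext fun i => ?_)
    simpa using hu i (Finset.mem_univ i)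
  exact mul_left_cancel₀ (pow_ne_zero N hu') h
end

section
/- Let n ≥ 1 and consider the action of K = Sp(1) × Sp(n) on ℍⁿ × Im ℍ given by (k₁,k₂)·(v,z) = (k₂ v k₁*, k₁ z k₁*), where Sp(1) is the group of unit quaternions, Sp(n) is the group of quaternionic unitary n×n matrices, v ∈ ℍⁿ is a column vector (with k₁* acting by right scalar multiplication), and Im ℍ is the space of purely imaginary quaternions. Then every real polynomial function P on ℍⁿ × Im ℍ (polynomial in the real coordinates) that is invariant under this action is a real polynomial in the two functions |v|² and |z|²: there exists Q ∈ ℝ[y₁,y₂] with P(v,z) = Q(|v|², |z|²) for all (v,z). -/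
open scoped Quaternion

namespace Quaternion

/-- The imaginary quaternion with the given coordinates. -/
def ofIm (a b c : ℝ) : ℍ[ℝ] := ⟨0, a, b, c⟩

@[simp] lemma re_ofIm (a b c : ℝ) : (ofIm a b c).re = 0 := rfl

@[simp] lemma imI_ofIm (a b c : ℝ) : (ofIm a b c).imI = a := rfl

@[simp] lemma imJ_ofIm (a b c : ℝ) : (ofIm a b c).imJ = b := rfl

@[simp] lemma imK_ofIm (a b c : ℝ) : (ofIm a b c).imK = c := rfl

lemma star_mul_self_eq_coe_norm_sq (a : ℍ[ℝ]) : star a * a = ((‖a‖ ^ 2 : ℝ) : ℍ[ℝ]) := by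
  rw [Quaternion.star_mul_self, Quaternion.normSq_eq_norm_mul_self, sq]

lemma self_mul_star_eq_coe_norm_sq (a : ℍ[ℝ]) : a * star a = ((‖a‖ ^ 2 : ℝ) : ℍ[ℝ]) := by
  rw [Quaternion.self_mul_star, Quaternion.normSq_eq_norm_mul_self, sq]

lemma norm_eq_one_of_mul_star {q : ℍ[ℝ]} (hq : q * star q = 1) : ‖q‖ = 1 := by
  have h := congrArg norm hq
  rw [norm_mul, norm_star, norm_one] at h
  nlinarith [norm_nonneg q]

/-- An intertwiner `k z = u k` with `k ≠ 0` can be normalised to a unit quaternion conjugating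
`z` to `u`. -/
lemma exists_unit_conj_of_intertwines {k z u : ℍ[ℝ]} (hk : k ≠ 0) (h : k * z = u * k) :
    ∃ q : ℍ[ℝ], q * star q = 1 ∧ q * z * star q = u := by
  have hn : ‖k‖ ≠ 0 := norm_ne_zero_iff.mpr hk
  have hq : (‖k‖⁻¹ • k) * star (‖k‖⁻¹ • k) = 1 := by
    rw [self_mul_star_eq_coe_norm_sq, norm_smul, norm_inv, norm_norm, inv_mul_cancel₀ hn]
    simp
  refine ⟨‖k‖⁻¹ • k, hq, ?_⟩
  have : (‖k‖⁻¹ • k) * z = u * (‖k‖⁻¹ • k) := by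
    rw [smul_mul_assoc, h, mul_smul_comm]
  rw [this, mul_assoc, hq, mul_one]

/-- Unit quaternions act transitively on the spheres of `Im ℍ`. -/
lemma exists_unit_conj_eq_norm_smul_i {z : ℍ[ℝ]} (hz : z.re = 0) :
    ∃ q : ℍ[ℝ], q * star q = 1 ∧ q * z * star q = ofIm ‖z‖ 0 0 := by
  have hsq : ‖z‖ * ‖z‖ = z.imI * z.imI + z.imJ * z.imJ + z.imK * z.imK := by
    rw [← Quaternion.normSq_eq_norm_mul_self, Quaternion.normSq_def']
    rw [hz]; ring
  by_cases hk : ofIm ‖z‖ 0 0 + z = 0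
  · have hz' : z = ofIm (-‖z‖) 0 0 := by
      refine (eq_neg_of_add_eq_zero_right hk).trans ?_
      ext <;> simp
    have hj : ofIm 0 1 0 ≠ 0 := fun h => by simpa using congrArg (·.imJ) h
    refine exists_unit_conj_of_intertwines hj ?_
    generalize ‖z‖ = t at hz' ⊢
    subst hz'
    ext <;> simp
  · refine exists_unit_conj_of_intertwines hk ?_
    ext <;> simp [hz] <;> linarith

end Quaternion

section Householder

variable {ι : Type*} [Fintype ι]

open Matrix

lemma star_dotProduct_self_quaternion (w : ι → ℍ[ℝ]) :
    star w ⬝ᵥ w = ((∑ i, ‖w i‖ ^ 2 : ℝ) : ℍ[ℝ]) := by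
  simp only [dotProduct, Pi.star_apply, Quaternion.star_mul_self_eq_coe_norm_sq]
  exact (map_sum (algebraMap ℝ ℍ[ℝ]) _ _).symm

variable [DecidableEq ι]

/-- The quaternionic Householder reflection in the hyperplane orthogonal to `w`. -/
noncomputable def quaternionHouseholder (w : ι → ℍ[ℝ]) : Matrix ι ι ℍ[ℝ] :=
  1 - (2 / ∑ i, ‖w i‖ ^ 2 : ℝ) • vecMulVec w (star w)

lemma quaternionHouseholder_mul_conjTranspose (w : ι → ℍ[ℝ]) :
    quaternionHouseholder w * (quaternionHouseholder w)ᴴ = 1 := by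
  have hH : (quaternionHouseholder w)ᴴ = quaternionHouseholder w := by
    ext1 i j
    simp [quaternionHouseholder, vecMulVec_apply, Matrix.one_apply, apply_ite star, eq_comm]
  have hV : vecMulVec w (star w) * vecMulVec w (star w)
      = (∑ i, ‖w i‖ ^ 2 : ℝ) • vecMulVec w (star w) := by
    ext1 i j
    simp only [Matrix.mul_apply, vecMulVec_apply, Matrix.smul_apply]
    have : ∀ k, w i * star w k * (w k * star w j) = w i * (star w k * w k) * star w j :=
      fun k => by simp only [mul_assoc]
    simp only [this, ← Finset.sum_mul, ← Finset.mul_sum]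
    have h := star_dotProduct_self_quaternion w
    rw [dotProduct] at h
    rw [h, ← Quaternion.coe_commutes, mul_assoc, Quaternion.coe_mul_eq_smul]
  rw [hH, quaternionHouseholder]
  by_cases h0 : ∑ i, ‖w i‖ ^ 2 = 0
  · simp [h0]
  · rw [sub_mul, one_mul, mul_sub, mul_one, smul_mul_smul_comm, hV, smul_smul,
      show 2 / (∑ i, ‖w i‖ ^ 2) * (2 / ∑ i, ‖w i‖ ^ 2) * (∑ i, ‖w i‖ ^ 2)
        = 2 / (∑ i, ‖w i‖ ^ 2) + 2 / ∑ i, ‖w i‖ ^ 2 by field_simp; norm_num, add_smul]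
    abel

/-- The Householder reflection in `x - y` exchanges `x` and `y`, when these have the same norm and
real inner product. -/
lemma quaternionHouseholder_sub_mulVec {x y : ι → ℍ[ℝ]} {r : ℝ}
    (hxy : ∑ i, ‖x i‖ ^ 2 = ∑ i, ‖y i‖ ^ 2) (hr : star y ⬝ᵥ x = (r : ℍ[ℝ])) :
    quaternionHouseholder (x - y) *ᵥ x = y := by
  have hr' : star x ⬝ᵥ y = (r : ℍ[ℝ]) := by
    rw [star_dotProduct, hr, Quaternion.star_coe]
  have h1 : star (x - y) ⬝ᵥ x = ((∑ i, ‖x i‖ ^ 2 - r : ℝ) : ℍ[ℝ]) := by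
    rw [star_sub, sub_dotProduct, hr, star_dotProduct_self_quaternion, Quaternion.coe_sub]
  have h2 : ∑ i, ‖(x - y) i‖ ^ 2 = 2 * (∑ i, ‖x i‖ ^ 2 - r) := by
    apply Quaternion.coe_injective
    rw [← star_dotProduct_self_quaternion, dotProduct_sub, h1, star_sub, sub_dotProduct, hr',
      star_dotProduct_self_quaternion, ← hxy]
    simp only [← Quaternion.coe_sub]
    congr 1; ring
  by_cases h0 : ∑ i, ‖(x - y) i‖ ^ 2 = 0
  · have hx : x = y := by
      rw [Finset.sum_eq_zero_iff_of_nonneg fun i _ => by positivity] at h0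
      exact funext fun i => sub_eq_zero.mp (by simpa using h0 i (Finset.mem_univ i))
    subst hx
    simp [quaternionHouseholder]
  · ext1 i
    have hc : 2 / (∑ i, ‖(x - y) i‖ ^ 2) * (∑ i, ‖x i‖ ^ 2 - r) = 1 := by
      rw [h2] at h0 ⊢
      field_simp
      exact div_self fun h => h0 (by rw [h, mul_zero])
    have h3 : (vecMulVec (x - y) (star (x - y)) *ᵥ x) i
        = (∑ i, ‖x i‖ ^ 2 - r) • (x - y) i := by
      rw [← Quaternion.mul_coe_eq_smul, ← h1, dotProduct, Finset.mul_sum]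
      simp only [mulVec, dotProduct, vecMulVec_apply, mul_assoc]
    rw [quaternionHouseholder, sub_mulVec, one_mulVec, smul_mulVec, Pi.sub_apply, Pi.smul_apply,
      h3, smul_smul, hc, one_smul, Pi.sub_apply, sub_sub_cancel]

lemma exists_unit_mul_eq_norm (a : ℍ[ℝ]) :
    ∃ q : ℍ[ℝ], q * star q = 1 ∧ q * a = (‖a‖ : ℍ[ℝ]) := by
  by_cases ha : a = 0
  · exact ⟨1, by simp, by simp [ha]⟩
  · have hn : ‖a‖ ≠ 0 := norm_ne_zero_iff.mpr ha
    refine ⟨‖a‖⁻¹ • star a, ?_, ?_⟩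
    · rw [Quaternion.self_mul_star_eq_coe_norm_sq, norm_smul, norm_inv, norm_norm, norm_star,
        inv_mul_cancel₀ hn]
      simp
    · rw [smul_mul_assoc, Quaternion.star_mul_self_eq_coe_norm_sq, ← Quaternion.coe_smul]
      congr 1
      rw [smul_eq_mul]
      field_simp

/-- `Sp(n)` acts transitively on the spheres of `ℍⁿ`. -/
lemma exists_quaternionUnitary_mulVec_eq_single (i₀ : ι) (v : ι → ℍ[ℝ]) :
    ∃ k : Matrix ι ι ℍ[ℝ], k * kᴴ = 1 ∧
      k *ᵥ v = Pi.single i₀ ((√(∑ i, ‖v i‖ ^ 2) : ℝ) : ℍ[ℝ]) := by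
  obtain ⟨q, hq, hqv⟩ := exists_unit_mul_eq_norm (v i₀)
  have hqn : ‖q‖ = 1 := Quaternion.norm_eq_one_of_mul_star hq
  set x : ι → ℍ[ℝ] := fun i => q * v i
  set y : ι → ℍ[ℝ] := Pi.single i₀ ((√(∑ i, ‖v i‖ ^ 2) : ℝ) : ℍ[ℝ])
  have hx : ∑ i, ‖x i‖ ^ 2 = ∑ i, ‖v i‖ ^ 2 := by simp [x, hqn]
  have hy : ∑ i, ‖y i‖ ^ 2 = ∑ i, ‖v i‖ ^ 2 := by
    rw [Finset.sum_eq_single i₀ (fun j _ hj => by simp [y, hj]) (by simp)]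
    simp only [y, Pi.single_eq_same, Quaternion.norm_coe, Real.norm_eq_abs, sq_abs]
    exact Real.sq_sqrt (by positivity)
  have hr : star y ⬝ᵥ x = ((√(∑ i, ‖v i‖ ^ 2) * ‖v i₀‖ : ℝ) : ℍ[ℝ]) := by
    rw [dotProduct, Finset.sum_eq_single i₀ (fun j _ hj => by simp [y, hj]) (by simp)]
    simp [x, y, hqv]
  have hD : Matrix.diagonal (fun _ : ι => q) *ᵥ v = x := by
    ext1 i
    rw [mulVec_diagonal]
  refine ⟨quaternionHouseholder (x - y) * Matrix.diagonal fun _ => q, ?_, ?_⟩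
  · have hDD : Matrix.diagonal (fun _ : ι => q) * (Matrix.diagonal fun _ : ι => q)ᴴ = 1 := by
      rw [diagonal_conjTranspose, diagonal_mul_diagonal]
      simp [hq]
    rw [conjTranspose_mul, Matrix.mul_assoc, ← Matrix.mul_assoc (Matrix.diagonal _), hDD,
      Matrix.one_mul, quaternionHouseholder_mul_conjTranspose]
  · rw [← mulVec_mulVec, hD, quaternionHouseholder_sub_mulVec (hx.trans hy.symm) hr]

end Householder

/-- The average of a polynomial in two variables over sign changes is a polynomial in the
squares. -/
lemma MvPolynomial.exists_eval_sq_eq_signAverage (f : MvPolynomial (Fin 2) ℝ) :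
    ∃ Q : MvPolynomial (Fin 2) ℝ, ∀ s t : ℝ,
      (eval ![s, t] f + eval ![-s, t] f + eval ![s, -t] f + eval ![-s, -t] f) / 4
        = eval ![s ^ 2, t ^ 2] Q := by
  induction f using MvPolynomial.induction_on' with
  | monomial u a =>
    by_cases h : Even (u 0) ∧ Even (u 1)
    · obtain ⟨⟨m, hm⟩, ⟨l, hl⟩⟩ := h
      refine ⟨C a * X 0 ^ m * X 1 ^ l, fun s t => ?_⟩
      simp [MvPolynomial.eval_monomial, Finsupp.prod_fintype, hm, hl, ← two_mul, pow_mul]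
      ring
    · refine ⟨0, fun s t => ?_⟩
      rw [not_and_or, Nat.not_even_iff_odd, Nat.not_even_iff_odd] at h
      rcases h with h | h <;>
      · simp [MvPolynomial.eval_monomial, Finsupp.prod_fintype, h.neg_pow]
  | add p q hp hq =>
    obtain ⟨P, hP⟩ := hp
    obtain ⟨Q, hQ⟩ := hq
    refine ⟨P + Q, fun s t => ?_⟩
    rw [map_add (eval _) P Q, ← hP, ← hQ]
    simp only [map_add]
    ring

/-- **`Sp(1) × Sp(n)`-invariants on `ℍⁿ ⊕ Im ℍ`.**
Every real polynomial function on `ℍⁿ × Im ℍ` invariant under the action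
`(k₁,k₂)·(v,z) = (k₂ v k₁*, k₁ z k₁*)` of `Sp(1) × Sp(n)` is a real polynomial in `|v|²`
and `|z|²`. -/
theorem Sp1_Spn_invariants (n : ℕ) (hn : 1 ≤ n)
    (F : (Fin n → Quaternion ℝ) → Quaternion ℝ → ℝ)
    (hpoly : ∃ p : MvPolynomial (Fin n × Fin 4 ⊕ Fin 3) ℝ,
      ∀ (v : Fin n → Quaternion ℝ) (z : Quaternion ℝ), z.re = 0 →
        F v z = MvPolynomial.eval
          (Sum.elim
            (fun q => ![(v q.1).re, (v q.1).imI, (v q.1).imJ, (v q.1).imK] q.2)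
            fun j => ![z.imI, z.imJ, z.imK] j) p)
    (hinv : ∀ (k₁ : Quaternion ℝ) (k₂ : Matrix (Fin n) (Fin n) (Quaternion ℝ)),
      k₁ * star k₁ = 1 → k₂ * k₂.conjTranspose = 1 →
      ∀ (v : Fin n → Quaternion ℝ) (z : Quaternion ℝ), z.re = 0 →
        F (fun i => k₂.mulVec v i * star k₁) (k₁ * z * star k₁) = F v z) :
    ∃ Q : MvPolynomial (Fin 2) ℝ,
      ∀ (v : Fin n → Quaternion ℝ) (z : Quaternion ℝ), z.re = 0 →
        F v z = MvPolynomial.eval ![∑ i, ‖v i‖ ^ 2, ‖z‖ ^ 2] Q := by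
  obtain ⟨p, hp⟩ := hpoly
  let i₀ : Fin n := ⟨0, hn⟩
  let f : MvPolynomial (Fin 2) ℝ := MvPolynomial.bind₁
    (Sum.elim (fun q => if q = (i₀, 0) then MvPolynomial.X 0 else 0)
      (fun j => if j = 0 then MvPolynomial.X 1 else 0)) p
  have hf : ∀ s t : ℝ,
      F (Pi.single i₀ (s : Quaternion ℝ)) (Quaternion.ofIm t 0 0) = MvPolynomial.eval ![s, t] f := by
    intro s t
    refine (hp _ _ rfl).trans ?_
    simp only [f, MvPolynomial.eval, MvPolynomial.eval₂Hom_bind₁]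
    congr 2
    funext x
    rcases x with ⟨i, c⟩ | j
    · by_cases hi : i = i₀
      · subst hi
        fin_cases c <;> simp
      · fin_cases c <;> simp [hi]
    · fin_cases j <;> simp
  have hred : ∀ (v : Fin n → Quaternion ℝ) (z : Quaternion ℝ), z.re = 0 →
      F v z = MvPolynomial.eval ![√(∑ i, ‖v i‖ ^ 2), ‖z‖] f := by
    intro v z hz
    obtain ⟨k₁, hk₁, hkz⟩ := Quaternion.exists_unit_conj_eq_norm_smul_i hz
    obtain ⟨k₂, hk₂, hkv⟩ :=
      exists_quaternionUnitary_mulVec_eq_single i₀ fun i => v i * star k₁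
    have hn₁ : ‖k₁‖ = 1 := Quaternion.norm_eq_one_of_mul_star hk₁
    have h₁ := hinv k₁ 1 hk₁ (by simp) v z hz
    have h₂ := hinv 1 k₂ (by simp) hk₂ (fun i => v i * star k₁) (Quaternion.ofIm ‖z‖ 0 0) rfl
    simp only [Matrix.one_mulVec, hkz] at h₁
    simp only [star_one, mul_one, one_mul, hkv, norm_mul, norm_star, hn₁] at h₂
    rw [← h₁, ← h₂, hf]
  have heven : ∀ s t : ℝ, MvPolynomial.eval ![s, t] f = MvPolynomial.eval ![|s|, |t|] f := by
    intro s t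
    rw [← hf, hred _ _ rfl]
    have hs : √(∑ i, ‖(Pi.single i₀ (s : Quaternion ℝ) : Fin n → Quaternion ℝ) i‖ ^ 2) = |s| := by
      rw [Finset.sum_eq_single i₀ (fun j _ hj => by simp [hj]) (by simp)]
      simp [Real.sqrt_sq_eq_abs]
    have ht : ‖Quaternion.ofIm t 0 0‖ = |t| := by
      rw [← Real.sqrt_sq (norm_nonneg _), sq, ← Quaternion.normSq_eq_norm_mul_self,
        Quaternion.normSq_def']
      simp [Real.sqrt_sq_eq_abs]
    rw [hs, ht]
  obtain ⟨Q, hQ⟩ := MvPolynomial.exists_eval_sq_eq_signAverage f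
  refine ⟨Q, fun v z hz => ?_⟩
  have h := hQ (√(∑ i, ‖v i‖ ^ 2)) ‖z‖
  rw [Real.sq_sqrt (by positivity)] at h
  rw [hred v z hz, ← h, heven (-_) ‖z‖, heven _ (-‖z‖), heven (-_) (-‖z‖)]
  simp only [abs_neg, ← heven]
  ring
end

section
/- Let n ≥ 2 and consider the action of K = Sp(2) × Sp(n) on M_{2×n}(ℍ) × 𝔰𝔭(2) given by (k₁,k₂)·(v,z) = (k₁ v k₂*, k₁ z k₁*), where Sp(m) is the group of quaternionic unitary m×m matrices and 𝔰𝔭(2) = {z ∈ M₂(ℍ) : z* = -z} is the space of skew-Hermitian quaternionic 2×2 matrices. Then every real polynomial function P on M_{2×n}(ℍ) × 𝔰𝔭(2) (polynomial in the real coordinates) invariant under this action belongs to the ℝ-subalgebra generated by the six real-valued functions (v,z) ↦ Re tr(z²), Re tr(z⁴), Re tr(v v*), Re tr(z v (z v)*), Re tr((z v v* - v v* z)²), Re tr((v v*)²). -/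
open scoped Quaternion

section FunctionAlgebras

variable {X X' : Type*}

/-- If `t` is odd and `t * t` as well as the generators `S` are even under `σ`, then an even element
of the algebra generated by `S` and `t` lies in the algebra generated by `S`. -/
lemma mem_adjoin_of_even {S : Set (X → ℝ)} {t f : X → ℝ} (σ : X → X)
    (ht : t * t ∈ Algebra.adjoin ℝ S) (hS : ∀ s ∈ S, ∀ x, s (σ x) = s x)
    (hσ : ∀ x, t (σ x) = -t x) (hf : f ∈ Algebra.adjoin ℝ (insert t S))
    (hfσ : ∀ x, f (σ x) = f x) : f ∈ Algebra.adjoin ℝ S := by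
  have key : ∃ a ∈ Algebra.adjoin ℝ S, ∃ b ∈ Algebra.adjoin ℝ S, f = a + b * t := by
    refine Algebra.adjoin_induction
      (p := fun f _ => ∃ a ∈ Algebra.adjoin ℝ S, ∃ b ∈ Algebra.adjoin ℝ S, f = a + b * t)
      ?_ ?_ ?_ ?_ hf
    · rintro g (rfl | hg)
      · exact ⟨0, zero_mem _, 1, one_mem _, by simp⟩
      · exact ⟨g, Algebra.subset_adjoin hg, 0, zero_mem _, by simp⟩
    · exact fun r => ⟨_, Subalgebra.algebraMap_mem _ r, 0, zero_mem _, by simp⟩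
    · rintro _ _ - - ⟨a, ha, b, hb, rfl⟩ ⟨c, hc, d, hd, rfl⟩
      exact ⟨a + c, add_mem ha hc, b + d, add_mem hb hd, by ring⟩
    · rintro _ _ - - ⟨a, ha, b, hb, rfl⟩ ⟨c, hc, d, hd, rfl⟩
      exact ⟨a * c + b * d * (t * t), add_mem (mul_mem ha hc) (mul_mem (mul_mem hb hd) ht),
        a * d + b * c, add_mem (mul_mem ha hd) (mul_mem hb hc), by ring⟩
  have hinv : ∀ a ∈ Algebra.adjoin ℝ S, ∀ x, a (σ x) = a x := by
    intro a ha
    refine Algebra.adjoin_induction (p := fun a _ => ∀ x, a (σ x) = a x) hS ?_ ?_ ?_ ha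
    · intro r x; simp
    · intro a b _ _ ha hb x; simp [ha, hb]
    · intro a b _ _ ha hb x; simp [ha, hb]
  obtain ⟨a, ha, b, hb, rfl⟩ := key
  convert ha using 1
  funext x
  have := hfσ x
  simp only [Pi.add_apply, Pi.mul_apply, hinv a ha, hinv b hb, hσ] at this ⊢
  linarith

/-- Iterated version of `mem_adjoin_of_even`. -/
lemma mem_adjoin_of_even_family {m : ℕ} {S : Set (X → ℝ)} (t : Fin m → X → ℝ) {f : X → ℝ}
    (σ : Fin m → X → X) (ht : ∀ i, t i * t i ∈ Algebra.adjoin ℝ S)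
    (hS : ∀ i, ∀ s ∈ S, ∀ x, s (σ i x) = s x) (hσ : ∀ i x, t i (σ i x) = -t i x)
    (hlt : ∀ i j, j < i → ∀ x, t j (σ i x) = t j x)
    (hf : f ∈ Algebra.adjoin ℝ (S ∪ Set.range t)) (hfσ : ∀ i x, f (σ i x) = f x) :
    f ∈ Algebra.adjoin ℝ S := by
  induction m with
  | zero => simpa using hf
  | succ m ih =>
    refine ih (t ∘ Fin.castSucc) (σ ∘ Fin.castSucc) (fun i => ht _) (fun i => hS _)
      (fun i => hσ _) (fun i j hij => hlt _ _ (by simpa using hij)) ?_ (fun i => hfσ _)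
    refine mem_adjoin_of_even (t := t (Fin.last m)) (σ (Fin.last m))
      (Algebra.adjoin_mono Set.subset_union_left (ht _)) ?_ (hσ _) ?_ (hfσ _)
    · rintro s (hs | ⟨i, rfl⟩)
      · exact hS _ s hs
      · exact hlt _ _ (Fin.castSucc_lt_last i)
    · refine Algebra.adjoin_mono ?_ hf
      rintro s (hs | ⟨i, rfl⟩)
      · exact Or.inr (Or.inl hs)
      · rcases Fin.eq_castSucc_or_eq_last i with ⟨j, rfl⟩ | rfl
        · exact Or.inr (Or.inr ⟨j, rfl⟩)
        · exact Or.inl rfl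

/-- Membership in an algebra of functions can be transported along a map of domains. -/
lemma comp_mem_of_mem_adjoin {S : Set (X → ℝ)} {A : Subalgebra ℝ (X' → ℝ)} {f : X → ℝ}
    (φ : X' → X) (hS : ∀ s ∈ S, (fun x => s (φ x)) ∈ A) (hf : f ∈ Algebra.adjoin ℝ S) :
    (fun x => f (φ x)) ∈ A := by
  refine Algebra.adjoin_induction (p := fun f _ => (fun x => f (φ x)) ∈ A) hS ?_ ?_ ?_ hf
  · exact fun r => A.algebraMap_mem r
  · exact fun a b _ _ ha hb => A.add_mem ha hb
  · exact fun a b _ _ ha hb => A.mul_mem ha hb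

/-- A polynomial in functions from a subalgebra is again in the subalgebra. -/
lemma eval_mem_subalgebra {ι : Type*} (A : Subalgebra ℝ (X → ℝ)) (p : MvPolynomial ι ℝ)
    (c : X → ι → ℝ) (hc : ∀ i, (fun x => c x i) ∈ A) :
    (fun x => MvPolynomial.eval (c x) p) ∈ A := by
  induction p using MvPolynomial.induction_on with
  | C a => simp only [MvPolynomial.eval_C]; exact A.algebraMap_mem a
  | add p q hp hq => simp only [map_add]; exact A.add_mem hp hq
  | mul_X p i hp => simp only [map_mul, MvPolynomial.eval_X]; exact A.mul_mem hp (hc i)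

/-- Generators of the algebra of functions on `X` which are polynomials in the components of `Y`
and the inverse of `W ∘ Y`. -/
def locGens {ι : Type*} (Y : X → ι → ℝ) (W : MvPolynomial ι ℝ) : Set (X → ℝ) :=
  insert (fun x => (MvPolynomial.eval (Y x) W)⁻¹) (Set.range fun i x => Y x i)

lemma exists_numerator {ι : Type*} {Y : X → ι → ℝ} {W : MvPolynomial ι ℝ}
    (hW : ∀ x, MvPolynomial.eval (Y x) W ≠ 0) {f : X → ℝ}
    (hf : f ∈ Algebra.adjoin ℝ (locGens Y W)) :
    ∃ (G : MvPolynomial ι ℝ) (N : ℕ),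
      ∀ x, MvPolynomial.eval (Y x) W ^ N * f x = MvPolynomial.eval (Y x) G := by
  refine Algebra.adjoin_induction (p := fun f _ => ∃ (G : MvPolynomial ι ℝ) (N : ℕ),
      ∀ x, MvPolynomial.eval (Y x) W ^ N * f x = MvPolynomial.eval (Y x) G) ?_ ?_ ?_ ?_ hf
  · rintro g (rfl | ⟨i, rfl⟩)
    · exact ⟨1, 1, fun x => by simp [hW x]⟩
    · exact ⟨MvPolynomial.X i, 0, fun x => by simp⟩
  · exact fun r => ⟨MvPolynomial.C r, 0, fun x => by simp⟩
  · rintro a b - - ⟨G, N, hG⟩ ⟨G', N', hG'⟩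
    refine ⟨W ^ N' * G + W ^ N * G', N + N', fun x => ?_⟩
    simp only [map_add, map_mul, map_pow, ← hG, ← hG', Pi.add_apply]
    ring
  · rintro a b - - ⟨G, N, hG⟩ ⟨G', N', hG'⟩
    refine ⟨G * G', N + N', fun x => ?_⟩
    simp only [map_mul, ← hG, ← hG', Pi.mul_apply]
    ring

lemma locGens_coord_mem {ι : Type*} (Y : X → ι → ℝ) (W : MvPolynomial ι ℝ) (i : ι) :
    (fun x => Y x i) ∈ Algebra.adjoin ℝ (locGens Y W) :=
  Algebra.subset_adjoin (Or.inr ⟨i, rfl⟩)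

lemma locGens_inv_mem {ι : Type*} (Y : X → ι → ℝ) (W : MvPolynomial ι ℝ) :
    (fun x => (MvPolynomial.eval (Y x) W)⁻¹) ∈ Algebra.adjoin ℝ (locGens Y W) :=
  Algebra.subset_adjoin (Or.inl rfl)

/-- If `P` divides `W`, then the inverse of `P ∘ Y` is available once that of `W ∘ Y` is. -/
lemma locGens_inv_mem_of_dvd {ι : Type*} {Y : X → ι → ℝ} {W P : MvPolynomial ι ℝ}
    (hW : ∀ x, MvPolynomial.eval (Y x) W ≠ 0) (h : P ∣ W) :
    (fun x => (MvPolynomial.eval (Y x) P)⁻¹) ∈ Algebra.adjoin ℝ (locGens Y W) := by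
  obtain ⟨R, rfl⟩ := h
  have := mul_mem (eval_mem_subalgebra _ R Y (locGens_coord_mem Y (P * R)))
    (locGens_inv_mem Y (P * R))
  convert this using 1
  funext x
  have hx := hW x
  simp only [map_mul, Pi.mul_apply] at hx ⊢
  have h1 := left_ne_zero_of_mul hx
  have h2 := right_ne_zero_of_mul hx
  field_simp

end FunctionAlgebras

/-- Two polynomials are relatively prime if one is constant and the other monic in some variable. -/
lemma isRelPrime_of_const_of_monic {A R : Type*} [CommRing A] [CommRing R] [IsDomain R]
    (e : A ≃+* Polynomial R) {p q : A} {c : R} (hp : e p = Polynomial.C c) (hc : c ≠ 0)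
    (hq : (e q).Monic) : IsRelPrime p q := by
  intro d hdp hdq
  have h1 : e d ∣ Polynomial.C c := hp ▸ map_dvd e hdp
  have h2 : e d ∣ e q := map_dvd e hdq
  have h3 : (e d).natDegree = 0 := by
    have := Polynomial.natDegree_le_of_dvd h1 (by simpa using hc)
    simpa using this
  rw [Polynomial.eq_C_of_natDegree_eq_zero h3] at h2
  have h4 : IsUnit ((e d).coeff 0) := by
    have := (Polynomial.C_dvd_iff_dvd_coeff _ _).1 h2 (e q).natDegree
    rw [Polynomial.coeff_natDegree, hq.leadingCoeff] at this
    exact isUnit_of_dvd_one this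
  have h5 : IsUnit (e d) := by
    rw [Polynomial.eq_C_of_natDegree_eq_zero h3]; exact h4.map Polynomial.C
  simpa using h5.map e.symm

/-- A polynomial vanishing near a point is zero. -/
lemma mvPolynomial_eq_of_eventually {ι : Type*} [Finite ι] {p q : MvPolynomial ι ℝ} {y : ι → ℝ}
    (h : ∀ᶠ x in nhds y, MvPolynomial.eval x p = MvPolynomial.eval x q) : p = q := by
  have := Fintype.ofFinite ι
  obtain ⟨ε, hε, hball⟩ := Metric.eventually_nhds_iff_ball.1 h
  refine MvPolynomial.funext_set (fun i => Metric.ball (y i) ε) (fun i => ?_) fun x hx => ?_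
  · rw [Real.ball_eq_Ioo]
    exact Set.Ioo_infinite (by linarith)
  · exact hball x (by rw [← ball_pi _ hε] at *; simpa using hx)

/-- The six generators. -/
noncomputable def invts {n : ℕ} (v : Matrix (Fin 2) (Fin n) ℍ[ℝ])
    (z : Matrix (Fin 2) (Fin 2) ℍ[ℝ]) : Fin 6 → ℝ :=
  ![(Matrix.trace (z ^ 2)).re, (Matrix.trace (z ^ 4)).re,
    (Matrix.trace (v * v.conjTranspose)).re,
    (Matrix.trace (z * v * (z * v).conjTranspose)).re,
    (Matrix.trace ((z * v * v.conjTranspose - v * v.conjTranspose * z) ^ 2)).re,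
    (Matrix.trace ((v * v.conjTranspose) ^ 2)).re]

/-- Two pairs are in the same orbit of `Sp(2) × Sp(n)`. -/
def OrbitRel {n : ℕ} (v : Matrix (Fin 2) (Fin n) ℍ[ℝ]) (z : Matrix (Fin 2) (Fin 2) ℍ[ℝ])
    (v' : Matrix (Fin 2) (Fin n) ℍ[ℝ]) (z' : Matrix (Fin 2) (Fin 2) ℍ[ℝ]) : Prop :=
  ∃ k₁ ∈ unitary (Matrix (Fin 2) (Fin 2) ℍ[ℝ]), ∃ k₂ ∈ unitary (Matrix (Fin n) (Fin n) ℍ[ℝ]),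
    v' = k₁ * v * star k₂ ∧ z' = k₁ * z * star k₁

section Orbits

variable {n : ℕ} {v v' v'' : Matrix (Fin 2) (Fin n) ℍ[ℝ]} {z z' z'' : Matrix (Fin 2) (Fin 2) ℍ[ℝ]}

lemma OrbitRel.trans (h : OrbitRel v z v' z') (h' : OrbitRel v' z' v'' z'') :
    OrbitRel v z v'' z'' := by
  obtain ⟨k, hk, l, hl, rfl, rfl⟩ := h
  obtain ⟨k', hk', l', hl', rfl, rfl⟩ := h'
  exact ⟨k' * k, mul_mem hk' hk, l' * l, mul_mem hl' hl, by simp [Matrix.mul_assoc],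
    by simp [Matrix.mul_assoc]⟩

lemma OrbitRel.conjTranspose_eq_neg (h : OrbitRel v z v' z') (hz : z.conjTranspose = -z) :
    z'.conjTranspose = -z' := by
  obtain ⟨k, hk, l, hl, rfl, rfl⟩ := h
  simp [Matrix.star_eq_conjTranspose, hz, Matrix.mul_assoc]

lemma re_trace_mul_comm {m l : Type*} [Fintype m] [Fintype l] (A : Matrix m l ℍ[ℝ])
    (B : Matrix l m ℍ[ℝ]) : (Matrix.trace (A * B)).re = (Matrix.trace (B * A)).re := by
  let reHom : ℍ[ℝ] →+ ℝ := ⟨⟨fun q => q.re, rfl⟩, fun _ _ => rfl⟩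
  change reHom _ = reHom _
  simp only [Matrix.trace, Matrix.diag, Matrix.mul_apply, map_sum]
  rw [Finset.sum_comm]
  refine Finset.sum_congr rfl fun i _ => Finset.sum_congr rfl fun j _ => ?_
  change (A j i * B i j).re = (B i j * A j i).re
  simp only [Quaternion.re_mul]
  ring

lemma re_trace_conj {k : Matrix (Fin 2) (Fin 2) ℍ[ℝ]} (hk : star k * k = 1)
    (A : Matrix (Fin 2) (Fin 2) ℍ[ℝ]) :
    (Matrix.trace (k * A * star k)).re = (Matrix.trace A).re := by
  rw [re_trace_mul_comm, ← Matrix.mul_assoc, hk, Matrix.one_mul]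

lemma OrbitRel.invts_eq (h : OrbitRel v z v' z') : invts v' z' = invts v z := by
  obtain ⟨k, hk, l, hl, rfl, rfl⟩ := h
  obtain ⟨hk1, hk2⟩ := Unitary.mem_iff.1 hk
  obtain ⟨hl1, hl2⟩ := Unitary.mem_iff.1 hl
  have hpow : ∀ (A : Matrix (Fin 2) (Fin 2) ℍ[ℝ]) (m : ℕ),
      (k * A * star k) ^ m = k * A ^ m * star k := by
    intro A m
    induction m with
    | zero => simp [hk2]
    | succ m ih =>
      rw [pow_succ, ih, pow_succ]
      calc k * A ^ m * star k * (k * A * star k) = k * A ^ m * (star k * k) * A * star k := by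
            simp only [Matrix.mul_assoc]
        _ = _ := by rw [hk1]; simp [Matrix.mul_assoc]
  have hmul : ∀ A B : Matrix (Fin 2) (Fin 2) ℍ[ℝ],
      (k * A * star k) * (k * B * star k) = k * (A * B) * star k := by
    intro A B
    calc (k * A * star k) * (k * B * star k) = k * A * (star k * k) * B * star k := by
            simp only [Matrix.mul_assoc]
        _ = _ := by rw [hk1]; simp [Matrix.mul_assoc]
  have hH : (k * v * star l) * (k * v * star l).conjTranspose
      = k * (v * v.conjTranspose) * star k := by
    calc (k * v * star l) * (k * v * star l).conjTranspose
        = k * v * (star l * l) * v.conjTranspose * star k := by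
          simp [Matrix.mul_assoc, Matrix.star_eq_conjTranspose]
      _ = _ := by rw [hl1]; simp [Matrix.mul_assoc]
  have hzv : (k * z * star k) * (k * v * star l) *
        ((k * z * star k) * (k * v * star l)).conjTranspose
      = k * (z * v * (z * v).conjTranspose) * star k := by
    have : (k * z * star k) * (k * v * star l) = k * (z * v) * star l := by
      calc (k * z * star k) * (k * v * star l) = k * z * (star k * k) * v * star l := by
            simp only [Matrix.mul_assoc]
        _ = _ := by rw [hk1]; simp [Matrix.mul_assoc]
    rw [this]
    calc (k * (z * v) * star l) * (k * (z * v) * star l).conjTranspose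
        = k * (z * v) * (star l * l) * (z * v).conjTranspose * star k := by
          simp [Matrix.mul_assoc, Matrix.star_eq_conjTranspose]
      _ = _ := by rw [hl1]; simp [Matrix.mul_assoc]
  unfold invts
  rw [hzv, Matrix.mul_assoc (k * z * star k) (k * v * star l) _, hH, hmul, hmul, ← sub_mul,
    ← mul_sub, hpow, hpow, hpow, hpow]
  simp only [re_trace_conj hk1]
  simp only [Matrix.mul_assoc]

/-- The `2 × n` matrix `(1 0)`. -/
noncomputable def colEmbed (n : ℕ) : Matrix (Fin 2) (Fin n) ℍ[ℝ] :=
  Matrix.of fun i j => if j.val = i.val then 1 else 0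

lemma colEmbed_mul_conjTranspose (hn : 2 ≤ n) :
    colEmbed n * (colEmbed n).conjTranspose = 1 := by
  ext1 i j
  simp only [Matrix.mul_apply, Matrix.conjTranspose_apply, colEmbed, Matrix.of_apply]
  rw [Finset.sum_eq_single (Fin.castLE hn i)]
  · simp [Matrix.one_apply, Fin.ext_iff, apply_ite star]
  · intro b _ hb
    have : b.val ≠ i.val := fun h => hb (Fin.ext h)
    simp [this]
  · simp

/-- The right action of `Sp(2)` on `2 × 2` matrices is part of that of `Sp(n)`. -/
lemma orbitRel_colEmbed (hn : 2 ≤ n) (M : Matrix (Fin 2) (Fin 2) ℍ[ℝ])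
    (z : Matrix (Fin 2) (Fin 2) ℍ[ℝ]) {k l : Matrix (Fin 2) (Fin 2) ℍ[ℝ]}
    (hk : k ∈ unitary (Matrix (Fin 2) (Fin 2) ℍ[ℝ]))
    (hl : l ∈ unitary (Matrix (Fin 2) (Fin 2) ℍ[ℝ])) :
    OrbitRel (M * colEmbed n) z (k * M * star l * colEmbed n) (k * z * star k) := by
  obtain ⟨hl1, hl2⟩ := Unitary.mem_iff.1 hl
  set E := colEmbed n with hE
  have hEE : E * E.conjTranspose = 1 := colEmbed_mul_conjTranspose hn
  set L := E.conjTranspose * l * E + (1 - E.conjTranspose * E) with hL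
  set P := 1 - E.conjTranspose * E with hP
  have hEP : E * P = 0 := by
    rw [hP, Matrix.mul_sub, Matrix.mul_one, ← Matrix.mul_assoc, hEE, Matrix.one_mul, sub_self]
  have hPE : P * E.conjTranspose = 0 := by
    rw [hP, Matrix.sub_mul, Matrix.one_mul, Matrix.mul_assoc, hEE, Matrix.mul_one, sub_self]
  have hPP : P * P = P := by
    rw [hP, Matrix.sub_mul, ← hP, Matrix.one_mul, Matrix.mul_assoc, hEP, Matrix.mul_zero, sub_zero]
  have hsL : star L = E.conjTranspose * star l * E + P := by
    simp [hL, hP, Matrix.star_eq_conjTranspose, Matrix.mul_assoc]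
  have hEL : E * star L = star l * E := by
    rw [hsL, Matrix.mul_add, hEP, add_zero, ← Matrix.mul_assoc, ← Matrix.mul_assoc, hEE,
      Matrix.one_mul]
  have hLL : L * star L = 1 := by
    rw [hL, Matrix.add_mul, Matrix.mul_assoc _ E, hEL, hsL, Matrix.mul_add, hPP,
      Matrix.mul_assoc _ _ E, ← Matrix.mul_assoc P, hPE, Matrix.zero_mul, zero_add,
      Matrix.mul_assoc E.conjTranspose, ← Matrix.mul_assoc l, hl2, Matrix.one_mul, hP]
    abel
  refine ⟨k, hk, L, Unitary.mem_iff.2 ⟨mul_eq_one_comm.1 hLL, hLL⟩, ?_, rfl⟩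
  rw [Matrix.mul_assoc k (M * E), Matrix.mul_assoc M, hEL]
  simp only [Matrix.mul_assoc]

lemma invts_colEmbed (hn : 2 ≤ n) (M z : Matrix (Fin 2) (Fin 2) ℍ[ℝ]) :
    invts (M * colEmbed n) z = invts M z := by
  have hE := colEmbed_mul_conjTranspose hn
  have h : M * colEmbed n * (M * colEmbed n).conjTranspose = M * M.conjTranspose := by
    rw [Matrix.conjTranspose_mul, Matrix.mul_assoc, ← Matrix.mul_assoc (colEmbed n), hE,
      Matrix.one_mul]
  have h' : z * (M * colEmbed n) * (z * (M * colEmbed n)).conjTranspose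
      = z * M * (z * M).conjTranspose := by
    rw [← Matrix.mul_assoc z, Matrix.conjTranspose_mul, Matrix.mul_assoc,
      ← Matrix.mul_assoc (colEmbed n), hE, Matrix.one_mul]
  unfold invts
  rw [h', Matrix.mul_assoc z _ (M * colEmbed n).conjTranspose, h,
    Matrix.mul_assoc z M M.conjTranspose]

end Orbits

section Slices

/-- The quaternion `a + b i + c j + d k`. -/
def quat (a b c d : ℝ) : ℍ[ℝ] := ⟨a, b, c, d⟩

@[simp] lemma quat_re (a b c d : ℝ) : (quat a b c d).re = a := rfl

@[simp] lemma quat_imI (a b c d : ℝ) : (quat a b c d).imI = b := rfl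

@[simp] lemma quat_imJ (a b c d : ℝ) : (quat a b c d).imJ = c := rfl

@[simp] lemma quat_imK (a b c d : ℝ) : (quat a b c d).imK = d := rfl

lemma quat_mul (a b c d a' b' c' d' : ℝ) : quat a b c d * quat a' b' c' d' =
    quat (a * a' - b * b' - c * c' - d * d') (a * b' + b * a' + c * d' - d * c')
      (a * c' - b * d' + c * a' + d * b') (a * d' + b * c' - c * b' + d * a') := by
  ext <;> simp [Quaternion.re_mul, Quaternion.imI_mul, Quaternion.imJ_mul, Quaternion.imK_mul]

lemma quat_add (a b c d a' b' c' d' : ℝ) : quat a b c d + quat a' b' c' d' =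
    quat (a + a') (b + b') (c + c') (d + d') := rfl

lemma quat_sub (a b c d a' b' c' d' : ℝ) : quat a b c d - quat a' b' c' d' =
    quat (a - a') (b - b') (c - c') (d - d') := rfl

lemma quat_neg (a b c d : ℝ) : -quat a b c d = quat (-a) (-b) (-c) (-d) := rfl

lemma star_quat (a b c d : ℝ) : star (quat a b c d) = quat a (-b) (-c) (-d) := by
  ext <;> simp

lemma quat_one : quat 1 0 0 0 = 1 := rfl

lemma quat_zero : quat 0 0 0 0 = 0 := rfl

/-- The matrix `diag(α, β)`. -/
def diagSlice (α β : ℝ) : Matrix (Fin 2) (Fin 2) ℍ[ℝ] :=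
  !![quat α 0 0 0, quat 0 0 0 0; quat 0 0 0 0, quat β 0 0 0]

/-- Normal form of `z` when `v` is diagonal. -/
def skewSlice (q x y w : ℝ) : Matrix (Fin 2) (Fin 2) ℍ[ℝ] :=
  !![quat 0 x 0 0, quat q 0 0 0; quat (-q) 0 0 0, quat 0 y w 0]

/-- The matrix `diag(a i, b i)`. -/
def torusSlice (a b : ℝ) : Matrix (Fin 2) (Fin 2) ℍ[ℝ] :=
  !![quat 0 a 0 0, quat 0 0 0 0; quat 0 0 0 0, quat 0 b 0 0]

/-- Normal form of `v` when `z` is diagonal. -/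
def triSlice (α β c d : ℝ) : Matrix (Fin 2) (Fin 2) ℍ[ℝ] :=
  !![quat α 0 0 0, quat 0 0 0 0; quat c 0 d 0, quat β 0 0 0]

lemma conjTranspose_fin_two (a b c d : ℍ[ℝ]) :
    (!![a, b; c, d] : Matrix (Fin 2) (Fin 2) ℍ[ℝ]).conjTranspose =
      !![star a, star c; star b, star d] := by
  ext1 i j; fin_cases i <;> fin_cases j <;> rfl

lemma sub_fin_two (a b c d a' b' c' d' : ℍ[ℝ]) :
    (!![a, b; c, d] : Matrix (Fin 2) (Fin 2) ℍ[ℝ]) - !![a', b'; c', d'] =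
      !![a - a', b - b'; c - c', d - d'] := by
  ext1 i j; fin_cases i <;> fin_cases j <;> rfl

lemma sq_mul_self (M : Matrix (Fin 2) (Fin 2) ℍ[ℝ]) : M ^ 2 = M * M := sq M

lemma pow_four_mul_self (M : Matrix (Fin 2) (Fin 2) ℍ[ℝ]) : M ^ 4 = (M * M) * (M * M) := by
  rw [← sq, ← sq, ← pow_mul]

lemma invts_diagSlice_skewSlice (α β q x y w : ℝ) :
    invts (diagSlice α β) (skewSlice q x y w) =
      ![-(x ^ 2 + (y ^ 2 + w ^ 2) + 2 * q ^ 2),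
        (x ^ 2 + q ^ 2) ^ 2 + (y ^ 2 + w ^ 2 + q ^ 2) ^ 2
          + 2 * q ^ 2 * (x ^ 2 + (y ^ 2 + w ^ 2) + 2 * (x * y)),
        α ^ 2 + β ^ 2,
        α ^ 2 * (x ^ 2 + q ^ 2) + β ^ 2 * (y ^ 2 + w ^ 2 + q ^ 2),
        2 * q ^ 2 * (α ^ 2 - β ^ 2) ^ 2,
        α ^ 4 + β ^ 4] := by
  unfold invts diagSlice skewSlice
  simp only [sq_mul_self, pow_four_mul_self, conjTranspose_fin_two, Matrix.mul_fin_two, quat_mul,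
    star_quat, quat_add, sub_fin_two, quat_sub, Matrix.trace_fin_two_of, quat_re]
  congr! 1
  · ring
  congr! 1
  · ring
  congr! 1
  · ring
  congr! 1
  · ring
  congr! 1
  · ring
  congr! 1
  · ring

lemma invts_triSlice_torusSlice (a b α β c d : ℝ) :
    invts (triSlice α β c d) (torusSlice a b) =
      ![-(a ^ 2 + b ^ 2), a ^ 4 + b ^ 4,
        α ^ 2 + (c ^ 2 + d ^ 2 + β ^ 2),
        a ^ 2 * α ^ 2 + b ^ 2 * (c ^ 2 + d ^ 2 + β ^ 2),
        2 * α ^ 2 * ((a - b) ^ 2 * c ^ 2 + (a + b) ^ 2 * d ^ 2),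
        α ^ 4 + (c ^ 2 + d ^ 2 + β ^ 2) ^ 2 + 2 * α ^ 2 * (c ^ 2 + d ^ 2)] := by
  unfold invts triSlice torusSlice
  simp only [sq_mul_self, pow_four_mul_self, conjTranspose_fin_two, Matrix.mul_fin_two, quat_mul,
    star_quat, quat_add, sub_fin_two, quat_sub, Matrix.trace_fin_two_of, quat_re]
  congr! 1
  · ring
  congr! 1
  · ring
  congr! 1
  · ring
  congr! 1
  · ring
  congr! 1
  · ring
  congr! 1
  · ring

end Slices

/-- The real coordinates of a pair of quaternionic matrices. -/
def realCoords {n : ℕ} (v : Matrix (Fin 2) (Fin n) ℍ[ℝ]) (z : Matrix (Fin 2) (Fin 2) ℍ[ℝ]) :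
    Fin 2 × Fin n × Fin 4 ⊕ Fin 2 × Fin 2 × Fin 4 → ℝ :=
  Sum.elim
    (fun q => ![(v q.1 q.2.1).re, (v q.1 q.2.1).imI, (v q.1 q.2.1).imJ, (v q.1 q.2.1).imK] q.2.2)
    fun q => ![(z q.1 q.2.1).re, (z q.1 q.2.1).imI, (z q.1 q.2.1).imJ, (z q.1 q.2.1).imK] q.2.2

section Denominators

open MvPolynomial

/-- Half the discriminant of `v v*`. -/
noncomputable def discV : MvPolynomial (Fin 6) ℝ := X 5 - C (1 / 2) * X 2 ^ 2

/-- A polynomial whose vanishing expresses that a diagonal entry of `z` vanishes when `v v*` is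
diagonal. -/
noncomputable def discZV : MvPolynomial (Fin 6) ℝ :=
  (2 * discV * X 0 + X 4) ^ 2 - 2 * discV * (2 * X 3 + X 0 * X 2) ^ 2

/-- The denominator arising when `v` is diagonalised. -/
noncomputable def denomV : MvPolynomial (Fin 6) ℝ := discV * X 4 * discZV

/-- The discriminant of `z²`. -/
noncomputable def discZ : MvPolynomial (Fin 6) ℝ := 2 * X 1 - X 0 ^ 2

/-- Twice the product of the squares of the eigenvalues of `z`. -/
noncomputable def detZ : MvPolynomial (Fin 6) ℝ := X 0 ^ 2 - X 1

/-- The product of the diagonal entries of `v v*` and `discZ` when `z` is diagonal. -/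
noncomputable def diagVZ : MvPolynomial (Fin 6) ℝ :=
  -X 3 ^ 2 - X 0 * X 2 * X 3 - C (1 / 2) * detZ * X 2 ^ 2

/-- The denominator arising when `z` is diagonalised. -/
noncomputable def denomZ : MvPolynomial (Fin 6) ℝ := discZ * detZ * diagVZ

end Denominators

lemma mul_colEmbed_apply {n : ℕ} (M : Matrix (Fin 2) (Fin 2) ℍ[ℝ]) (i : Fin 2) (j : Fin n) :
    (M * colEmbed n) i j = if j.val = 0 then M i 0 else if j.val = 1 then M i 1 else 0 := by
  simp only [Matrix.mul_apply, Fin.sum_univ_two, colEmbed, Matrix.of_apply]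
  rcases hj : j.val with _ | _ | k <;> simp

/-- The coordinates of a family `(M x * colEmbed n, Z x)` lie in a subalgebra containing the
coordinates of `M` and `Z`. -/
lemma realCoords_mem {X : Type*} {n : ℕ} (A : Subalgebra ℝ (X → ℝ))
    (M Z : X → Matrix (Fin 2) (Fin 2) ℍ[ℝ])
    (h : ∀ i, (fun x => realCoords (M x) (Z x) i) ∈ A) :
    ∀ i, (fun x => realCoords (M x * colEmbed n) (Z x) i) ∈ A := by
  rintro (⟨i, j, k⟩ | ⟨i, j, k⟩)
  · simp only [realCoords, Sum.elim_inl, mul_colEmbed_apply]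
    split_ifs
    · exact h (Sum.inl (i, 0, k))
    · exact h (Sum.inl (i, 1, k))
    · convert A.zero_mem using 1
      funext x
      fin_cases k <;> rfl
  · exact h (Sum.inr (i, j, k))

section DiagonalV

/-- The invariants on the slice with diagonal `v`, with parameters `(α, β, q, x, y, w)`. -/
def diagInvts (u : Fin 6 → ℝ) : Fin 6 → ℝ :=
  ![-(u 3 ^ 2 + (u 4 ^ 2 + u 5 ^ 2) + 2 * u 2 ^ 2),
    (u 3 ^ 2 + u 2 ^ 2) ^ 2 + (u 4 ^ 2 + u 5 ^ 2 + u 2 ^ 2) ^ 2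
      + 2 * u 2 ^ 2 * (u 3 ^ 2 + (u 4 ^ 2 + u 5 ^ 2) + 2 * (u 3 * u 4)),
    u 0 ^ 2 + u 1 ^ 2,
    u 0 ^ 2 * (u 3 ^ 2 + u 2 ^ 2) + u 1 ^ 2 * (u 4 ^ 2 + u 5 ^ 2 + u 2 ^ 2),
    2 * u 2 ^ 2 * (u 0 ^ 2 - u 1 ^ 2) ^ 2,
    u 0 ^ 4 + u 1 ^ 4]

lemma eval_discV_diagInvts (u : Fin 6 → ℝ) :
    MvPolynomial.eval (diagInvts u) discV = (u 0 ^ 2 - u 1 ^ 2) ^ 2 / 2 := by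
  simp [discV, diagInvts]; ring

lemma eval_discZV_diagInvts (u : Fin 6 → ℝ) :
    MvPolynomial.eval (diagInvts u) discZV =
      4 * (u 0 ^ 2 - u 1 ^ 2) ^ 4 * u 3 ^ 2 * (u 4 ^ 2 + u 5 ^ 2) := by
  have := eval_discV_diagInvts u
  simp only [discZV, map_sub, map_mul, map_pow, map_add, this, MvPolynomial.eval_X, map_ofNat]
  simp [diagInvts]; ring

/-- The regular points of the slice with diagonal `v`. -/
abbrev RegDiag := {u : Fin 6 → ℝ // MvPolynomial.eval (diagInvts u) denomV ≠ 0}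

lemma RegDiag.ne_zero (u : RegDiag) : u.1 0 ^ 2 - u.1 1 ^ 2 ≠ 0 ∧ u.1 2 ≠ 0 ∧ u.1 3 ≠ 0 ∧
    u.1 4 ^ 2 + u.1 5 ^ 2 ≠ 0 := by
  have h := u.2
  simp only [denomV, map_mul, eval_discV_diagInvts, eval_discZV_diagInvts, MvPolynomial.eval_X] at h
  refine ⟨?_, ?_, ?_, ?_⟩ <;> intro h0 <;> apply h <;> simp [h0, diagInvts]

/-- On the regular part of the slice with diagonal `v`, a function of the parameters which is
invariant under the evident sign changes is a rational function of the invariants and of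
`α² - β²`. -/
lemma mem_adjoin_of_sign_invariant_diag (f : RegDiag → ℝ)
    (hf : ∀ A : Subalgebra ℝ (RegDiag → ℝ), (∀ i, (fun u : RegDiag => u.1 i) ∈ A) → f ∈ A)
    (hσ : ∀ (u u' : RegDiag),
      (u'.1 = ![-u.1 0, u.1 1, u.1 2, u.1 3, u.1 4, u.1 5] ∨
       u'.1 = ![u.1 0, -u.1 1, u.1 2, u.1 3, u.1 4, u.1 5] ∨
       u'.1 = ![u.1 0, u.1 1, -u.1 2, u.1 3, u.1 4, u.1 5] ∨
       u'.1 = ![u.1 0, u.1 1, u.1 2, -u.1 3, -u.1 4, u.1 5] ∨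
       u'.1 = ![u.1 0, u.1 1, u.1 2, u.1 3, u.1 4, -u.1 5]) → f u' = f u) :
    f ∈ Algebra.adjoin ℝ (insert (fun u : RegDiag => u.1 0 ^ 2 - u.1 1 ^ 2)
      (locGens (fun u : RegDiag => diagInvts u.1) denomV)) := by
  set δ : RegDiag → ℝ := fun u => u.1 0 ^ 2 - u.1 1 ^ 2 with hδ
  set S := insert δ (locGens (fun u : RegDiag => diagInvts u.1) denomV) with hS
  set B := Algebra.adjoin ℝ S with hB
  have hle : Algebra.adjoin ℝ (locGens (fun u : RegDiag => diagInvts u.1) denomV) ≤ B :=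
    Algebra.adjoin_mono (Set.subset_insert _ _)
  have hW : ∀ u : RegDiag, MvPolynomial.eval (diagInvts u.1) denomV ≠ 0 := fun u => u.2
  have mδ : δ ∈ B := Algebra.subset_adjoin (Set.mem_insert _ _)
  have mY : ∀ i, (fun u : RegDiag => diagInvts u.1 i) ∈ B := fun i =>
    hle (locGens_coord_mem (fun u : RegDiag => diagInvts u.1) denomV i)
  have mdisc : (fun u : RegDiag => (MvPolynomial.eval (diagInvts u.1) discV)⁻¹) ∈ B :=
    hle (locGens_inv_mem_of_dvd hW ⟨_, mul_assoc _ _ _⟩)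
  have m4 : (fun u : RegDiag => (MvPolynomial.eval (diagInvts u.1) (MvPolynomial.X 4))⁻¹) ∈ B :=
    hle (locGens_inv_mem_of_dvd hW ((dvd_mul_left _ _).trans (dvd_mul_right _ _)))
  have m6 : (fun u : RegDiag => (MvPolynomial.eval (diagInvts u.1) discZV)⁻¹) ∈ B :=
    hle (locGens_inv_mem_of_dvd hW (dvd_mul_left _ _))
  simp only [eval_discV_diagInvts, eval_discZV_diagInvts, MvPolynomial.eval_X] at mdisc m4 m6
  have e0 := mY 0
  have e1 := mY 1
  have e2 := mY 2
  have e3 := mY 3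
  have e4 := mY 4
  simp only [diagInvts, Matrix.cons_val] at e0 e1 e2 e3 e4 m4
  have mα : (fun u : RegDiag => u.1 0 ^ 2) ∈ B := by
    convert B.smul_mem (B.add_mem e2 mδ) (1 / 2 : ℝ) using 1
    funext u
    simp [hδ]; ring
  have mβ : (fun u : RegDiag => u.1 1 ^ 2) ∈ B := by
    convert B.smul_mem (B.sub_mem e2 mδ) (1 / 2 : ℝ) using 1
    funext u
    simp [hδ]; ring
  have mq : (fun u : RegDiag => u.1 2 ^ 2) ∈ B := by
    convert B.smul_mem (B.mul_mem e4 mdisc) (1 / 4 : ℝ) using 1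
    funext u
    obtain ⟨h1, h2, h3, h4⟩ := u.ne_zero
    simp; field_simp; norm_num
  have mqi : (fun u : RegDiag => (u.1 2 ^ 2)⁻¹) ∈ B := by
    convert B.smul_mem (B.mul_mem (B.mul_mem mδ mδ) m4) (2 : ℝ) using 1
    funext u
    obtain ⟨h1, h2, h3, h4⟩ := u.ne_zero
    simp [hδ]; field_simp
  have mx : (fun u : RegDiag => u.1 3 ^ 2) ∈ B := by
    convert B.smul_mem (B.add_mem (B.sub_mem (B.neg_mem e0) (B.smul_mem mq (2 : ℝ)))
      (B.smul_mem (B.mul_mem (B.mul_mem mδ mdisc)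
        (B.add_mem (B.smul_mem e3 (2 : ℝ)) (B.mul_mem e0 e2))) (1 / 2 : ℝ))) (1 / 2 : ℝ) using 1
    funext u
    obtain ⟨h1, h2, h3, h4⟩ := u.ne_zero
    simp [hδ]; field_simp; ring
  have mr : (fun u : RegDiag => u.1 4 ^ 2 + u.1 5 ^ 2) ∈ B := by
    convert B.sub_mem (B.sub_mem (B.neg_mem e0) (B.smul_mem mq (2 : ℝ))) mx using 1
    funext u
    simp only [Pi.sub_apply, Pi.neg_apply, Pi.smul_apply, smul_eq_mul]; ring
  have mxi : (fun u : RegDiag => (u.1 3 ^ 2)⁻¹) ∈ B := by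
    convert B.smul_mem (B.mul_mem (B.mul_mem mr (B.pow_mem mδ 4)) m6) (4 : ℝ) using 1
    funext u
    obtain ⟨h1, h2, h3, h4⟩ := u.ne_zero
    simp [hδ]; field_simp
  have mxy : (fun u : RegDiag => u.1 3 * u.1 4) ∈ B := by
    convert B.smul_mem (B.mul_mem mqi (B.sub_mem (B.sub_mem (B.sub_mem e1
      (B.pow_mem (B.add_mem mx mq) 2)) (B.pow_mem (B.add_mem mr mq) 2))
      (B.smul_mem (B.mul_mem mq (B.add_mem mx mr)) (2 : ℝ)))) (1 / 4 : ℝ) using 1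
    funext u
    obtain ⟨h1, h2, h3, h4⟩ := u.ne_zero
    simp; field_simp; ring
  have mw : (fun u : RegDiag => u.1 5 ^ 2) ∈ B := by
    convert B.sub_mem mr (B.mul_mem (B.pow_mem mxy 2) mxi) using 1
    funext u
    obtain ⟨h1, h2, h3, h4⟩ := u.ne_zero
    simp; field_simp; ring
  set t : Fin 5 → RegDiag → ℝ := ![fun u => u.1 0, fun u => u.1 1, fun u => u.1 2, fun u => u.1 3,
    fun u => u.1 5] with ht
  set ε : Fin 5 → Fin 6 → ℝ := ![![-1, 1, 1, 1, 1, 1], ![1, -1, 1, 1, 1, 1], ![1, 1, -1, 1, 1, 1],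
    ![1, 1, 1, -1, -1, 1], ![1, 1, 1, 1, 1, -1]] with hε
  have hY : ∀ i (u : Fin 6 → ℝ), diagInvts (fun j => ε i j * u j) = diagInvts u := by
    intro i u
    fin_cases i <;> simp [diagInvts, hε, Even.neg_pow, show Even 4 from ⟨2, rfl⟩]
  refine mem_adjoin_of_even_family t
    (fun i u => ⟨fun j => ε i j * u.1 j, (hY i u.1).symm ▸ u.2⟩) ?_ ?_ ?_ ?_ ?_ ?_
  · intro i
    rw [← sq]
    fin_cases i
    exacts [mα, mβ, mq, mx, mw]
  · rintro i s (rfl | rfl | ⟨j, rfl⟩) u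
    · fin_cases i <;> simp [hδ, hε]
    · simp only [hY]
    · simp only [hY]
  · intro i u
    fin_cases i <;> simp [ht, hε]
  · intro i j hij u
    fin_cases i <;> fin_cases j <;> simp [ht, hε] at hij ⊢
  · have hle' : B ≤ Algebra.adjoin ℝ (S ∪ Set.range t) :=
      Algebra.adjoin_mono Set.subset_union_left
    have mt : ∀ i, t i ∈ Algebra.adjoin ℝ (S ∪ Set.range t) := fun i =>
      Algebra.subset_adjoin (Or.inr ⟨i, rfl⟩)
    refine hf _ fun i => ?_
    fin_cases i
    · exact mt 0
    · exact mt 1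
    · exact mt 2
    · exact mt 3
    · convert mul_mem (mt 3) (mul_mem (hle' mxy) (hle' mxi)) using 1
      funext u
      obtain ⟨h1, h2, h3, h4⟩ := u.ne_zero
      simp [ht]; field_simp
    · exact mt 4
  · intro i u
    refine hσ _ _ ?_
    fin_cases i
    · refine Or.inl (funext fun j => ?_)
      fin_cases j <;> simp [hε]
    · refine Or.inr (Or.inl (funext fun j => ?_))
      fin_cases j <;> simp [hε]
    · refine Or.inr (Or.inr (Or.inl (funext fun j => ?_)))
      fin_cases j <;> simp [hε]
    · refine Or.inr (Or.inr (Or.inr (Or.inl (funext fun j => ?_))))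
      fin_cases j <;> simp [hε]
    · refine Or.inr (Or.inr (Or.inr (Or.inr (funext fun j => ?_))))
      fin_cases j <;> simp [hε]

end DiagonalV

section NormalForms

instance : StarModule ℝ ℍ[ℝ] := ⟨fun r q => by ext <;> simp⟩

lemma mem_unitary_of_mul_conjTranspose {n : ℕ} {k : Matrix (Fin n) (Fin n) ℍ[ℝ]}
    (h : k * k.conjTranspose = 1) : k ∈ unitary (Matrix (Fin n) (Fin n) ℍ[ℝ]) :=
  Unitary.mem_iff.2 ⟨mul_eq_one_comm.1 h, h⟩

open Matrix in
/-- Quaternionic Householder reflections. -/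
lemma exists_householder {n : ℕ} (x : Fin n → ℍ[ℝ]) (i : Fin n) :
    ∃ P ∈ unitary (Matrix (Fin n) (Fin n) ℍ[ℝ]), ∃ γ : ℍ[ℝ], x ᵥ* P = Pi.single i γ ∧
      ∀ y : Fin n → ℍ[ℝ], y ⬝ᵥ star x = 0 → y i = 0 → y ᵥ* P = y := by
  have hsum : ∀ u : Fin n → ℍ[ℝ], u ⬝ᵥ star u = ((∑ j, ‖u j‖ ^ 2 : ℝ) : ℍ[ℝ]) := by
    intro u
    simp only [dotProduct, Pi.star_apply, Quaternion.self_mul_star,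
      Quaternion.normSq_eq_norm_mul_self, sq]
    exact (map_sum (algebraMap ℝ ℍ[ℝ]) _ _).symm
  obtain ⟨ω, hω, hxω⟩ : ∃ ω : ℍ[ℝ], ω * star ω = 1 ∧ x i * star ω = (‖x i‖ : ℍ[ℝ]) := by
    by_cases h : x i = 0
    · exact ⟨1, by simp, by simp [h]⟩
    · have h' : (‖x i‖ : ℝ) ≠ 0 := by simpa using h
      refine ⟨(‖x i‖⁻¹ : ℝ) • x i, ?_, ?_⟩
      · rw [star_smul, star_trivial, smul_mul_smul_comm, Quaternion.self_mul_star,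
          Quaternion.normSq_eq_norm_mul_self, ← Quaternion.coe_smul]
        simp only [smul_eq_mul]
        rw [show ‖x i‖⁻¹ * ‖x i‖⁻¹ * (‖x i‖ * ‖x i‖) = 1 by field_simp, Quaternion.coe_one]
      · rw [star_smul, star_trivial, mul_smul_comm, Quaternion.self_mul_star,
          Quaternion.normSq_eq_norm_mul_self, ← Quaternion.coe_smul]
        simp only [smul_eq_mul]
        rw [inv_mul_cancel_left₀ h']
  set s : ℝ := Real.sqrt (∑ j, ‖x j‖ ^ 2) with hs
  have hs2 : s ^ 2 = ∑ j, ‖x j‖ ^ 2 := Real.sq_sqrt (Finset.sum_nonneg fun _ _ => by positivity)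
  set γ : ℍ[ℝ] := s • ω with hγ
  have hγγ : γ * star γ = ((s ^ 2 : ℝ) : ℍ[ℝ]) := by
    rw [hγ, star_smul, star_trivial, smul_mul_smul_comm, hω, sq]
    ext <;> simp
  have hxγ : x i * star γ = ((s * ‖x i‖ : ℝ) : ℍ[ℝ]) := by
    rw [hγ, star_smul, star_trivial, mul_smul_comm, hxω]
    ext <;> simp
  set u : Fin n → ℍ[ℝ] := x - Pi.single i γ with hu
  set τ : ℝ := ∑ j, ‖u j‖ ^ 2 with hτ
  have hxu : x ⬝ᵥ star u = ((s ^ 2 - s * ‖x i‖ : ℝ) : ℍ[ℝ]) := by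
    rw [hu, star_sub, dotProduct_sub, hsum, ← hs2, ← Pi.single_star, dotProduct_single, hxγ]
    simp
  have huu : u ⬝ᵥ star u = (τ : ℍ[ℝ]) := hsum u
  have hτ2 : τ = 2 * (s ^ 2 - s * ‖x i‖) := by
    have h1 : u ⬝ᵥ star u = ((2 * (s ^ 2 - s * ‖x i‖) : ℝ) : ℍ[ℝ]) := by
      conv_lhs => rw [show u = x - Pi.single i γ from rfl, sub_dotProduct]
      rw [hxu, single_dotProduct]
      have h2 : star (u i) = star (x i) - star γ := by simp [hu]
      have h3 : γ * star (x i) = ((s * ‖x i‖ : ℝ) : ℍ[ℝ]) := by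
        have := congrArg star hxγ
        rwa [star_mul, star_star, Quaternion.star_coe] at this
      rw [Pi.star_apply, h2, mul_sub, h3, hγγ]
      rw [← Quaternion.coe_sub, ← Quaternion.coe_sub]
      congr 1
      ring
    rw [huu] at h1
    exact Quaternion.coe_injective h1
  set T : Matrix (Fin n) (Fin n) ℍ[ℝ] := vecMulVec (star u) u with hT
  have hTs : T.conjTranspose = T := by
    rw [hT, conjTranspose_vecMulVec, star_star]
  have hTT : T * T = τ • T := by
    ext1 a b
    have : (T * T) a b = star (u a) * (u ⬝ᵥ star u) * u b := by
      simp only [hT, mul_apply, vecMulVec_apply, dotProduct, Finset.mul_sum, Finset.sum_mul]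
      exact Finset.sum_congr rfl fun c _ => by simp [mul_assoc]
    rw [this, huu]
    simp only [hT, Matrix.smul_apply, vecMulVec_apply, Pi.star_apply]
    rw [← Quaternion.coe_commutes, mul_assoc, Quaternion.coe_mul_eq_smul]
  have hvT : ∀ y : Fin n → ℍ[ℝ], y ᵥ* T = fun j => (y ⬝ᵥ star u) * u j := by
    intro y
    funext j
    simp only [hT, vecMul, dotProduct, vecMulVec_apply, Finset.sum_mul]
    exact Finset.sum_congr rfl fun c _ => by simp [mul_assoc]
  refine ⟨1 - (2 / τ) • T, mem_unitary_of_mul_conjTranspose ?_, γ, ?_, ?_⟩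
  · rw [conjTranspose_sub, conjTranspose_one, conjTranspose_smul, star_trivial, hTs, sub_mul, one_mul,
      mul_sub, mul_one, smul_mul_smul_comm, hTT, smul_smul]
    by_cases h : τ = 0
    · simp [h]
    · rw [show 2 / τ * (2 / τ) * τ = 2 / τ + 2 / τ by field_simp; ring, add_smul]
      abel
  · rw [vecMul_sub, vecMul_one, vecMul_smul, hvT, hxu]
    funext j
    by_cases h : τ = 0
    · have : u j = 0 := by
        have := (Finset.sum_eq_zero_iff_of_nonneg fun j _ => by positivity).1 h j (Finset.mem_univ j)
        simpa using this
      have h' : x j - (Pi.single i γ : Fin n → ℍ[ℝ]) j = 0 := this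
      simpa [h] using sub_eq_zero.1 h'
    · simp only [Pi.sub_apply, Pi.smul_apply, Quaternion.coe_mul_eq_smul, smul_smul]
      rw [show 2 / τ * (s ^ 2 - s * ‖x i‖) = 1 by
        rw [div_mul_eq_mul_div, ← hτ2, div_self h]]
      simp [hu]
  · intro y hy hyi
    have : y ⬝ᵥ star u = 0 := by
      rw [hu, star_sub, dotProduct_sub, hy, ← Pi.single_star, dotProduct_single, hyi]
      simp
    rw [vecMul_sub, vecMul_one, vecMul_smul, hvT, this]
    funext j
    simp

lemma exists_half_angle (a b : ℝ) :
    ∃ r C S : ℝ, C ^ 2 + S ^ 2 = 1 ∧ a = r * (C ^ 2 - S ^ 2) ∧ b = r * (2 * C * S) := by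
  set ζ : ℂ := ⟨a, b⟩
  have h1 := Complex.norm_mul_cos_arg ζ
  have h2 := Complex.norm_mul_sin_arg ζ
  refine ⟨‖ζ‖, Real.cos (ζ.arg / 2), Real.sin (ζ.arg / 2), Real.cos_sq_add_sin_sq _, ?_, ?_⟩
  · rw [← Real.cos_two_mul', show 2 * (ζ.arg / 2) = ζ.arg by ring, h1]
  · rw [show 2 * Real.cos (ζ.arg / 2) * Real.sin (ζ.arg / 2) = Real.sin (2 * (ζ.arg / 2)) by
      rw [Real.sin_two_mul]; ring, show 2 * (ζ.arg / 2) = ζ.arg by ring, h2]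

lemma eq_quat (p : ℍ[ℝ]) : p = quat p.re p.imI p.imJ p.imK := rfl

lemma quat_mul_star_self {a b c d : ℝ} (h : a ^ 2 + b ^ 2 + c ^ 2 + d ^ 2 = 1) :
    quat a b c d * star (quat a b c d) = 1 := by
  rw [star_quat, quat_mul, ← quat_one]
  congr 1 <;> linarith

/-- A unit quaternion commuting with `i` rotates an imaginary quaternion into the `(i,j)` plane. -/
lemma exists_rotate_imJ (a b c : ℝ) : ∃ C S r : ℝ, C ^ 2 + S ^ 2 = 1 ∧
    quat C S 0 0 * quat 0 a b c * star (quat C S 0 0) = quat 0 a r 0 := by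
  obtain ⟨r, C, S, h, rfl, rfl⟩ := exists_half_angle b c
  refine ⟨C, -S, r, by linarith, ?_⟩
  simp only [star_quat, quat_mul]
  congr 1
  · ring
  · linear_combination a * h
  · linear_combination r * (C ^ 2 + S ^ 2 + 1) * h
  · ring

/-- Imaginary quaternions are conjugate to real multiples of `i`. -/
lemma exists_rotate_imI {p : ℍ[ℝ]} (hp : p.re = 0) : ∃ (u : ℍ[ℝ]) (x : ℝ), u * star u = 1 ∧
    u * p * star u = quat 0 x 0 0 := by
  obtain ⟨C, S, r, h, h1⟩ := exists_rotate_imJ p.imI p.imJ p.imK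
  obtain ⟨x, C', S', h', h2, h3⟩ := exists_half_angle p.imI r
  have hu := quat_mul_star_self (a := C) (b := S) (c := 0) (d := 0) (by linarith)
  have hu' := quat_mul_star_self (a := C') (b := 0) (c := 0) (d := -S') (by linarith)
  refine ⟨quat C' 0 0 (-S') * quat C S 0 0, x, ?_, ?_⟩
  · rw [star_mul, mul_assoc, ← mul_assoc (quat C S 0 0), hu, one_mul, hu']
  · rw [eq_quat p, hp, star_mul]
    calc _ = quat C' 0 0 (-S') * (quat C S 0 0 * quat 0 p.imI p.imJ p.imK * star (quat C S 0 0)) *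
        star (quat C' 0 0 (-S')) := by simp only [mul_assoc]
      _ = _ := by
        rw [h1, h2, h3]
        simp only [star_quat, quat_mul]
        congr 1
        · ring
        · linear_combination x * (C' ^ 2 + S' ^ 2 + 1) * h'
        · ring
        · ring

lemma exists_phase (q : ℍ[ℝ]) : ∃ (w : ℍ[ℝ]) (s : ℝ), w * star w = 1 ∧
    q * star w = quat s 0 0 0 := by
  by_cases h : q = 0
  · exact ⟨1, 0, by simp, by simp [h, quat_zero]⟩
  · have h' : (‖q‖ : ℝ) ≠ 0 := by simpa using h
    refine ⟨(‖q‖⁻¹ : ℝ) • q, ‖q‖, ?_, ?_⟩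
    · rw [star_smul, star_trivial, smul_mul_smul_comm, Quaternion.self_mul_star,
        Quaternion.normSq_eq_norm_mul_self, ← Quaternion.coe_smul, smul_eq_mul]
      rw [show ‖q‖⁻¹ * ‖q‖⁻¹ * (‖q‖ * ‖q‖) = 1 by field_simp, Quaternion.coe_one]
    · rw [star_smul, star_trivial, mul_smul_comm, Quaternion.self_mul_star,
        Quaternion.normSq_eq_norm_mul_self, ← Quaternion.coe_smul, smul_eq_mul]
      rw [inv_mul_cancel_left₀ h']
      rfl

lemma diag_mem_unitary {u w : ℍ[ℝ]} (hu : u * star u = 1) (hw : w * star w = 1) :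
    !![u, 0; 0, w] ∈ unitary (Matrix (Fin 2) (Fin 2) ℍ[ℝ]) := by
  refine mem_unitary_of_mul_conjTranspose ?_
  simp [conjTranspose_fin_two, hu, hw, Matrix.one_fin_two]

/-- The rotation matrix with entries `C`, `S`. -/
def rot (C S : ℝ) : Matrix (Fin 2) (Fin 2) ℍ[ℝ] :=
  !![quat C 0 0 0, quat S 0 0 0; quat (-S) 0 0 0, quat C 0 0 0]

lemma rot_mem_unitary {C S : ℝ} (h : C ^ 2 + S ^ 2 = 1) :
    rot C S ∈ unitary (Matrix (Fin 2) (Fin 2) ℍ[ℝ]) := by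
  refine mem_unitary_of_mul_conjTranspose ?_
  simp only [rot, conjTranspose_fin_two, Matrix.mul_fin_two, quat_mul, star_quat, quat_add,
    Matrix.one_fin_two, ← quat_one, ← quat_zero]
  congr! <;> nlinarith

lemma diag_conj (u w a b c d : ℍ[ℝ]) :
    !![u, 0; 0, w] * !![a, b; c, d] * star !![u, 0; 0, w] =
      !![u * a * star u, u * b * star w; w * c * star u, w * d * star w] := by
  simp [Matrix.star_eq_conjTranspose, conjTranspose_fin_two]

lemma exists_skew_eq {z : Matrix (Fin 2) (Fin 2) ℍ[ℝ]} (hz : z.conjTranspose = -z) :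
    ∃ p q r : ℍ[ℝ], p.re = 0 ∧ r.re = 0 ∧ z = !![p, q; -star q, r] := by
  have h : ∀ i j, star (z j i) = -z i j := fun i j => by
    simpa using congrFun (congrFun hz i) j
  have hre : ∀ i, (z i i).re = 0 := fun i => by
    have := congrArg (fun q : ℍ[ℝ] => q.re) (h i i)
    simp at this
    linarith
  refine ⟨z 0 0, z 0 1, z 1 1, hre 0, hre 1, ?_⟩
  rw [h 1 0, neg_neg]
  exact Matrix.eta_fin_two z

lemma exists_conj_skewSlice {z : Matrix (Fin 2) (Fin 2) ℍ[ℝ]} (hz : z.conjTranspose = -z) :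
    ∃ u w : ℍ[ℝ], u * star u = 1 ∧ w * star w = 1 ∧ ∃ q x y t : ℝ,
      !![u, 0; 0, w] * z * star !![u, 0; 0, w] = skewSlice q x y t := by
  obtain ⟨p, q, r, hp, hr, rfl⟩ := exists_skew_eq hz
  obtain ⟨w, s, hw, hqw⟩ := exists_phase q
  obtain ⟨u, x, hu, hux⟩ := exists_rotate_imI hp
  set r' := u * (w * r * star w) * star u with hr'
  have hr're : r'.re = 0 := by
    have hs : star r = -r := by
      rw [eq_quat r, hr, star_quat, quat_neg, neg_zero]
    have : star r' = -r' := by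
      rw [hr']; simp [hs, mul_assoc]
    have := congrArg (fun q : ℍ[ℝ] => q.re) this
    simp at this
    linarith
  obtain ⟨C, S, t, h, ht⟩ := exists_rotate_imJ r'.imI r'.imJ r'.imK
  set g := quat C S 0 0 with hg
  have hgg : g * star g = 1 := quat_mul_star_self (by linarith)
  have hrr : r' = quat 0 r'.imI r'.imJ r'.imK := by
    have h0 := eq_quat r'
    rwa [hr're] at h0
  have hmul : ∀ {a b : ℍ[ℝ]}, a * star a = 1 → b * star b = 1 → (a * b) * star (a * b) = 1 := by
    intro a b ha hb
    rw [star_mul, mul_assoc, ← mul_assoc b, hb, one_mul, ha]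
  have hreal : ∀ {a : ℍ[ℝ]}, a * star a = 1 → a * quat s 0 0 0 * star a = quat s 0 0 0 := by
    intro a ha
    change a * (s : ℍ[ℝ]) * star a = (s : ℍ[ℝ])
    rw [← Quaternion.coe_commutes, mul_assoc, ha, mul_one]
  refine ⟨g * u, g * u * w, hmul hgg hu, hmul (hmul hgg hu) hw, s, x, r'.imI, t, ?_⟩
  rw [diag_conj, skewSlice]
  have h01 : g * u * q * star (g * u * w) = quat s 0 0 0 := by
    calc _ = g * u * (q * star w) * star (g * u) := by simp only [star_mul, mul_assoc]
      _ = _ := by rw [hqw, hreal (hmul hgg hu)]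
  have h10 : g * u * w * -star q * star (g * u) = quat (-s) 0 0 0 := by
    have := congrArg star h01
    rw [star_quat] at this
    rw [show quat (-s) 0 0 0 = -quat s (-0) (-0) (-0) by simp [quat_neg], ← this]
    simp [mul_assoc]
  have h11 : g * u * w * r * star (g * u * w) = quat 0 r'.imI t 0 := by
    rw [← ht, ← hrr]
    simp only [hr', star_mul, mul_assoc]
  have h00 : g * u * p * star (g * u) = quat 0 x 0 0 := by
    calc g * u * p * star (g * u) = g * (u * p * star u) * star g := by
          simp only [star_mul, mul_assoc]
      _ = _ := by
        rw [hux, hg, star_quat, quat_mul, quat_mul]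
        congr 1
        · ring
        · linear_combination x * h
        · ring
        · ring
  rw [h00, h01, h10, h11]

end NormalForms

section OrbitNormalForms

variable {n : ℕ}

open Matrix in
lemma exists_orbitRel_lower_triangular (hn : 2 ≤ n) (v : Matrix (Fin 2) (Fin n) ℍ[ℝ])
    (z : Matrix (Fin 2) (Fin 2) ℍ[ℝ]) : ∃ (α β : ℝ) (q : ℍ[ℝ]),
      OrbitRel v z (!![quat α 0 0 0, 0; q, quat β 0 0 0] * colEmbed n) z := by
  set i₀ : Fin n := ⟨0, by lia⟩ with hi₀
  set i₁ : Fin n := ⟨1, by lia⟩ with hi₁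
  obtain ⟨P, hP, γ, hγ, -⟩ := exists_householder (v 0) i₀
  set y : Fin n → ℍ[ℝ] := v 1 ᵥ* P with hy
  set y' : Fin n → ℍ[ℝ] := y - Pi.single i₀ (y i₀) with hy'
  obtain ⟨P', hP', δ, hδ, hfix⟩ := exists_householder y' i₁
  have hsingle : ∀ a : ℍ[ℝ], (Pi.single i₀ a : Fin n → ℍ[ℝ]) ᵥ* P' = Pi.single i₀ a := by
    intro a
    refine hfix _ ?_ ?_
    · rw [single_dotProduct]
      simp [hy']
    · simp [hi₀, hi₁]
  have h0 : v 0 ᵥ* (P * P') = Pi.single i₀ γ := by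
    rw [← vecMul_vecMul, hγ, hsingle]
  have h1 : v 1 ᵥ* (P * P') = Pi.single i₀ (y i₀) + Pi.single i₁ δ := by
    rw [← vecMul_vecMul, ← hy, ← hδ, ← hsingle, ← add_vecMul]
    simp [hy']
  have hM : v * (P * P') = !![γ, 0; y i₀, δ] * colEmbed n := by
    ext1 i j
    rw [mul_colEmbed_apply]
    have hj0 : j.val = 0 ↔ j = i₀ := by rw [Fin.ext_iff]
    have hj1 : j.val = 1 ↔ j = i₁ := by rw [Fin.ext_iff]
    have hne : i₀ ≠ i₁ := by simp [hi₀, hi₁]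
    simp only [hj0, hj1]
    fin_cases i
    · refine (congrFun h0 j).trans ?_
      by_cases h : j = i₀
      · simp [h]
      · simp [h]
    · refine (congrFun h1 j).trans ?_
      by_cases h : j = i₀
      · simp [h, hne]
      · by_cases h' : j = i₁
        · simp [h', hne.symm]
        · simp [h, h']
  obtain ⟨w₁, α, hw₁, hα⟩ := exists_phase γ
  obtain ⟨w₂, β, hw₂, hβ⟩ := exists_phase δ
  refine ⟨α, β, y i₀ * star w₁, OrbitRel.trans (v' := v * (P * P')) (z' := z) ?_ ?_⟩
  · exact ⟨1, one_mem _, star (P * P'), Unitary.star_mem (mul_mem hP hP'), by simp, by simp⟩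
  · rw [hM]
    have := orbitRel_colEmbed hn !![γ, 0; y i₀, δ] z (one_mem _) (diag_mem_unitary hw₁ hw₂)
    simpa [Matrix.star_eq_conjTranspose, conjTranspose_fin_two, hα, hβ] using this

lemma fin_two_congr {a b c d a' b' c' d' : ℍ[ℝ]} (ha : a = a') (hb : b = b') (hc : c = c')
    (hd : d = d') : !![a, b; c, d] = !![a', b'; c', d'] := by
  rw [ha, hb, hc, hd]

lemma quat_congr {a b c d a' b' c' d' : ℝ} (ha : a = a') (hb : b = b') (hc : c = c')
    (hd : d = d') : quat a b c d = quat a' b' c' d' := by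
  rw [ha, hb, hc, hd]

/-- Real `2 × 2` matrices have a singular value decomposition; lower triangular case. -/
lemma exists_rot_mul_rot (α β γ : ℝ) : ∃ C S C' S' a b : ℝ, C ^ 2 + S ^ 2 = 1 ∧
    C' ^ 2 + S' ^ 2 = 1 ∧
    rot C S * !![quat α 0 0 0, quat 0 0 0 0; quat γ 0 0 0, quat β 0 0 0] * star (rot C' S') =
      diagSlice a b := by
  obtain ⟨r, c, s, h, h1, h2⟩ := exists_half_angle ((α + β) / 2) (γ / 2)
  obtain ⟨r', c', s', h', h1', h2'⟩ := exists_half_angle ((α - β) / 2) (γ / 2)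
  have hα : α = r * (c ^ 2 - s ^ 2) + r' * (c' ^ 2 - s' ^ 2) := by linarith
  have hβ : β = r * (c ^ 2 - s ^ 2) - r' * (c' ^ 2 - s' ^ 2) := by linarith
  have hγ : γ = r * (2 * c * s) + r' * (2 * c' * s') := by linarith
  have h0 : r * (2 * c * s) = r' * (2 * c' * s') := by linarith
  refine ⟨c * c' - s * s', s * c' + c * s', c * c' + s * s', c * s' - s * c',
    (c * c' - s * s') * α * (c * c' + s * s') + (s * c' + c * s') * γ * (c * c' + s * s')
      + (s * c' + c * s') * β * (c * s' - s * c'),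
    (s * c' + c * s') * α * (c * s' - s * c') - (c * c' - s * s') * γ * (c * s' - s * c')
      + (c * c' - s * s') * β * (c * c' + s * s'),
    ?_, ?_, ?_⟩
  · linear_combination (c' ^ 2 + s' ^ 2) * h + h'
  · linear_combination (c' ^ 2 + s' ^ 2) * h + h'
  · rw [diagSlice, rot, rot, Matrix.star_eq_conjTranspose]
    simp only [conjTranspose_fin_two, Matrix.mul_fin_two, quat_mul, star_quat, quat_add]
    refine fin_two_congr (quat_congr ?_ ?_ ?_ ?_) (quat_congr ?_ ?_ ?_ ?_)
      (quat_congr ?_ ?_ ?_ ?_) (quat_congr ?_ ?_ ?_ ?_) <;> try ring1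
    · rw [hα, hβ, hγ]
      linear_combination ((c * c' - s * s') * (c * c' + s * s')) * h0
    · rw [hα, hβ, hγ]
      linear_combination (-(s * c' + c * s') * (c * s' - s * c')) * h0

lemma conj_real {u : ℍ[ℝ]} (hu : u * star u = 1) (s : ℝ) :
    u * quat s 0 0 0 * star u = quat s 0 0 0 := by
  change u * (s : ℍ[ℝ]) * star u = (s : ℍ[ℝ])
  rw [← Quaternion.coe_commutes, mul_assoc, hu, mul_one]

lemma exists_orbitRel_diagSlice (hn : 2 ≤ n) (v : Matrix (Fin 2) (Fin n) ℍ[ℝ])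
    (z : Matrix (Fin 2) (Fin 2) ℍ[ℝ]) : ∃ (α β : ℝ) (z' : Matrix (Fin 2) (Fin 2) ℍ[ℝ]),
      OrbitRel v z (diagSlice α β * colEmbed n) z' := by
  obtain ⟨α, β, q, h⟩ := exists_orbitRel_lower_triangular hn v z
  obtain ⟨w, γ, hw, hγ⟩ := exists_phase (star q)
  have hγ' : w * q = quat γ 0 0 0 := by
    have := congrArg star hγ
    simpa [star_quat] using this
  have hd : !![1, 0; 0, w] ∈ unitary (Matrix (Fin 2) (Fin 2) ℍ[ℝ]) :=
    diag_mem_unitary (by simp) hw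
  have hβ := conj_real hw β
  obtain ⟨C, S, C', S', a, b, h1, h2, h3⟩ := exists_rot_mul_rot α β γ
  refine ⟨a, b, _, h.trans ((orbitRel_colEmbed hn _ _ hd hd).trans (z'' := rot C S *
    (!![1, 0; 0, w] * z * star !![1, 0; 0, w]) * star (rot C S)) ?_)⟩
  rw [diag_conj, ← h3]
  have : !![1 * quat α 0 0 0 * star 1, 1 * 0 * star w; w * q * star 1, w * quat β 0 0 0 * star w]
      = (!![quat α 0 0 0, quat 0 0 0 0; quat γ 0 0 0, quat β 0 0 0] :
        Matrix (Fin 2) (Fin 2) ℍ[ℝ]) := by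
    rw [hγ', hβ]
    simp [quat_zero]
  rw [this]
  exact orbitRel_colEmbed hn _ _ (rot_mem_unitary h1) (rot_mem_unitary h2)

/-- Diagonal `v` can be preserved while bringing `z` into normal form. -/
lemma orbitRel_diagSlice_skewSlice (hn : 2 ≤ n) (α β : ℝ) {z : Matrix (Fin 2) (Fin 2) ℍ[ℝ]}
    (hz : z.conjTranspose = -z) : ∃ q x y t : ℝ,
      OrbitRel (diagSlice α β * colEmbed n) z (diagSlice α β * colEmbed n) (skewSlice q x y t) := by
  obtain ⟨u, w, hu, hw, q, x, y, t, h⟩ := exists_conj_skewSlice hz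
  have hd := diag_mem_unitary hu hw
  refine ⟨q, x, y, t, ?_⟩
  have := orbitRel_colEmbed hn (diagSlice α β) z hd hd
  rw [h, diagSlice, diag_conj, conj_real hu α, conj_real hw β] at this
  simpa [diagSlice, quat_zero] using this

/-- Quaternionic Hermitian `2 × 2` matrices can be diagonalised. -/
lemma exists_conj_hermitian (A B : ℝ) (h : ℍ[ℝ]) :
    ∃ k ∈ unitary (Matrix (Fin 2) (Fin 2) ℍ[ℝ]),
      (k * !![quat A 0 0 0, h; star h, quat B 0 0 0] * star k) 0 1 = 0 := by
  obtain ⟨w, s, hw, hs⟩ := exists_phase h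
  obtain ⟨r, C, S, hCS, h1, h2⟩ := exists_half_angle ((A - B) / 2) s
  refine ⟨rot C S * !![1, 0; 0, w], mul_mem (rot_mem_unitary hCS) (diag_mem_unitary (by simp) hw),
    ?_⟩
  have hB := conj_real hw B
  have hs' : w * star h = quat s 0 0 0 := by
    have := congrArg star hs
    simpa [star_quat] using this
  have : rot C S * !![1, 0; 0, w] * !![quat A 0 0 0, h; star h, quat B 0 0 0]
      * star (rot C S * !![1, 0; 0, w]) = rot C S * !![quat A 0 0 0, quat s 0 0 0; quat s 0 0 0,
        quat B 0 0 0] * star (rot C S) := by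
    have hd := diag_conj 1 w (quat A 0 0 0) h (star h) (quat B 0 0 0)
    rw [hB, hs', one_mul, one_mul, hs, star_one, mul_one, mul_one] at hd
    rw [← hd, star_mul]
    simp only [mul_assoc]
  rw [this, rot, Matrix.star_eq_conjTranspose]
  simp only [conjTranspose_fin_two, Matrix.mul_fin_two, quat_mul, star_quat, quat_add,
    Matrix.of_apply, Matrix.cons_val', Matrix.cons_val_zero, Matrix.cons_val_one,
    Matrix.cons_val_fin_one]
  rw [← quat_zero]
  refine quat_congr ?_ ?_ ?_ ?_
  · linear_combination (C ^ 2 - S ^ 2) * h2 - 2 * C * S * h1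
  all_goals ring

lemma conj_conjTranspose {z k : Matrix (Fin 2) (Fin 2) ℍ[ℝ]} (hz : z.conjTranspose = -z) :
    (k * z * star k).conjTranspose = -(k * z * star k) := by
  simp [Matrix.star_eq_conjTranspose, hz, Matrix.mul_assoc]

lemma star_eq_neg_of_re {p : ℍ[ℝ]} (hp : p.re = 0) : star p = -p := by
  rw [eq_quat p, hp, star_quat, quat_neg, neg_zero]

/-- Every skew-Hermitian matrix is conjugate to one with diagonal square. -/
lemma exists_conj_sq_diagonal {z : Matrix (Fin 2) (Fin 2) ℍ[ℝ]} (hz : z.conjTranspose = -z) :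
    ∃ k ∈ unitary (Matrix (Fin 2) (Fin 2) ℍ[ℝ]),
      ((k * z * star k) * (k * z * star k)) 0 1 = 0 := by
  obtain ⟨p, q, r, hp, hr, rfl⟩ := exists_skew_eq hz
  set h := p * q + q * r with hh
  have hsq : !![p, q; -star q, r] * !![p, q; -star q, r] =
      !![quat ((p * p - q * star q).re) 0 0 0, h; star h, quat ((r * r - star q * q).re) 0 0 0] := by
    rw [Matrix.mul_fin_two]
    refine fin_two_congr ?_ rfl ?_ ?_
    · rw [eq_quat p, hp]
      ext <;> simp <;> ring
    · simp [hh, star_eq_neg_of_re hp, star_eq_neg_of_re hr]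
    · rw [eq_quat r, hr]
      ext <;> simp <;> ring
  obtain ⟨k, hk, h0⟩ := exists_conj_hermitian ((p * p - q * star q).re)
    ((r * r - star q * q).re) h
  refine ⟨k, hk, ?_⟩
  rw [← h0, ← hsq]
  have hk1 := (Unitary.mem_iff.1 hk).1
  refine congrFun (congrFun ?_ 0) 1
  calc k * !![p, q; -star q, r] * star k * (k * !![p, q; -star q, r] * star k)
      = k * !![p, q; -star q, r] * (star k * k) * !![p, q; -star q, r] * star k := by
        simp only [mul_assoc]
    _ = _ := by rw [hk1, mul_one]; simp only [mul_assoc]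

/-- Every skew-Hermitian matrix is conjugate to a diagonal one. -/
lemma exists_conj_diagonal {z : Matrix (Fin 2) (Fin 2) ℍ[ℝ]} (hz : z.conjTranspose = -z) :
    ∃ k ∈ unitary (Matrix (Fin 2) (Fin 2) ℍ[ℝ]), ∃ p r : ℍ[ℝ], p.re = 0 ∧ r.re = 0 ∧
      k * z * star k = !![p, 0; 0, r] := by
  obtain ⟨k, hk, hk0⟩ := exists_conj_sq_diagonal hz
  obtain ⟨u, w, hu, hw, q, x, y, t, h⟩ := exists_conj_skewSlice (conj_conjTranspose (k := k) hz)
  have hd := diag_mem_unitary hu hw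
  set z₁ := k * z * star k with hz₁
  set d := !![u, 0; 0, w] with hd'
  have hdk : d * k * z * star (d * k) = skewSlice q x y t := by
    rw [← h, hz₁, star_mul]
    simp only [mul_assoc]
  have h0 : (skewSlice q x y t * skewSlice q x y t) 0 1 = 0 := by
    have h1 : skewSlice q x y t * skewSlice q x y t = d * (z₁ * z₁) * star d := by
      rw [← h]
      calc _ = d * z₁ * (star d * d) * z₁ * star d := by simp only [mul_assoc]
        _ = _ := by rw [(Unitary.mem_iff.1 hd).1, mul_one]; simp only [mul_assoc]
    have h2 : d * (z₁ * z₁) * star d = !![u, 0; 0, w] *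
        !![(z₁ * z₁) 0 0, (z₁ * z₁) 0 1; (z₁ * z₁) 1 0, (z₁ * z₁) 1 1] * star !![u, 0; 0, w] := by
      rw [← Matrix.eta_fin_two]
    rw [h1, h2, diag_conj, hk0]
    simp
  by_cases hq : q = 0
  · exact ⟨d * k, mul_mem hd hk, quat 0 x 0 0, quat 0 y t 0, rfl, rfl, by
      rw [hdk, skewSlice, hq, neg_zero, quat_zero]⟩
  · simp only [skewSlice, Matrix.mul_fin_two, quat_mul, quat_add, Matrix.of_apply, Matrix.cons_val',
      Matrix.cons_val_zero, Matrix.cons_val_one, Matrix.cons_val_fin_one] at h0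
    have h1 := congrArg (fun q : ℍ[ℝ] => q.imI) h0
    have h2 := congrArg (fun q : ℍ[ℝ] => q.imJ) h0
    simp at h1 h2
    have hy : y = -x := by
      apply mul_left_cancel₀ hq
      linarith
    have ht : t = 0 := h2.resolve_left hq
    set s := Real.sqrt (1 / 2) with hs
    have hss : s ^ 2 = 1 / 2 := Real.sq_sqrt (by norm_num)
    have hj : quat 0 0 1 0 * star (quat 0 0 1 0) = 1 := quat_mul_star_self (by norm_num)
    have hR := rot_mem_unitary (C := s) (S := s) (by linarith)
    refine ⟨rot s s * !![1, 0; 0, quat 0 0 1 0] * (d * k),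
      mul_mem (mul_mem hR (diag_mem_unitary (by simp) hj)) (mul_mem hd hk),
      quat 0 x (-q) 0, quat 0 x q 0, rfl, rfl, ?_⟩
    have : rot s s * !![1, 0; 0, quat 0 0 1 0] * (d * k) * z *
        star (rot s s * !![1, 0; 0, quat 0 0 1 0] * (d * k)) =
        rot s s * !![1, 0; 0, quat 0 0 1 0] * skewSlice q x y t *
          star (rot s s * !![1, 0; 0, quat 0 0 1 0]) := by
      rw [← hdk]
      simp only [mul_assoc, star_mul]
    rw [this, hy, ht, rot, skewSlice, Matrix.star_eq_conjTranspose, ← quat_one, ← quat_zero]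
    simp only [conjTranspose_fin_two, Matrix.mul_fin_two, quat_mul, star_quat, quat_add]
    refine fin_two_congr (quat_congr ?_ ?_ ?_ ?_) (quat_congr ?_ ?_ ?_ ?_)
      (quat_congr ?_ ?_ ?_ ?_) (quat_congr ?_ ?_ ?_ ?_) <;> try ring1
    all_goals ring_nf; simp only [hss]; ring

lemma exists_conj_torusSlice {z : Matrix (Fin 2) (Fin 2) ℍ[ℝ]} (hz : z.conjTranspose = -z) :
    ∃ k ∈ unitary (Matrix (Fin 2) (Fin 2) ℍ[ℝ]), ∃ a b : ℝ, k * z * star k = torusSlice a b := by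
  obtain ⟨k, hk, p, r, hp, hr, h⟩ := exists_conj_diagonal hz
  obtain ⟨u, a, hu, ha⟩ := exists_rotate_imI hp
  obtain ⟨w, b, hw, hb⟩ := exists_rotate_imI hr
  refine ⟨!![u, 0; 0, w] * k, mul_mem (diag_mem_unitary hu hw) hk, a, b, ?_⟩
  have := diag_conj u w p 0 0 r
  rw [← h, ha, hb] at this
  rw [star_mul, torusSlice]
  simp only [quat_zero]
  simpa [mul_assoc] using this

/-- Every pair is equivalent to one in which `z` is diagonal. -/
lemma exists_orbitRel_torusSlice (v : Matrix (Fin 2) (Fin n) ℍ[ℝ])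
    {z : Matrix (Fin 2) (Fin 2) ℍ[ℝ]} (hz : z.conjTranspose = -z) :
    ∃ (v' : Matrix (Fin 2) (Fin n) ℍ[ℝ]) (a b : ℝ), OrbitRel v z v' (torusSlice a b) := by
  obtain ⟨k, hk, a, b, h⟩ := exists_conj_torusSlice hz
  exact ⟨k * v * star 1, a, b, k, hk, 1, one_mem _, rfl, h.symm⟩

/-- Normal form of `v` when `z` is diagonal. -/
lemma orbitRel_torusSlice_triSlice (hn : 2 ≤ n) (v : Matrix (Fin 2) (Fin n) ℍ[ℝ]) (a b : ℝ) :
    ∃ α β c d : ℝ,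
      OrbitRel v (torusSlice a b) (triSlice α β c d * colEmbed n) (torusSlice a b) := by
  obtain ⟨α, β, q, h⟩ := exists_orbitRel_lower_triangular hn v (torusSlice a b)
  obtain ⟨r, c, s, h1, h2, h3⟩ := exists_half_angle q.re q.imI
  obtain ⟨r', c', s', h1', h2', h3'⟩ := exists_half_angle q.imJ q.imK
  set u := quat (c * c' + s * s') (s * c' - c * s') 0 0 with hu
  set w := quat (c * c' - s * s') (-(s * c' + c * s')) 0 0 with hw
  have hu1 : u * star u = 1 := quat_mul_star_self (by
    linear_combination (c' ^ 2 + s' ^ 2) * h1 + h1')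
  have hw1 : w * star w = 1 := quat_mul_star_self (by
    linear_combination (c' ^ 2 + s' ^ 2) * h1 + h1')
  have hd := diag_mem_unitary hu1 hw1
  refine ⟨α, β, r, r', h.trans ?_⟩
  have := orbitRel_colEmbed hn !![quat α 0 0 0, 0; q, quat β 0 0 0] (torusSlice a b) hd hd
  have e1 : !![u, 0; 0, w] * !![quat α 0 0 0, 0; q, quat β 0 0 0] * star !![u, 0; 0, w] =
      triSlice α β r r' := by
    rw [diag_conj, triSlice]
    rw [conj_real hu1 α, conj_real hw1 β]
    refine fin_two_congr rfl (by simp [quat_zero]) ?_ rfl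
    rw [eq_quat q, h2, h3, h2', h3', hu, hw]
    simp only [quat_mul, star_quat]
    refine quat_congr ?_ ?_ ?_ ?_
    · linear_combination r * (c ^ 2 + s ^ 2 + 1) * (c' ^ 2 + s' ^ 2) * h1 + r * h1'
    · ring
    · linear_combination r' * (c' ^ 2 + s' ^ 2 + 1) * (c ^ 2 + s ^ 2) * h1' + r' * h1
    · ring
  have e2 : !![u, 0; 0, w] * torusSlice a b * star !![u, 0; 0, w] = torusSlice a b := by
    rw [torusSlice, diag_conj, hu, hw]
    simp only [quat_mul, star_quat]
    refine fin_two_congr (quat_congr ?_ ?_ ?_ ?_) (quat_congr ?_ ?_ ?_ ?_)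
      (quat_congr ?_ ?_ ?_ ?_) (quat_congr ?_ ?_ ?_ ?_) <;> try ring1
    · linear_combination a * (c' ^ 2 + s' ^ 2) * h1 + a * h1'
    · linear_combination b * (c' ^ 2 + s' ^ 2) * h1 + b * h1'
  rwa [e1, e2] at this

end OrbitNormalForms

section EliminationV

variable {n : ℕ}

lemma skewSlice_conjTranspose (q x y t : ℝ) :
    (skewSlice q x y t).conjTranspose = -skewSlice q x y t := by
  ext i j <;> fin_cases i <;> fin_cases j <;> simp [skewSlice, Matrix.conjTranspose_apply]

lemma torusSlice_conjTranspose (a b : ℝ) : (torusSlice a b).conjTranspose = -torusSlice a b := by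
  ext i j <;> fin_cases i <;> fin_cases j <;> simp [torusSlice, Matrix.conjTranspose_apply]

lemma orbitRel_diag (hn : 2 ≤ n) {g₁ g₂ l₁ l₂ : ℍ[ℝ]} (h₁ : g₁ * star g₁ = 1)
    (h₂ : g₂ * star g₂ = 1) (h₃ : l₁ * star l₁ = 1) (h₄ : l₂ * star l₂ = 1)
    {M z M' z' : Matrix (Fin 2) (Fin 2) ℍ[ℝ]}
    (hM : !![g₁, quat 0 0 0 0; quat 0 0 0 0, g₂] * M *
      (!![l₁, quat 0 0 0 0; quat 0 0 0 0, l₂]).conjTranspose = M')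
    (hz : !![g₁, quat 0 0 0 0; quat 0 0 0 0, g₂] * z *
      (!![g₁, quat 0 0 0 0; quat 0 0 0 0, g₂]).conjTranspose = z') :
    OrbitRel (M * colEmbed n) z (M' * colEmbed n) z' := by
  subst hM hz
  exact orbitRel_colEmbed hn M z (diag_mem_unitary h₁ h₂) (diag_mem_unitary h₃ h₄)

/-- Orbit relations between points of the slice with diagonal `v`. -/
lemma orbitRel_diagSlice_sign (hn : 2 ≤ n) (u u' : Fin 6 → ℝ)
    (h : u' = ![-u 0, u 1, u 2, u 3, u 4, u 5] ∨ u' = ![u 0, -u 1, u 2, u 3, u 4, u 5] ∨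
       u' = ![u 0, u 1, -u 2, u 3, u 4, u 5] ∨ u' = ![u 0, u 1, u 2, -u 3, -u 4, u 5] ∨
       u' = ![u 0, u 1, u 2, u 3, u 4, -u 5]) :
    OrbitRel (diagSlice (u 0) (u 1) * colEmbed n) (skewSlice (u 2) (u 3) (u 4) (u 5))
      (diagSlice (u' 0) (u' 1) * colEmbed n) (skewSlice (u' 2) (u' 3) (u' 4) (u' 5)) := by
  have hq : ∀ {a b c d : ℝ}, a ^ 2 + b ^ 2 + c ^ 2 + d ^ 2 = 1 →
      quat a b c d * star (quat a b c d) = 1 := quat_mul_star_self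
  rcases h with rfl | rfl | rfl | rfl | rfl
  · refine orbitRel_diag hn (g₁ := quat 1 0 0 0) (g₂ := quat 1 0 0 0) (l₁ := quat (-1) 0 0 0)
      (l₂ := quat 1 0 0 0) (hq (by simp)) (hq (by simp)) (hq (by simp)) (hq (by simp)) ?_ ?_ <;>
    simp [diagSlice, skewSlice, conjTranspose_fin_two, quat_mul, star_quat, quat_add]
  · refine orbitRel_diag hn (g₁ := quat 1 0 0 0) (g₂ := quat 1 0 0 0) (l₁ := quat 1 0 0 0)
      (l₂ := quat (-1) 0 0 0) (hq (by simp)) (hq (by simp)) (hq (by simp)) (hq (by simp)) ?_ ?_ <;>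
    simp [diagSlice, skewSlice, conjTranspose_fin_two, quat_mul, star_quat, quat_add]
  · refine orbitRel_diag hn (g₁ := quat 1 0 0 0) (g₂ := quat (-1) 0 0 0) (l₁ := quat 1 0 0 0)
      (l₂ := quat (-1) 0 0 0) (hq (by simp)) (hq (by simp)) (hq (by simp)) (hq (by simp)) ?_ ?_ <;>
    simp [diagSlice, skewSlice, conjTranspose_fin_two, quat_mul, star_quat, quat_add]
  · refine orbitRel_diag hn (g₁ := quat 0 0 1 0) (g₂ := quat 0 0 1 0) (l₁ := quat 0 0 1 0)
      (l₂ := quat 0 0 1 0) (hq (by simp)) (hq (by simp)) (hq (by simp)) (hq (by simp)) ?_ ?_ <;>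
    simp [diagSlice, skewSlice, conjTranspose_fin_two, quat_mul, star_quat, quat_add]
  · refine orbitRel_diag hn (g₁ := quat 0 1 0 0) (g₂ := quat 0 1 0 0) (l₁ := quat 0 1 0 0)
      (l₂ := quat 0 1 0 0) (hq (by simp)) (hq (by simp)) (hq (by simp)) (hq (by simp)) ?_ ?_ <;>
    simp [diagSlice, skewSlice, conjTranspose_fin_two, quat_mul, star_quat, quat_add]

lemma orbitRel_diagSlice_swap (hn : 2 ≤ n) (α β : ℝ) (z : Matrix (Fin 2) (Fin 2) ℍ[ℝ]) :
    ∃ z', OrbitRel (diagSlice α β * colEmbed n) z (diagSlice β α * colEmbed n) z' := by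
  have hR := rot_mem_unitary (C := 0) (S := 1) (by norm_num)
  have := orbitRel_colEmbed hn (diagSlice α β) z hR hR
  have h : rot 0 1 * diagSlice α β * star (rot 0 1) = diagSlice β α := by
    simp [rot, diagSlice, Matrix.star_eq_conjTranspose, conjTranspose_fin_two, quat_mul, star_quat,
      quat_add]
  rw [h] at this
  exact ⟨_, this⟩

/-- On the locus where `denomV` does not vanish, invariants are rational functions of the
generators with denominator a power of `denomV`. -/
lemma exists_numerator_denomV (hn : 2 ≤ n)
    {F : Matrix (Fin 2) (Fin n) ℍ[ℝ] → Matrix (Fin 2) (Fin 2) ℍ[ℝ] → ℝ}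
    {p : MvPolynomial (Fin 2 × Fin n × Fin 4 ⊕ Fin 2 × Fin 2 × Fin 4) ℝ}
    (hF : ∀ v z, z.conjTranspose = -z → F v z = MvPolynomial.eval (realCoords v z) p)
    (hinv : ∀ v z v' z', z.conjTranspose = -z → OrbitRel v z v' z' → F v' z' = F v z) :
    ∃ (G : MvPolynomial (Fin 6) ℝ) (N : ℕ), ∀ v z, z.conjTranspose = -z →
      MvPolynomial.eval (invts v z) denomV ^ N * F v z = MvPolynomial.eval (invts v z) G := by
  set f : RegDiag → ℝ := fun u =>
    F (diagSlice (u.1 0) (u.1 1) * colEmbed n) (skewSlice (u.1 2) (u.1 3) (u.1 4) (u.1 5)) with hf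
  have hfmem := mem_adjoin_of_sign_invariant_diag f ?_ ?_
  rotate_left
  · intro A hA
    have : f = fun u : RegDiag => MvPolynomial.eval (realCoords
        (diagSlice (u.1 0) (u.1 1) * colEmbed n)
        (skewSlice (u.1 2) (u.1 3) (u.1 4) (u.1 5))) p := by
      funext u
      exact hF _ _ (skewSlice_conjTranspose _ _ _ _)
    rw [this]
    refine eval_mem_subalgebra A p _ (realCoords_mem A (fun u : RegDiag => diagSlice (u.1 0) (u.1 1))
      (fun u : RegDiag => skewSlice (u.1 2) (u.1 3) (u.1 4) (u.1 5)) ?_)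
    rintro (⟨i, j, k⟩ | ⟨i, j, k⟩) <;> fin_cases i <;> fin_cases j <;> fin_cases k <;>
      first
      | exact A.zero_mem
      | exact hA _
      | exact A.neg_mem (hA _)
  · intro u u' h
    exact hinv _ _ _ _ (skewSlice_conjTranspose _ _ _ _) (orbitRel_diagSlice_sign hn u.1 u'.1 h)
  let X := {x : ℝ × ℝ × Matrix (Fin 2) (Fin 2) ℍ[ℝ] // x.2.2.conjTranspose = -x.2.2 ∧
    MvPolynomial.eval (invts (diagSlice x.1 x.2.1 * colEmbed n) x.2.2) denomV ≠ 0}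
  let Y : X → Fin 6 → ℝ := fun x => invts (diagSlice x.1.1 x.1.2.1 * colEmbed n) x.1.2.2
  let f' : X → ℝ := fun x => F (diagSlice x.1.1 x.1.2.1 * colEmbed n) x.1.2.2
  let δ : X → ℝ := fun x => x.1.1 ^ 2 - x.1.2.1 ^ 2
  have hW : ∀ x : X, MvPolynomial.eval (Y x) denomV ≠ 0 := fun x => x.2.2
  have hmem : f' ∈ Algebra.adjoin ℝ (insert δ (locGens Y denomV)) := by
    have hφ : ∀ x : X, ∃ u : RegDiag, u.1 0 = x.1.1 ∧ u.1 1 = x.1.2.1 ∧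
        diagInvts u.1 = Y x ∧ f u = f' x := by
      rintro ⟨⟨α, β, z⟩, hz, hne⟩
      obtain ⟨q, x, y, t, h⟩ := orbitRel_diagSlice_skewSlice hn α β hz
      have hI : diagInvts ![α, β, q, x, y, t] = invts (diagSlice α β * colEmbed n) z := by
        rw [← h.invts_eq, invts_colEmbed hn, invts_diagSlice_skewSlice]
        rfl
      exact ⟨⟨![α, β, q, x, y, t], by rw [hI]; exact hne⟩, rfl, rfl, hI, hinv _ _ _ _ hz h⟩
    choose φ h0 h1 h2 h3 using hφ
    have : f' = fun x => f (φ x) := funext fun x => (h3 x).symm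
    rw [this]
    refine comp_mem_of_mem_adjoin φ ?_ hfmem
    rintro s (rfl | rfl | ⟨i, rfl⟩)
    · simp only [h0, h1]
      exact Algebra.subset_adjoin (Or.inl rfl)
    · simp only [h2]
      exact Algebra.subset_adjoin (Or.inr (Or.inl rfl))
    · simp only [h2]
      exact Algebra.subset_adjoin (Or.inr (Or.inr ⟨i, rfl⟩))
  have hmem' : f' ∈ Algebra.adjoin ℝ (locGens Y denomV) := by
    have hσ : ∀ x : X, ∃ x' : X, δ x' = -δ x ∧ Y x' = Y x ∧ f' x' = f' x := by
      rintro ⟨⟨α, β, z⟩, hz, hne⟩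
      obtain ⟨z', h⟩ := orbitRel_diagSlice_swap hn α β z
      refine ⟨⟨⟨β, α, z'⟩, h.conjTranspose_eq_neg hz, ?_⟩, ?_, h.invts_eq, hinv _ _ _ _ hz h⟩
      · change MvPolynomial.eval (invts (diagSlice β α * colEmbed n) z') denomV ≠ 0
        rw [h.invts_eq]
        exact hne
      · simp [δ]
    choose σ h1 h2 h3 using hσ
    refine mem_adjoin_of_even σ ?_ ?_ h1 hmem h3
    · have : δ * δ = (2 : ℝ) • (fun x => MvPolynomial.eval (Y x) discV) := by
        funext ⟨⟨α, β, z⟩, hz, hne⟩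
        obtain ⟨q, x, y, t, h⟩ := orbitRel_diagSlice_skewSlice hn α β hz
        have hI : diagInvts ![α, β, q, x, y, t] = invts (diagSlice α β * colEmbed n) z := by
          rw [← h.invts_eq, invts_colEmbed hn, invts_diagSlice_skewSlice]
          rfl
        simp only [δ, Y, Pi.mul_apply, Pi.smul_apply, ← hI, eval_discV_diagInvts]
        simp
        ring
      rw [this]
      exact Subalgebra.smul_mem _ (eval_mem_subalgebra _ _ _ (locGens_coord_mem Y denomV)) _
    · rintro s (rfl | ⟨i, rfl⟩) x
      · simp only [h2]
      · simp only [h2]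
  obtain ⟨G, N, hG⟩ := exists_numerator hW hmem'
  refine ⟨denomV * G, N + 1, fun v z hz => ?_⟩
  obtain ⟨α, β, z', h⟩ := exists_orbitRel_diagSlice hn v z
  rw [← h.invts_eq, ← hinv _ _ _ _ hz h, map_mul]
  by_cases h0 : MvPolynomial.eval (invts (diagSlice α β * colEmbed n) z') denomV = 0
  · rw [h0]
    ring
  · rw [pow_succ', mul_assoc]
    exact congrArg _ (hG ⟨⟨α, β, z'⟩, h.conjTranspose_eq_neg hz, h0⟩)

end EliminationV

section DiagonalZ

/-- The invariants on the slice with diagonal `z`, with parameters `(a, b, α, β, c, d)`. -/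
def triInvts (u : Fin 6 → ℝ) : Fin 6 → ℝ :=
  ![-(u 0 ^ 2 + u 1 ^ 2), u 0 ^ 4 + u 1 ^ 4,
    u 2 ^ 2 + (u 4 ^ 2 + u 5 ^ 2 + u 3 ^ 2),
    u 0 ^ 2 * u 2 ^ 2 + u 1 ^ 2 * (u 4 ^ 2 + u 5 ^ 2 + u 3 ^ 2),
    2 * u 2 ^ 2 * ((u 0 - u 1) ^ 2 * u 4 ^ 2 + (u 0 + u 1) ^ 2 * u 5 ^ 2),
    u 2 ^ 4 + (u 4 ^ 2 + u 5 ^ 2 + u 3 ^ 2) ^ 2 + 2 * u 2 ^ 2 * (u 4 ^ 2 + u 5 ^ 2)]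

lemma eval_discZ_triInvts (u : Fin 6 → ℝ) :
    MvPolynomial.eval (triInvts u) discZ = (u 0 ^ 2 - u 1 ^ 2) ^ 2 := by
  simp [discZ, triInvts]; ring

lemma eval_detZ_triInvts (u : Fin 6 → ℝ) :
    MvPolynomial.eval (triInvts u) detZ = 2 * (u 0 * u 1) ^ 2 := by
  simp [detZ, triInvts]; ring

lemma eval_diagVZ_triInvts (u : Fin 6 → ℝ) :
    MvPolynomial.eval (triInvts u) diagVZ =
      (u 0 ^ 2 - u 1 ^ 2) ^ 2 * (u 2 ^ 2 * (u 4 ^ 2 + u 5 ^ 2 + u 3 ^ 2)) := by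
  simp [diagVZ, detZ, triInvts]; ring

/-- The regular points of the slice with diagonal `z`. -/
abbrev RegTri := {u : Fin 6 → ℝ // MvPolynomial.eval (triInvts u) denomZ ≠ 0}

lemma RegTri.ne_zero (u : RegTri) : u.1 0 ^ 2 - u.1 1 ^ 2 ≠ 0 ∧ u.1 0 ≠ 0 ∧ u.1 1 ≠ 0 ∧
    u.1 2 ≠ 0 ∧ u.1 4 ^ 2 + u.1 5 ^ 2 + u.1 3 ^ 2 ≠ 0 := by
  have h := u.2
  simp only [denomZ, map_mul, eval_discZ_triInvts, eval_detZ_triInvts, eval_diagVZ_triInvts] at h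
  refine ⟨?_, ?_, ?_, ?_, ?_⟩ <;> intro h0 <;> apply h <;> simp [h0]

/-- On the regular part of the slice with diagonal `z`, a function of the parameters which is
invariant under the evident sign changes is a rational function of the invariants and of the
eigenvalues of `z`. -/
lemma mem_adjoin_of_sign_invariant_tri (f : RegTri → ℝ)
    (hf : ∀ A : Subalgebra ℝ (RegTri → ℝ), (∀ i, (fun u : RegTri => u.1 i) ∈ A) → f ∈ A)
    (hσ : ∀ (u u' : RegTri),
      (u'.1 = ![u.1 0, u.1 1, -u.1 2, u.1 3, -u.1 4, -u.1 5] ∨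
       u'.1 = ![u.1 0, u.1 1, u.1 2, u.1 3, -u.1 4, u.1 5] ∨
       u'.1 = ![u.1 0, u.1 1, u.1 2, u.1 3, u.1 4, -u.1 5] ∨
       u'.1 = ![u.1 0, u.1 1, u.1 2, -u.1 3, u.1 4, u.1 5]) → f u' = f u) :
    f ∈ Algebra.adjoin ℝ (insert (fun u : RegTri => u.1 0) (insert (fun u : RegTri => u.1 1)
      (locGens (fun u : RegTri => triInvts u.1) denomZ))) := by
  set S := insert (fun u : RegTri => u.1 0) (insert (fun u : RegTri => u.1 1)
      (locGens (fun u : RegTri => triInvts u.1) denomZ)) with hS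
  set B := Algebra.adjoin ℝ S with hB
  have hle : Algebra.adjoin ℝ (locGens (fun u : RegTri => triInvts u.1) denomZ) ≤ B :=
    Algebra.adjoin_mono ((Set.subset_insert _ _).trans (Set.subset_insert _ _))
  have hW : ∀ u : RegTri, MvPolynomial.eval (triInvts u.1) denomZ ≠ 0 := fun u => u.2
  have ma : (fun u : RegTri => u.1 0) ∈ B := Algebra.subset_adjoin (Or.inl rfl)
  have mb : (fun u : RegTri => u.1 1) ∈ B := Algebra.subset_adjoin (Or.inr (Or.inl rfl))
  have mY : ∀ i, (fun u : RegTri => triInvts u.1 i) ∈ B := fun i =>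
    hle (locGens_coord_mem (fun u : RegTri => triInvts u.1) denomZ i)
  have mdisc : (fun u : RegTri => (MvPolynomial.eval (triInvts u.1) discZ)⁻¹) ∈ B :=
    hle (locGens_inv_mem_of_dvd hW ⟨_, mul_assoc _ _ _⟩)
  have mdet : (fun u : RegTri => (MvPolynomial.eval (triInvts u.1) detZ)⁻¹) ∈ B :=
    hle (locGens_inv_mem_of_dvd hW ((dvd_mul_left _ _).trans (dvd_mul_right _ _)))
  have mdiag : (fun u : RegTri => (MvPolynomial.eval (triInvts u.1) diagVZ)⁻¹) ∈ B :=
    hle (locGens_inv_mem_of_dvd hW (dvd_mul_left _ _))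
  simp only [eval_discZ_triInvts, eval_detZ_triInvts, eval_diagVZ_triInvts] at mdisc mdet mdiag
  have e2 := mY 2
  have e3 := mY 3
  have e4 := mY 4
  have e5 := mY 5
  simp only [triInvts, Matrix.cons_val] at e2 e3 e4 e5
  have me : (fun u : RegTri => u.1 0 ^ 2 - u.1 1 ^ 2) ∈ B :=
    B.sub_mem (B.pow_mem ma 2) (B.pow_mem mb 2)
  have mh : (fun u : RegTri => u.1 2 ^ 2) ∈ B := by
    convert B.mul_mem (B.mul_mem me mdisc) (B.sub_mem e3 (B.mul_mem (B.pow_mem mb 2) e2)) using 1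
    funext u
    obtain ⟨h1, h2, h3, h4, h5⟩ := u.ne_zero
    simp; field_simp; ring
  have mk : (fun u : RegTri => u.1 4 ^ 2 + u.1 5 ^ 2 + u.1 3 ^ 2) ∈ B := by
    convert B.sub_mem e2 mh using 1
    funext u
    simp
  have mhi : (fun u : RegTri => (u.1 2 ^ 2)⁻¹) ∈ B := by
    convert B.mul_mem (B.mul_mem mk (B.pow_mem me 2)) mdiag using 1
    funext u
    obtain ⟨h1, h2, h3, h4, h5⟩ := u.ne_zero
    simp; field_simp
  have mU : (fun u : RegTri => u.1 2 ^ 2 * (u.1 4 ^ 2 + u.1 5 ^ 2)) ∈ B := by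
    convert B.smul_mem (B.sub_mem (B.sub_mem e5 (B.pow_mem mh 2)) (B.pow_mem mk 2)) (1 / 2 : ℝ)
      using 1
    funext u
    simp; ring
  have mD : (fun u : RegTri => u.1 2 ^ 2 * (u.1 4 ^ 2 - u.1 5 ^ 2)) ∈ B := by
    convert B.mul_mem (B.mul_mem (B.mul_mem ma mb) mdet) (B.sub_mem
      (B.mul_mem (B.add_mem (B.pow_mem ma 2) (B.pow_mem mb 2)) mU) (B.smul_mem e4 (1 / 2 : ℝ)))
      using 1
    funext u
    obtain ⟨h1, h2, h3, h4, h5⟩ := u.ne_zero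
    simp; field_simp; ring
  have mc : (fun u : RegTri => u.1 4 ^ 2) ∈ B := by
    convert B.smul_mem (B.mul_mem mhi (B.add_mem mU mD)) (1 / 2 : ℝ) using 1
    funext u
    obtain ⟨h1, h2, h3, h4, h5⟩ := u.ne_zero
    simp; field_simp; ring
  have md : (fun u : RegTri => u.1 5 ^ 2) ∈ B := by
    convert B.smul_mem (B.mul_mem mhi (B.sub_mem mU mD)) (1 / 2 : ℝ) using 1
    funext u
    obtain ⟨h1, h2, h3, h4, h5⟩ := u.ne_zero
    simp; field_simp; ring
  have mβ : (fun u : RegTri => u.1 3 ^ 2) ∈ B := by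
    convert B.sub_mem (B.sub_mem mk mc) md using 1
    funext u
    simp only [Pi.sub_apply]; ring
  set t : Fin 4 → RegTri → ℝ := ![fun u => u.1 2, fun u => u.1 4, fun u => u.1 5,
    fun u => u.1 3] with ht
  set ε : Fin 4 → Fin 6 → ℝ := ![![1, 1, -1, 1, -1, -1], ![1, 1, 1, 1, -1, 1],
    ![1, 1, 1, 1, 1, -1], ![1, 1, 1, -1, 1, 1]] with hε
  have hY : ∀ i (u : Fin 6 → ℝ), triInvts (fun j => ε i j * u j) = triInvts u := by
    intro i u
    fin_cases i <;> simp [triInvts, hε, Even.neg_pow, show Even 4 from ⟨2, rfl⟩]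
  refine mem_adjoin_of_even_family t
    (fun i u => ⟨fun j => ε i j * u.1 j, (hY i u.1).symm ▸ u.2⟩) ?_ ?_ ?_ ?_ ?_ ?_
  · intro i
    rw [← sq]
    fin_cases i
    exacts [mh, mc, md, mβ]
  · rintro i s (rfl | rfl | rfl | ⟨j, rfl⟩) u
    · fin_cases i <;> simp [hε]
    · fin_cases i <;> simp [hε]
    · simp only [hY]
    · simp only [hY]
  · intro i u
    fin_cases i <;> simp [ht, hε]
  · intro i j hij u
    fin_cases i <;> fin_cases j <;> simp [ht, hε] at hij ⊢
  · have hle' : B ≤ Algebra.adjoin ℝ (S ∪ Set.range t) :=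
      Algebra.adjoin_mono Set.subset_union_left
    have mt : ∀ i, t i ∈ Algebra.adjoin ℝ (S ∪ Set.range t) := fun i =>
      Algebra.subset_adjoin (Or.inr ⟨i, rfl⟩)
    refine hf _ fun i => ?_
    fin_cases i
    exacts [hle' ma, hle' mb, mt 0, mt 3, mt 1, mt 2]
  · intro i u
    refine hσ _ _ ?_
    fin_cases i
    · refine Or.inl (funext fun j => ?_)
      fin_cases j <;> simp [hε]
    · refine Or.inr (Or.inl (funext fun j => ?_))
      fin_cases j <;> simp [hε]
    · refine Or.inr (Or.inr (Or.inl (funext fun j => ?_)))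
      fin_cases j <;> simp [hε]
    · refine Or.inr (Or.inr (Or.inr (funext fun j => ?_)))
      fin_cases j <;> simp [hε]

end DiagonalZ

section EliminationZ

variable {n : ℕ}

/-- Orbit relations between points of the slice with diagonal `z`. -/
lemma orbitRel_triSlice_sign (hn : 2 ≤ n) (u u' : Fin 6 → ℝ)
    (h : u' = ![u 0, u 1, -u 2, u 3, -u 4, -u 5] ∨ u' = ![u 0, u 1, u 2, u 3, -u 4, u 5] ∨
       u' = ![u 0, u 1, u 2, u 3, u 4, -u 5] ∨ u' = ![u 0, u 1, u 2, -u 3, u 4, u 5]) :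
    OrbitRel (triSlice (u 2) (u 3) (u 4) (u 5) * colEmbed n) (torusSlice (u 0) (u 1))
      (triSlice (u' 2) (u' 3) (u' 4) (u' 5) * colEmbed n) (torusSlice (u' 0) (u' 1)) := by
  have hq : ∀ {a b c d : ℝ}, a ^ 2 + b ^ 2 + c ^ 2 + d ^ 2 = 1 →
      quat a b c d * star (quat a b c d) = 1 := quat_mul_star_self
  rcases h with rfl | rfl | rfl | rfl
  · refine orbitRel_diag hn (g₁ := quat 1 0 0 0) (g₂ := quat 1 0 0 0) (l₁ := quat (-1) 0 0 0)
      (l₂ := quat 1 0 0 0) (hq (by simp)) (hq (by simp)) (hq (by simp)) (hq (by simp)) ?_ ?_ <;>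
    simp [triSlice, torusSlice, conjTranspose_fin_two, quat_mul, star_quat, quat_add]
  · refine orbitRel_diag hn (g₁ := quat 0 (-1) 0 0) (g₂ := quat 0 1 0 0) (l₁ := quat 0 (-1) 0 0)
      (l₂ := quat 0 1 0 0) (hq (by simp)) (hq (by simp)) (hq (by simp)) (hq (by simp)) ?_ ?_ <;>
    simp [triSlice, torusSlice, conjTranspose_fin_two, quat_mul, star_quat, quat_add]
  · refine orbitRel_diag hn (g₁ := quat 0 1 0 0) (g₂ := quat 0 1 0 0) (l₁ := quat 0 1 0 0)
      (l₂ := quat 0 1 0 0) (hq (by simp)) (hq (by simp)) (hq (by simp)) (hq (by simp)) ?_ ?_ <;>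
    simp [triSlice, torusSlice, conjTranspose_fin_two, quat_mul, star_quat, quat_add]
  · refine orbitRel_diag hn (g₁ := quat 1 0 0 0) (g₂ := quat 1 0 0 0) (l₁ := quat 1 0 0 0)
      (l₂ := quat (-1) 0 0 0) (hq (by simp)) (hq (by simp)) (hq (by simp)) (hq (by simp)) ?_ ?_ <;>
    simp [triSlice, torusSlice, conjTranspose_fin_two, quat_mul, star_quat, quat_add]

/-- The action of the Weyl group of type `C₂`. -/
lemma orbitRel_torusSlice_weyl (v : Matrix (Fin 2) (Fin n) ℍ[ℝ]) (a b : ℝ) :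
    (∃ v', OrbitRel v (torusSlice a b) v' (torusSlice (-a) b)) ∧
    (∃ v', OrbitRel v (torusSlice a b) v' (torusSlice a (-b))) ∧
    (∃ v', OrbitRel v (torusSlice a b) v' (torusSlice b a)) := by
  have hq : ∀ {a b c d : ℝ}, a ^ 2 + b ^ 2 + c ^ 2 + d ^ 2 = 1 →
      quat a b c d * star (quat a b c d) = 1 := quat_mul_star_self
  refine ⟨⟨_, _, diag_mem_unitary (u := quat 0 0 1 0) (w := quat 1 0 0 0) (hq (by simp))
      (hq (by simp)), 1, one_mem _, rfl, ?_⟩,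
    ⟨_, _, diag_mem_unitary (u := quat 1 0 0 0) (w := quat 0 0 1 0) (hq (by simp))
      (hq (by simp)), 1, one_mem _, rfl, ?_⟩,
    ⟨_, _, rot_mem_unitary (C := 0) (S := 1) (by norm_num), 1, one_mem _, rfl, ?_⟩⟩ <;>
  simp [rot, torusSlice, ← quat_zero, Matrix.star_eq_conjTranspose, conjTranspose_fin_two, quat_mul,
    star_quat, quat_add]

lemma invts_zero_torusSlice (v : Matrix (Fin 2) (Fin n) ℍ[ℝ]) (a b : ℝ) :
    invts v (torusSlice a b) 0 = -(a ^ 2 + b ^ 2) := by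
  simp [invts, torusSlice, sq_mul_self, Matrix.trace_fin_two_of, quat_mul, quat_add]
  ring

lemma invts_one_torusSlice (v : Matrix (Fin 2) (Fin n) ℍ[ℝ]) (a b : ℝ) :
    invts v (torusSlice a b) 1 = a ^ 4 + b ^ 4 := by
  simp [invts, torusSlice, pow_four_mul_self, Matrix.trace_fin_two_of, quat_mul, quat_add]
  ring

/-- On the locus where `denomZ` does not vanish, invariants are rational functions of the
generators with denominator a power of `denomZ`. -/
lemma exists_numerator_denomZ (hn : 2 ≤ n)
    {F : Matrix (Fin 2) (Fin n) ℍ[ℝ] → Matrix (Fin 2) (Fin 2) ℍ[ℝ] → ℝ}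
    {p : MvPolynomial (Fin 2 × Fin n × Fin 4 ⊕ Fin 2 × Fin 2 × Fin 4) ℝ}
    (hF : ∀ v z, z.conjTranspose = -z → F v z = MvPolynomial.eval (realCoords v z) p)
    (hinv : ∀ v z v' z', z.conjTranspose = -z → OrbitRel v z v' z' → F v' z' = F v z) :
    ∃ (G : MvPolynomial (Fin 6) ℝ) (N : ℕ), ∀ v z, z.conjTranspose = -z →
      MvPolynomial.eval (invts v z) denomZ ^ N * F v z = MvPolynomial.eval (invts v z) G := by
  set f : RegTri → ℝ := fun u =>
    F (triSlice (u.1 2) (u.1 3) (u.1 4) (u.1 5) * colEmbed n) (torusSlice (u.1 0) (u.1 1)) with hf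
  have hfmem := mem_adjoin_of_sign_invariant_tri f ?_ ?_
  rotate_left
  · intro A hA
    have : f = fun u : RegTri => MvPolynomial.eval (realCoords
        (triSlice (u.1 2) (u.1 3) (u.1 4) (u.1 5) * colEmbed n)
        (torusSlice (u.1 0) (u.1 1))) p := by
      funext u
      exact hF _ _ (torusSlice_conjTranspose _ _)
    rw [this]
    refine eval_mem_subalgebra A p _ (realCoords_mem A
      (fun u : RegTri => triSlice (u.1 2) (u.1 3) (u.1 4) (u.1 5))
      (fun u : RegTri => torusSlice (u.1 0) (u.1 1)) ?_)
    rintro (⟨i, j, k⟩ | ⟨i, j, k⟩) <;> fin_cases i <;> fin_cases j <;> fin_cases k <;>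
      first
      | exact A.zero_mem
      | exact hA _
  · intro u u' h
    exact hinv _ _ _ _ (torusSlice_conjTranspose _ _) (orbitRel_triSlice_sign hn u.1 u'.1 h)
  let X := {x : Matrix (Fin 2) (Fin n) ℍ[ℝ] × ℝ × ℝ //
    MvPolynomial.eval (invts x.1 (torusSlice x.2.1 x.2.2)) denomZ ≠ 0}
  let Y : X → Fin 6 → ℝ := fun x => invts x.1.1 (torusSlice x.1.2.1 x.1.2.2)
  let f' : X → ℝ := fun x => F x.1.1 (torusSlice x.1.2.1 x.1.2.2)
  let a : X → ℝ := fun x => x.1.2.1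
  let b : X → ℝ := fun x => x.1.2.2
  let e : X → ℝ := fun x => x.1.2.1 ^ 2 - x.1.2.2 ^ 2
  have hW : ∀ x : X, MvPolynomial.eval (Y x) denomZ ≠ 0 := fun x => x.2
  have mY : ∀ i, (fun x => Y x i) ∈ Algebra.adjoin ℝ (insert e (locGens Y denomZ)) := fun i =>
    Algebra.adjoin_mono (Set.subset_insert _ _) (locGens_coord_mem Y denomZ i)
  have me : e ∈ Algebra.adjoin ℝ (insert e (locGens Y denomZ)) :=
    Algebra.subset_adjoin (Or.inl rfl)
  have hab : f' ∈ Algebra.adjoin ℝ (insert a (insert b (locGens Y denomZ))) := by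
    have hφ : ∀ x : X, ∃ u : RegTri, u.1 0 = a x ∧ u.1 1 = b x ∧
        triInvts u.1 = Y x ∧ f u = f' x := by
      rintro ⟨⟨v, a, b⟩, hne⟩
      obtain ⟨α, β, c, d, h⟩ := orbitRel_torusSlice_triSlice hn v a b
      have hI : triInvts ![a, b, α, β, c, d] = invts v (torusSlice a b) := by
        rw [← h.invts_eq, invts_colEmbed hn, invts_triSlice_torusSlice]
        rfl
      exact ⟨⟨![a, b, α, β, c, d], by rw [hI]; exact hne⟩, rfl, rfl, hI,
        hinv _ _ _ _ (torusSlice_conjTranspose _ _) h⟩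
    choose φ h0 h1 h2 h3 using hφ
    have : f' = fun x => f (φ x) := funext fun x => (h3 x).symm
    rw [this]
    refine comp_mem_of_mem_adjoin φ ?_ hfmem
    rintro s (rfl | rfl | rfl | ⟨i, rfl⟩)
    · simp only [h0]
      exact Algebra.subset_adjoin (Or.inl rfl)
    · simp only [h1]
      exact Algebra.subset_adjoin (Or.inr (Or.inl rfl))
    · simp only [h2]
      exact Algebra.subset_adjoin (Or.inr (Or.inr (Or.inl rfl)))
    · simp only [h2]
      exact Algebra.subset_adjoin (Or.inr (Or.inr (Or.inr ⟨i, rfl⟩)))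
  have hlift : ∀ {v v' : Matrix (Fin 2) (Fin n) ℍ[ℝ]} {a b a' b' : ℝ},
      OrbitRel v (torusSlice a b) v' (torusSlice a' b') →
      ∀ hx : MvPolynomial.eval (invts v (torusSlice a b)) denomZ ≠ 0,
      ∃ hx', Y ⟨(v', a', b'), hx'⟩ = Y ⟨(v, a, b), hx⟩ ∧
        f' ⟨(v', a', b'), hx'⟩ = f' ⟨(v, a, b), hx⟩ := by
    intro v v' a b a' b' h hx
    exact ⟨by change MvPolynomial.eval (invts v' (torusSlice a' b')) denomZ ≠ 0
              rw [h.invts_eq]; exact hx, h.invts_eq,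
      hinv _ _ _ _ (torusSlice_conjTranspose _ _) h⟩
  have hb : f' ∈ Algebra.adjoin ℝ (insert b (insert e (locGens Y denomZ))) := by
    have hσ : ∀ x : X, ∃ x' : X, a x' = -a x ∧ b x' = b x ∧ Y x' = Y x ∧ f' x' = f' x := by
      rintro ⟨⟨v, a, b⟩, hx⟩
      obtain ⟨v', h⟩ := (orbitRel_torusSlice_weyl v a b).1
      obtain ⟨hx', h1, h2⟩ := hlift h hx
      exact ⟨⟨(v', -a, b), hx'⟩, rfl, rfl, h1, h2⟩
    choose σ h1 h2 h3 h4 using hσ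
    refine mem_adjoin_of_even σ ?_ ?_ h1
      (Algebra.adjoin_mono (Set.insert_subset_insert (Set.insert_subset_insert
        (Set.subset_insert _ _))) hab) h4
    · refine Algebra.adjoin_mono (Set.subset_insert _ _) ?_
      convert Subalgebra.smul_mem _ (sub_mem me (mY 0)) (1 / 2 : ℝ) using 1
      funext x
      simp only [Y, invts_zero_torusSlice]
      simp [a, e]
      ring
    · have h1' : ∀ x : X, (σ x).1.2.1 = -x.1.2.1 := h1
      have h2' : ∀ x : X, (σ x).1.2.2 = x.1.2.2 := h2
      rintro s (rfl | rfl | rfl | ⟨i, rfl⟩) x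
      · exact h2 x
      · simp only [e, h1', h2', neg_sq]
      · simp only [h3]
      · simp only [h3]
  have he : f' ∈ Algebra.adjoin ℝ (insert e (locGens Y denomZ)) := by
    have hσ : ∀ x : X, ∃ x' : X, a x' = a x ∧ b x' = -b x ∧ Y x' = Y x ∧ f' x' = f' x := by
      rintro ⟨⟨v, a, b⟩, hx⟩
      obtain ⟨v', h⟩ := (orbitRel_torusSlice_weyl v a b).2.1
      obtain ⟨hx', h1, h2⟩ := hlift h hx
      exact ⟨⟨(v', a, -b), hx'⟩, rfl, rfl, h1, h2⟩
    choose σ h1 h2 h3 h4 using hσ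
    refine mem_adjoin_of_even σ ?_ ?_ h2 hb h4
    · convert Subalgebra.smul_mem _ (add_mem me (mY 0)) (-1 / 2 : ℝ) using 1
      funext x
      simp only [Y, invts_zero_torusSlice]
      simp [b, e]
      ring
    · have h1' : ∀ x : X, (σ x).1.2.1 = x.1.2.1 := h1
      have h2' : ∀ x : X, (σ x).1.2.2 = -x.1.2.2 := h2
      rintro s (rfl | rfl | ⟨i, rfl⟩) x
      · simp only [e, h1', h2', neg_sq]
      · simp only [h3]
      · simp only [h3]
  have hmem : f' ∈ Algebra.adjoin ℝ (locGens Y denomZ) := by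
    have hσ : ∀ x : X, ∃ x' : X, a x' = b x ∧ b x' = a x ∧ Y x' = Y x ∧ f' x' = f' x := by
      rintro ⟨⟨v, a, b⟩, hx⟩
      obtain ⟨v', h⟩ := (orbitRel_torusSlice_weyl v a b).2.2
      obtain ⟨hx', h1, h2⟩ := hlift h hx
      exact ⟨⟨(v', b, a), hx'⟩, rfl, rfl, h1, h2⟩
    choose σ h1 h2 h3 h4 using hσ
    have h1' : ∀ x : X, (σ x).1.2.1 = x.1.2.2 := h1
    have h2' : ∀ x : X, (σ x).1.2.2 = x.1.2.1 := h2
    refine mem_adjoin_of_even σ ?_ ?_ (fun x => ?_) he h4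
    · have : e * e = fun x => MvPolynomial.eval (Y x) discZ := by
        funext x
        simp only [discZ, map_sub, map_mul, map_pow, MvPolynomial.eval_X, map_ofNat, Y,
          invts_zero_torusSlice, invts_one_torusSlice]
        simp [e]
        ring
      rw [this]
      exact eval_mem_subalgebra _ _ _ (locGens_coord_mem Y denomZ)
    · rintro s (rfl | ⟨i, rfl⟩) x
      · simp only [h3]
      · simp only [h3]
    · simp only [e, h1', h2', neg_sub]
  obtain ⟨G, N, hG⟩ := exists_numerator hW hmem
  refine ⟨denomZ * G, N + 1, fun v z hz => ?_⟩
  obtain ⟨v', a, b, h⟩ := exists_orbitRel_torusSlice v hz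
  rw [← h.invts_eq, ← hinv _ _ _ _ hz h, map_mul]
  by_cases h0 : MvPolynomial.eval (invts v' (torusSlice a b)) denomZ = 0
  · rw [h0]
    ring
  · rw [pow_succ', mul_assoc]
    exact congrArg _ (hG ⟨(v', a, b), h0⟩)

end EliminationZ

section Coprimality

open MvPolynomial

/-- Polynomials in six variables regarded as univariate polynomials in the variable `X i`. -/
noncomputable def isolateVar (i : Fin 6) :
    MvPolynomial (Fin 6) ℝ ≃ₐ[ℝ] Polynomial (MvPolynomial (Fin 5) ℝ) :=
  (renameEquiv ℝ (Equiv.swap 0 i)).trans (finSuccEquiv ℝ 5)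

lemma isolateVar_X_self (i : Fin 6) : isolateVar i (X i) = Polynomial.X := by
  simp [isolateVar, finSuccEquiv_X_zero]

lemma isolateVar_X_of_swap {i j : Fin 6} {k : Fin 5} (h : Equiv.swap 0 i j = k.succ) :
    isolateVar i (X j) = Polynomial.C (X k) := by
  simp [isolateVar, h, finSuccEquiv_X_succ]

lemma isolateVar_C (i : Fin 6) (r : ℝ) : isolateVar i (C r) = Polynomial.C (C r) :=
  (isolateVar i).commutes r

lemma eval_triInvts_denomZ_ne_zero : eval (triInvts ![2, 1, 1, 1, 0, 0]) denomZ ≠ 0 := by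
  simp only [denomZ, map_mul, eval_discZ_triInvts, eval_detZ_triInvts, eval_diagVZ_triInvts,
    Matrix.cons_val]
  norm_num

lemma denomZ_ne_zero : denomZ ≠ 0 := fun h =>
  eval_triInvts_denomZ_ne_zero (by rw [h, map_zero])

lemma isolateVar_denomZ {i : Fin 6} {k : Fin 5} (h0 : Equiv.swap 0 i 0 = k.succ)
    (h1 : Equiv.swap 0 i 1 = 1) (h2 : Equiv.swap 0 i 2 = 2) (h3 : Equiv.swap 0 i 3 = 3) :
    ∃ c, c ≠ 0 ∧ isolateVar i denomZ = Polynomial.C c := by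
  have h : isolateVar i denomZ = Polynomial.C ((2 * X 0 - X k ^ 2) * (X k ^ 2 - X 0) *
      (-X 2 ^ 2 - X k * X 1 * X 2 - C (1 / 2) * (X k ^ 2 - X 0) * X 1 ^ 2)) := by
    simp only [denomZ, discZ, detZ, diagVZ, map_mul, map_sub, map_pow, map_neg, map_ofNat,
      isolateVar_C, isolateVar_X_of_swap h0, isolateVar_X_of_swap (k := 0) h1,
      isolateVar_X_of_swap (k := 1) h2, isolateVar_X_of_swap (k := 2) h3]
  refine ⟨_, fun hc => denomZ_ne_zero ?_, h⟩
  rw [hc, map_zero] at h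
  exact (map_eq_zero_iff _ (isolateVar i).injective).1 h

lemma isRelPrime_denomZ_denomV : IsRelPrime denomZ denomV := by
  obtain ⟨c, hc, hcZ⟩ := isolateVar_denomZ (i := 5) (k := 4) (by decide) (by decide) (by decide)
    (by decide)
  obtain ⟨c', hc', hcZ'⟩ := isolateVar_denomZ (i := 4) (k := 3) (by decide) (by decide) (by decide)
    (by decide)
  have h0 : isolateVar 4 (X 0) = Polynomial.C (X 3) := isolateVar_X_of_swap (by decide)
  have h2 : isolateVar 4 (X 2) = Polynomial.C (X 1) := isolateVar_X_of_swap (by decide)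
  have h3 : isolateVar 4 (X 3) = Polynomial.C (X 2) := isolateVar_X_of_swap (by decide)
  have h5 : isolateVar 4 (X 5) = Polynomial.C (X 4) := isolateVar_X_of_swap (by decide)
  have h2' : isolateVar 5 (X 2) = Polynomial.C (X 1) := isolateVar_X_of_swap (by decide)
  refine ((isRelPrime_of_const_of_monic (isolateVar 5).toRingEquiv hcZ hc ?_).mul_right
    (isRelPrime_of_const_of_monic (isolateVar 4).toRingEquiv hcZ' hc' ?_)).mul_right
    (isRelPrime_of_const_of_monic (isolateVar 4).toRingEquiv hcZ' hc' ?_)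
  · change (isolateVar 5 discV).Monic
    have : isolateVar 5 discV = Polynomial.X - Polynomial.C (C (1 / 2) * X 1 ^ 2) := by
      simp only [discV, map_sub, map_mul, map_pow, isolateVar_X_self, isolateVar_C, h2']
    rw [this]
    exact Polynomial.monic_X_sub_C _
  · change (isolateVar 4 (X 4)).Monic
    rw [isolateVar_X_self]
    exact Polynomial.monic_X
  · change (isolateVar 4 discZV).Monic
    set d : MvPolynomial (Fin 5) ℝ := X 4 - C (1 / 2) * X 1 ^ 2 with hd
    have : isolateVar 4 discZV = (Polynomial.X + Polynomial.C (2 * d * X 3)) ^ 2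
        - Polynomial.C (2 * d * (2 * X 2 + X 3 * X 1) ^ 2) := by
      simp only [hd, discZV, discV, map_sub, map_mul, map_pow, map_add, map_ofNat,
        isolateVar_X_self, isolateVar_C, h0, h2, h3, h5]
      ring
    rw [this]
    have hm := (Polynomial.monic_X_add_C (2 * d * X 3)).pow 2
    refine hm.sub_of_left (Polynomial.degree_C_le.trans_lt ?_)
    rw [Polynomial.degree_pow, Polynomial.degree_X_add_C]
    norm_num

end Coprimality

section Density

open Filter Topology

/-- The invariants take all values near a suitable point. -/
lemma exists_eventually_diagInvts_eq :
    ∃ y₀ : Fin 6 → ℝ, ∀ᶠ Y in 𝓝 y₀, ∃ u, diagInvts u = Y := by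
  let y₀ : Fin 6 → ℝ := ![-4, 12, 3, 6, 2, 5]
  let D : (Fin 6 → ℝ) → ℝ := fun Y => 2 * Y 5 - Y 2 ^ 2
  let δ : (Fin 6 → ℝ) → ℝ := fun Y => √(D Y)
  let S : (Fin 6 → ℝ) → ℝ := fun Y => Y 4 / (2 * D Y)
  let m : (Fin 6 → ℝ) → ℝ := fun Y => (2 * Y 3 + Y 0 * Y 2) / δ Y
  let P : (Fin 6 → ℝ) → ℝ := fun Y => (-Y 0 - 2 * S Y + m Y) / 2
  let R : (Fin 6 → ℝ) → ℝ := fun Y => (-Y 0 - 2 * S Y - m Y) / 2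
  let T : (Fin 6 → ℝ) → ℝ := fun Y =>
    (Y 1 - (P Y + S Y) ^ 2 - (R Y + S Y) ^ 2 - 2 * S Y * (P Y + R Y)) / (4 * S Y)
  let E : (Fin 6 → ℝ) → ℝ := fun Y => R Y - T Y ^ 2 / P Y
  have vD : D y₀ = 1 := by simp [D, y₀]; norm_num
  have vδ : δ y₀ = 1 := by simp [δ, vD]
  have vS : S y₀ = 1 := by simp [S, vD, y₀]
  have vm : m y₀ = 0 := by simp [m, vδ, y₀]; norm_num
  have vP : P y₀ = 1 := by simp [P, vS, vm, y₀]; norm_num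
  have vR : R y₀ = 1 := by simp [R, vS, vm, y₀]; norm_num
  have vT : T y₀ = 0 := by simp [T, vS, vP, vR, y₀]; norm_num
  have vE : E y₀ = 1 := by simp [E, vT, vP, vR]
  have c : ∀ i, ContinuousAt (fun Y : Fin 6 → ℝ => Y i) y₀ := fun i => continuousAt_apply i y₀
  have cD : ContinuousAt D y₀ := by fun_prop
  have cδ : ContinuousAt δ y₀ := cD.sqrt
  have cS : ContinuousAt S y₀ :=
    (c 4).div (cD.const_mul 2) (by rw [vD]; norm_num)
  have cm : ContinuousAt m y₀ :=
    ContinuousAt.div (by fun_prop) cδ (by rw [vδ]; norm_num)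
  have cP : ContinuousAt P y₀ := (((c 0).neg.sub (cS.const_mul 2)).add cm).div_const 2
  have cR : ContinuousAt R y₀ := (((c 0).neg.sub (cS.const_mul 2)).sub cm).div_const 2
  have cT : ContinuousAt T y₀ :=
    ((((c 1).sub ((cP.add cS).pow 2)).sub ((cR.add cS).pow 2)).sub
      ((cS.const_mul 2).mul (cP.add cR))).div (cS.const_mul 4) (by rw [vS]; norm_num)
  have cE : ContinuousAt E y₀ :=
    cR.sub ((cT.pow 2).div cP (by rw [vP]; norm_num))
  have c2 : ContinuousAt (fun Y : Fin 6 → ℝ => Y 2 - δ Y) y₀ := (c 2).sub cδ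
  have v2 : y₀ 2 - δ y₀ = 2 := by rw [vδ]; simp [y₀]; norm_num
  refine ⟨y₀, ?_⟩
  filter_upwards [cD.eventually (lt_mem_nhds (by rw [vD]; norm_num : (0 : ℝ) < D y₀)),
    cS.eventually (lt_mem_nhds (by rw [vS]; norm_num : (0 : ℝ) < S y₀)),
    cP.eventually (lt_mem_nhds (by rw [vP]; norm_num : (0 : ℝ) < P y₀)),
    cE.eventually (lt_mem_nhds (by rw [vE]; norm_num : (0 : ℝ) < E y₀)),
    c2.eventually (lt_mem_nhds (by rw [v2]; norm_num : (0 : ℝ) < y₀ 2 - δ y₀))]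
    with Y hD hS hP hE h2
  have hδ : 0 < δ Y := Real.sqrt_pos.2 hD
  have eδ : δ Y ^ 2 = 2 * Y 5 - Y 2 ^ 2 := Real.sq_sqrt hD.le
  have eα : √((Y 2 + δ Y) / 2) ^ 2 = (Y 2 + δ Y) / 2 := Real.sq_sqrt (by linarith)
  have eβ : √((Y 2 - δ Y) / 2) ^ 2 = (Y 2 - δ Y) / 2 := Real.sq_sqrt (by linarith)
  have eq : √(S Y) ^ 2 = S Y := Real.sq_sqrt hS.le
  have ex : √(P Y) ^ 2 = P Y := Real.sq_sqrt hP.le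
  have ew : √(E Y) ^ 2 = E Y := Real.sq_sqrt hE.le
  have hx : √(P Y) ≠ 0 := (Real.sqrt_pos.2 hP).ne'
  have ey : (T Y / √(P Y)) ^ 2 + √(E Y) ^ 2 = R Y := by
    rw [ew, div_pow, ex]
    simp only [E]
    ring
  have exy : √(P Y) * (T Y / √(P Y)) = T Y := by field_simp
  have hSD : S Y * (2 * δ Y ^ 2) = Y 4 := by
    rw [eδ]
    exact div_mul_cancel₀ _ (by positivity)
  have hTS : T Y * (4 * S Y) =
      Y 1 - (P Y + S Y) ^ 2 - (R Y + S Y) ^ 2 - 2 * S Y * (P Y + R Y) :=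
    div_mul_cancel₀ _ (by positivity)
  have hmδ : m Y * δ Y = 2 * Y 3 + Y 0 * Y 2 := div_mul_cancel₀ _ hδ.ne'
  have hPR : P Y + R Y = -Y 0 - 2 * S Y := by simp only [P, R]; ring
  have hPR' : P Y - R Y = m Y := by simp only [P, R]; ring
  refine ⟨![√((Y 2 + δ Y) / 2), √((Y 2 - δ Y) / 2), √(S Y), √(P Y), T Y / √(P Y), √(E Y)], ?_⟩
  have p4 : ∀ r : ℝ, r ^ 4 = (r ^ 2) ^ 2 := fun r => by ring
  funext i
  fin_cases i <;> simp only [diagInvts, Matrix.cons_val, p4, ey, ex, exy, eq, eα, eβ]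
  · change -(P Y + R Y + 2 * S Y) = Y 0
    linarith
  · change (P Y + S Y) ^ 2 + (R Y + S Y) ^ 2 + 2 * S Y * (P Y + R Y + 2 * T Y) = Y 1
    linarith
  · change (Y 2 + δ Y) / 2 + (Y 2 - δ Y) / 2 = Y 2
    ring
  · change (Y 2 + δ Y) / 2 * (P Y + S Y) + (Y 2 - δ Y) / 2 * (R Y + S Y) = Y 3
    linear_combination (Y 2 / 2) * hPR + (δ Y / 2) * hPR' + (1 / 2) * hmδ
  · change 2 * S Y * ((Y 2 + δ Y) / 2 - (Y 2 - δ Y) / 2) ^ 2 = Y 4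
    linear_combination hSD
  · change ((Y 2 + δ Y) / 2) ^ 2 + ((Y 2 - δ Y) / 2) ^ 2 = Y 5
    linear_combination (1 / 2) * eδ

end Density

section PolynomialFunctions

open MvPolynomial

/-- The algebra of polynomial functions on `ℝᵐ`. -/
noncomputable def polyFunctions (m : ℕ) : Subalgebra ℝ ((Fin m → ℝ) → ℝ) :=
  (aeval fun (i : Fin m) (u : Fin m → ℝ) => u i).range

lemma mem_polyFunctions {m : ℕ} {f : (Fin m → ℝ) → ℝ} :
    f ∈ polyFunctions m ↔ ∃ p : MvPolynomial (Fin m) ℝ, f = fun u => eval u p := by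
  have h : ∀ p : MvPolynomial (Fin m) ℝ,
      aeval (fun (i : Fin m) (u : Fin m → ℝ) => u i) p = fun u => eval u p := by
    intro p
    induction p using MvPolynomial.induction_on with
    | C a => funext u; simp
    | add p q hp hq => funext u; simp [hp, hq]
    | mul_X p i hp => funext u; simp [hp]
  simp only [polyFunctions, AlgHom.mem_range, h, eq_comm]

lemma coord_mem_polyFunctions {m : ℕ} (i : Fin m) : (fun u => u i) ∈ polyFunctions m :=
  mem_polyFunctions.2 ⟨X i, by simp⟩

lemma triInvts_mem_polyFunctions (i : Fin 6) : (fun u => triInvts u i) ∈ polyFunctions 6 := by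
  refine mem_polyFunctions.2 ⟨![-(X 0 ^ 2 + X 1 ^ 2), X 0 ^ 4 + X 1 ^ 4,
    X 2 ^ 2 + (X 4 ^ 2 + X 5 ^ 2 + X 3 ^ 2),
    X 0 ^ 2 * X 2 ^ 2 + X 1 ^ 2 * (X 4 ^ 2 + X 5 ^ 2 + X 3 ^ 2),
    2 * X 2 ^ 2 * ((X 0 - X 1) ^ 2 * X 4 ^ 2 + (X 0 + X 1) ^ 2 * X 5 ^ 2),
    X 2 ^ 4 + (X 4 ^ 2 + X 5 ^ 2 + X 3 ^ 2) ^ 2 + 2 * X 2 ^ 2 * (X 4 ^ 2 + X 5 ^ 2)] i, ?_⟩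
  funext u
  fin_cases i <;> simp [triInvts]

/-- A polynomial function vanishing where another nonzero polynomial function does not vanish
is zero. -/
lemma eq_zero_of_pow_mul_eq_zero {m : ℕ} {f g : (Fin m → ℝ) → ℝ} (hf : f ∈ polyFunctions m)
    (hg : g ∈ polyFunctions m) (hg0 : g ≠ 0) {M : ℕ} (h : ∀ u, g u ^ M * f u = 0) : f = 0 := by
  obtain ⟨p, rfl⟩ := mem_polyFunctions.1 hf
  obtain ⟨q, rfl⟩ := mem_polyFunctions.1 hg
  have hq : q ≠ 0 := by
    rintro rfl
    exact hg0 (by funext u; simp)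
  have : q ^ M * p = 0 := MvPolynomial.funext fun u => by simpa using h u
  have hp : p = 0 := (mul_eq_zero.1 this).resolve_left (pow_ne_zero _ hq)
  funext u
  simp [hp]

end PolynomialFunctions

section Main

variable {n : ℕ}

/-- A polynomial function which is constant on orbits is a polynomial in the generators. -/
lemma exists_polynomial_of_invariant (hn : 2 ≤ n)
    {F : Matrix (Fin 2) (Fin n) ℍ[ℝ] → Matrix (Fin 2) (Fin 2) ℍ[ℝ] → ℝ}
    {p : MvPolynomial (Fin 2 × Fin n × Fin 4 ⊕ Fin 2 × Fin 2 × Fin 4) ℝ}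
    (hF : ∀ v z, z.conjTranspose = -z → F v z = MvPolynomial.eval (realCoords v z) p)
    (hinv : ∀ v z v' z', z.conjTranspose = -z → OrbitRel v z v' z' → F v' z' = F v z) :
    ∃ Q : MvPolynomial (Fin 6) ℝ, ∀ v z, z.conjTranspose = -z →
      F v z = MvPolynomial.eval (invts v z) Q := by
  obtain ⟨G₁, N, h₁⟩ := exists_numerator_denomV hn hF hinv
  obtain ⟨G₂, M, h₂⟩ := exists_numerator_denomZ hn hF hinv
  have hG : G₁ * denomZ ^ M = G₂ * denomV ^ N := by
    obtain ⟨y₀, hy⟩ := exists_eventually_diagInvts_eq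
    refine mvPolynomial_eq_of_eventually (y := y₀) (hy.mono ?_)
    rintro _ ⟨u, rfl⟩
    have hI : diagInvts u = invts (diagSlice (u 0) (u 1) * colEmbed n)
        (skewSlice (u 2) (u 3) (u 4) (u 5)) := by
      rw [invts_colEmbed hn, invts_diagSlice_skewSlice]
      rfl
    have hz := skewSlice_conjTranspose (u 2) (u 3) (u 4) (u 5)
    simp only [map_mul, map_pow, hI, ← h₁ _ _ hz, ← h₂ _ _ hz]
    ring
  obtain ⟨Q, rfl⟩ : denomZ ^ M ∣ G₂ :=
    (isRelPrime_denomZ_denomV.pow (m := M) (n := N)).dvd_of_dvd_mul_right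
      ⟨G₁, hG.symm.trans (mul_comm _ _)⟩
  refine ⟨Q, ?_⟩
  set f : (Fin 6 → ℝ) → ℝ := fun u =>
    F (triSlice (u 2) (u 3) (u 4) (u 5) * colEmbed n) (torusSlice (u 0) (u 1)) with hf
  have hI : ∀ u : Fin 6 → ℝ, invts (triSlice (u 2) (u 3) (u 4) (u 5) * colEmbed n)
      (torusSlice (u 0) (u 1)) = triInvts u := by
    intro u
    rw [invts_colEmbed hn, invts_triSlice_torusSlice]
    rfl
  have mf : f ∈ polyFunctions 6 := by
    have : f = fun u => MvPolynomial.eval (realCoords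
        (triSlice (u 2) (u 3) (u 4) (u 5) * colEmbed n) (torusSlice (u 0) (u 1))) p :=
      funext fun u => hF _ _ (torusSlice_conjTranspose _ _)
    rw [this]
    refine eval_mem_subalgebra _ p _ (realCoords_mem _
      (fun u : Fin 6 → ℝ => triSlice (u 2) (u 3) (u 4) (u 5))
      (fun u : Fin 6 → ℝ => torusSlice (u 0) (u 1)) ?_)
    rintro (⟨i, j, k⟩ | ⟨i, j, k⟩) <;> fin_cases i <;> fin_cases j <;> fin_cases k <;>
      first
      | exact (polyFunctions 6).zero_mem
      | exact coord_mem_polyFunctions _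
  have hzero := eq_zero_of_pow_mul_eq_zero (M := M)
    (sub_mem mf (eval_mem_subalgebra _ Q triInvts triInvts_mem_polyFunctions))
    (eval_mem_subalgebra _ denomZ triInvts triInvts_mem_polyFunctions)
    (fun h => eval_triInvts_denomZ_ne_zero (congrFun h ![2, 1, 1, 1, 0, 0]))
    (fun u => by
      have := h₂ (triSlice (u 2) (u 3) (u 4) (u 5) * colEmbed n) (torusSlice (u 0) (u 1))
        (torusSlice_conjTranspose _ _)
      rw [hI, map_mul, map_pow] at this
      rw [Pi.sub_apply, mul_sub, sub_eq_zero]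
      exact this)
  intro v z hz
  obtain ⟨v', a, b, h⟩ := exists_orbitRel_torusSlice v hz
  obtain ⟨α, β, c, d, h'⟩ := orbitRel_torusSlice_triSlice hn v' a b
  have h'' := h.trans h'
  rw [← hinv _ _ _ _ hz h'', ← h''.invts_eq]
  have := congrFun hzero ![a, b, α, β, c, d]
  rw [Pi.sub_apply, ← hI] at this
  exact sub_eq_zero.1 this

end Main

/-- **`Sp(2) × Sp(n)`-invariants on `(ℍ² ⊗ ℍⁿ) ⊕ 𝔰𝔭(2)`, `n ≥ 2`.**
Every real polynomial function on `M_{2×n}(ℍ) × 𝔰𝔭(2)` invariant under the action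
`(k₁,k₂)·(v,z) = (k₁ v k₂*, k₁ z k₁*)` of `Sp(2) × Sp(n)` belongs to the `ℝ`-subalgebra
generated by `Re tr(z²)`, `Re tr(z⁴)`, `Re tr(vv*)`, `Re tr(zv(zv)*)`,
`Re tr((zvv* - vv*z)²)`, `Re tr((vv*)²)`. -/
theorem Sp2_Spn_invariants (n : ℕ) (hn : 2 ≤ n)
    (F : Matrix (Fin 2) (Fin n) (Quaternion ℝ) → Matrix (Fin 2) (Fin 2) (Quaternion ℝ) → ℝ)
    (hpoly : ∃ p : MvPolynomial (Fin 2 × Fin n × Fin 4 ⊕ Fin 2 × Fin 2 × Fin 4) ℝ,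
      ∀ (v : Matrix (Fin 2) (Fin n) (Quaternion ℝ))
        (z : Matrix (Fin 2) (Fin 2) (Quaternion ℝ)), z.conjTranspose = -z →
        F v z = MvPolynomial.eval
          (Sum.elim
            (fun q => ![(v q.1 q.2.1).re, (v q.1 q.2.1).imI,
              (v q.1 q.2.1).imJ, (v q.1 q.2.1).imK] q.2.2)
            fun q => ![(z q.1 q.2.1).re, (z q.1 q.2.1).imI,
              (z q.1 q.2.1).imJ, (z q.1 q.2.1).imK] q.2.2) p)
    (hinv : ∀ (k₁ : Matrix (Fin 2) (Fin 2) (Quaternion ℝ))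
        (k₂ : Matrix (Fin n) (Fin n) (Quaternion ℝ)),
      k₁ * k₁.conjTranspose = 1 → k₂ * k₂.conjTranspose = 1 →
      ∀ (v : Matrix (Fin 2) (Fin n) (Quaternion ℝ))
        (z : Matrix (Fin 2) (Fin 2) (Quaternion ℝ)), z.conjTranspose = -z →
        F (k₁ * v * k₂.conjTranspose) (k₁ * z * k₁.conjTranspose) = F v z) :
    ∃ Q : MvPolynomial (Fin 6) ℝ,
      ∀ (v : Matrix (Fin 2) (Fin n) (Quaternion ℝ))
        (z : Matrix (Fin 2) (Fin 2) (Quaternion ℝ)), z.conjTranspose = -z →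
        F v z = MvPolynomial.eval
          ![(Matrix.trace (z ^ 2)).re, (Matrix.trace (z ^ 4)).re,
            (Matrix.trace (v * v.conjTranspose)).re,
            (Matrix.trace (z * v * (z * v).conjTranspose)).re,
            (Matrix.trace ((z * v * v.conjTranspose - v * v.conjTranspose * z) ^ 2)).re,
            (Matrix.trace ((v * v.conjTranspose) ^ 2)).re] Q := by
  obtain ⟨p, hp⟩ := hpoly
  refine exists_polynomial_of_invariant hn hp ?_
  rintro v z _ _ hz ⟨k₁, hk₁, k₂, hk₂, rfl, rfl⟩
  exact hinv k₁ k₂ (Unitary.mul_star_self_of_mem hk₁) (Unitary.mul_star_self_of_mem hk₂) v z hz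
end
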